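/- arXiv:0812.2656 — 6 statements merged into one kernel-verified Lean document; each statement's English description precedes it below -/
import Mathlib

section
/- Fix the normalizing function p = 1/n. Let κ be a symmetric measurable function on [0,1]² with 0 < ∫_{[0,1]²} κ < ∞, and let (G_n) be a sequence of graphs with |G_n| = n. Then the cut distance d_□(κ_{G_n}, κ) is bounded away from zero, i.e. liminf_{n→∞} d_□(κ_{G_n}, κ) > 0. -/
open MeasureTheory Set Filter

noncomputable section
open scoped Classical

/-- The kernel `κ_G : [0,1]² → [0,∞)` associated to a graph `G` on `n` vertices,
with normalizing function `p = 1/n`: it takes the constant value `n` on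
`I_i × I_j` whenever `ij` is an edge of `G`, and `0` otherwise; here vertices
are indexed from `0`, so `I_i = (i/n, (i+1)/n]`. -/
def graphKernel (n : ℕ) (G : SimpleGraph (Fin n)) (x y : ℝ) : ℝ :=
  if ∃ i j : Fin n, G.Adj i j ∧ x ∈ Set.Ioc ((i : ℝ) / n) (((i : ℝ) + 1) / n) ∧
      y ∈ Set.Ioc ((j : ℝ) / n) (((j : ℝ) + 1) / n) then (n : ℝ) else 0

/-- The cut norm `‖W‖_□ = sup_{S,T ⊆ [0,1] measurable} |∫_{S×T} W|`. -/
def cutNorm (W : ℝ → ℝ → ℝ) : ℝ :=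
  sSup { r : ℝ | ∃ S T : Set ℝ, MeasurableSet S ∧ MeasurableSet T ∧
    S ⊆ Set.Icc 0 1 ∧ T ⊆ Set.Icc 0 1 ∧ r = |∫ x in S, ∫ y in T, W x y| }

/-- `τ` is a measure-preserving bijection of `[0,1]`. -/
def IsMPBij (τ : ℝ → ℝ) : Prop :=
  Set.BijOn τ (Set.Icc 0 1) (Set.Icc 0 1) ∧
    MeasurePreserving τ (volume.restrict (Set.Icc (0:ℝ) 1))
      (volume.restrict (Set.Icc (0:ℝ) 1))

/-- The cut metric `d_□(κ₁, κ₂) = inf_τ ‖κ₁ - κ₂^{(τ)}‖_□`, the infimum over all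
measure-preserving bijections `τ` of `[0,1]`, where `κ₂^{(τ)}(x,y) = κ₂(τ(x), τ(y))`. -/
def cutDist (κ₁ κ₂ : ℝ → ℝ → ℝ) : ℝ :=
  sInf { r : ℝ | ∃ τ : ℝ → ℝ, IsMPBij τ ∧
    r = cutNorm (fun x y => κ₁ x y - κ₂ (τ x) (τ y)) }

/-- `κ` is a kernel: a symmetric, measurable, nonnegative function on `[0,1]²`,
integrable on `[0,1]²` (so `∫ κ < ∞`). -/
def IsKernel (κ : ℝ → ℝ → ℝ) : Prop :=
  Measurable (Function.uncurry κ) ∧ (∀ x y, κ x y = κ y x) ∧ (∀ x y, 0 ≤ κ x y) ∧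
    IntegrableOn (Function.uncurry κ) (Set.Icc 0 1 ×ˢ Set.Icc 0 1)

/-- Lebesgue measure on `[0,1]`. -/
abbrev unitVolume : Measure ℝ := volume.restrict (Icc (0 : ℝ) 1)

instance : IsProbabilityMeasure unitVolume := ⟨by simp [unitVolume]⟩

theorem unitVolume_prod_eq :
    unitVolume.prod unitVolume = volume.restrict (Icc (0 : ℝ) 1 ×ˢ Icc (0 : ℝ) 1) := by
  rw [unitVolume, Measure.prod_restrict, ← Measure.volume_eq_prod]

theorem abs_integral_prod_le_cutNorm {W : ℝ → ℝ → ℝ}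
    (hW : Integrable (Function.uncurry W) (unitVolume.prod unitVolume)) {S T : Set ℝ}
    (hS : MeasurableSet S) (hT : MeasurableSet T) (hS1 : S ⊆ Icc 0 1) (hT1 : T ⊆ Icc 0 1) :
    |∫ q in S ×ˢ T, Function.uncurry W q ∂(unitVolume.prod unitVolume)| ≤ cutNorm W := by
  have key : ∀ S T : Set ℝ, MeasurableSet S → MeasurableSet T → S ⊆ Icc 0 1 → T ⊆ Icc 0 1 →
      ∫ x in S, ∫ y in T, W x y
        = ∫ q in S ×ˢ T, Function.uncurry W q ∂(unitVolume.prod unitVolume) := by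
    intro S T hS hT hS1 hT1
    rw [setIntegral_prod _ hW.integrableOn, unitVolume,
      Measure.restrict_restrict_of_subset hS1, Measure.restrict_restrict_of_subset hT1]
    rfl
  refine le_csSup ⟨∫ q, |Function.uncurry W q| ∂(unitVolume.prod unitVolume), ?_⟩
    ⟨S, T, hS, hT, hS1, hT1, by rw [key S T hS hT hS1 hT1]⟩
  rintro r ⟨S, T, hS, hT, hS1, hT1, rfl⟩
  rw [key S T hS hT hS1 hT1]
  exact abs_integral_le_integral_abs.trans
    (setIntegral_le_integral hW.abs (Eventually.of_forall fun q => abs_nonneg _))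

/-- The interval `(v/n, (v+1)/n]` representing the vertex `v`. -/
def vertexBlock (n : ℕ) (v : Fin n) : Set ℝ := Ioc ((v : ℝ) / n) (((v : ℝ) + 1) / n)

theorem measurableSet_vertexBlock (n : ℕ) (v : Fin n) : MeasurableSet (vertexBlock n v) :=
  measurableSet_Ioc

theorem vertexBlock_subset {n : ℕ} (v : Fin n) : vertexBlock n v ⊆ Icc 0 1 := by
  have hn : (0 : ℝ) < n := by exact_mod_cast v.pos
  rintro x ⟨h1, h2⟩
  refine ⟨(by positivity : (0 : ℝ) ≤ (v : ℝ) / n).trans h1.le, h2.trans ?_⟩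
  rw [div_le_one hn]
  exact_mod_cast v.isLt

theorem unitVolume_real_vertexBlock {n : ℕ} (v : Fin n) :
    unitVolume.real (vertexBlock n v) = 1 / n := by
  rw [measureReal_restrict_apply (measurableSet_vertexBlock n v),
    inter_eq_left.2 (vertexBlock_subset v), vertexBlock, Real.volume_real_Ioc_of_le (by gcongr; simp)]
  ring

theorem eq_of_mem_vertexBlock {n : ℕ} {v w : Fin n} {x : ℝ} (hv : x ∈ vertexBlock n v)
    (hw : x ∈ vertexBlock n w) : v = w := by
  have hn : (0 : ℝ) < n := by exact_mod_cast v.pos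
  obtain ⟨h1, h2⟩ := hv
  obtain ⟨h3, h4⟩ := hw
  have h5 := h1.trans_le h4
  have h6 := h3.trans_le h2
  rw [div_lt_div_iff_of_pos_right hn] at h5 h6
  norm_cast at h5 h6
  omega

theorem exists_mem_vertexBlock {n : ℕ} (hn : 0 < n) {x : ℝ} (hx : x ∈ Ioc (0 : ℝ) 1) :
    ∃ v : Fin n, x ∈ vertexBlock n v := by
  have hn' : (0 : ℝ) < n := by exact_mod_cast hn
  have hpos : 0 < ⌈n * x⌉₊ := Nat.ceil_pos.2 (mul_pos hn' hx.1)
  have hle : ⌈n * x⌉₊ ≤ n := Nat.ceil_le.2 (by nlinarith [hx.2])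
  obtain ⟨m, hm⟩ : ∃ m, ⌈n * x⌉₊ = m + 1 := ⟨_, (Nat.succ_pred_eq_of_pos hpos).symm⟩
  have h1 : n * x ≤ (m : ℝ) + 1 := by
    have := Nat.le_ceil (n * x)
    rw [hm] at this
    exact_mod_cast this
  have h2 : (m : ℝ) < n * x := Nat.lt_ceil.1 (by omega)
  refine ⟨⟨m, by omega⟩, ?_, ?_⟩
  · rw [div_lt_iff₀ hn']; simpa [mul_comm] using h2
  · rw [le_div_iff₀ hn']; simpa [mul_comm] using h1

/-- The union of the intervals representing the vertices in `A`. -/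
def vertexUnion {n : ℕ} (A : Finset (Fin n)) : Set ℝ := ⋃ v ∈ A, vertexBlock n v

theorem measurableSet_vertexUnion {n : ℕ} (A : Finset (Fin n)) :
    MeasurableSet (vertexUnion A) :=
  A.measurableSet_biUnion fun v _ => measurableSet_vertexBlock n v

theorem vertexUnion_subset {n : ℕ} (A : Finset (Fin n)) : vertexUnion A ⊆ Icc 0 1 :=
  iUnion₂_subset fun v _ => vertexBlock_subset v

theorem unitVolume_real_vertexUnion_le {n : ℕ} (A : Finset (Fin n)) :
    unitVolume.real (vertexUnion A) ≤ A.card / n := by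
  refine (measureReal_biUnion_finset_le A (vertexBlock n)).trans (le_of_eq ?_)
  simp only [unitVolume_real_vertexBlock, Finset.sum_const, nsmul_eq_mul]
  ring

theorem uncurry_graphKernel (n : ℕ) (G : SimpleGraph (Fin n)) :
    Function.uncurry (graphKernel n G) = fun q => ∑ v : Fin n, ∑ w ∈ {w | G.Adj v w},
      (vertexBlock n v ×ˢ vertexBlock n w).indicator (fun _ => (n : ℝ)) q := by
  ext ⟨x, y⟩
  simp only [Function.uncurry_apply_pair, graphKernel]
  split_ifs with h
  · obtain ⟨i, j, hij, hi, hj⟩ := h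
    rw [Finset.sum_eq_single i, Finset.sum_eq_single j]
    · exact (indicator_of_mem (s := vertexBlock n i ×ˢ vertexBlock n j)
        (mk_mem_prod hi hj) fun _ => (n : ℝ)).symm
    · intro w _ hw
      exact indicator_of_notMem (fun h => hw (eq_of_mem_vertexBlock h.2 hj)) _
    · intro h
      simp [hij] at h
    · intro v _ hv
      exact Finset.sum_eq_zero fun w _ =>
        indicator_of_notMem (fun h => hv (eq_of_mem_vertexBlock h.1 hi)) _
    · simp
  · symm
    refine Finset.sum_eq_zero fun v _ => Finset.sum_eq_zero fun w hw =>
      indicator_of_notMem (fun hm => h ⟨v, w, by simpa using hw, hm.1, hm.2⟩) _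

theorem integrable_indicator_prod {S T : Set ℝ} (hS : MeasurableSet S) (hT : MeasurableSet T)
    (c : ℝ) : Integrable ((S ×ˢ T).indicator fun _ => c) (unitVolume.prod unitVolume) :=
  (integrable_const c).indicator (hS.prod hT)

theorem integral_indicator_prod {S T : Set ℝ} (hS : MeasurableSet S) (hT : MeasurableSet T)
    (c : ℝ) : ∫ q, (S ×ˢ T).indicator (fun _ => c) q ∂(unitVolume.prod unitVolume)
      = unitVolume.real S * unitVolume.real T * c := by
  rw [integral_indicator_const c (hS.prod hT), measureReal_prod_prod, smul_eq_mul]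

theorem integrable_graphKernel (n : ℕ) (G : SimpleGraph (Fin n)) :
    Integrable (Function.uncurry (graphKernel n G)) (unitVolume.prod unitVolume) := by
  rw [uncurry_graphKernel]
  exact integrable_finsetSum _ fun v _ => integrable_finsetSum _ fun w _ =>
    integrable_indicator_prod (measurableSet_vertexBlock n v) (measurableSet_vertexBlock n w) _

theorem integral_graphKernel {n : ℕ} (hn : 0 < n) (G : SimpleGraph (Fin n)) :
    ∫ q, Function.uncurry (graphKernel n G) q ∂(unitVolume.prod unitVolume)
      = (∑ v : Fin n, (Finset.card {w | G.Adj v w} : ℝ)) / n := by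
  have hn' : (n : ℝ) ≠ 0 := by positivity
  have hI : ∀ v w : Fin n, Integrable ((vertexBlock n v ×ˢ vertexBlock n w).indicator
      fun _ => (n : ℝ)) (unitVolume.prod unitVolume) := fun v w =>
    integrable_indicator_prod (measurableSet_vertexBlock n v) (measurableSet_vertexBlock n w) _
  rw [uncurry_graphKernel, integral_finsetSum _ fun v _ => integrable_finsetSum _ fun w _ => hI v w,
    Finset.sum_div]
  refine Finset.sum_congr rfl fun v _ => ?_
  rw [integral_finsetSum _ fun w _ => hI v w, Finset.sum_congr rfl fun w _ =>
    integral_indicator_prod (measurableSet_vertexBlock n v) (measurableSet_vertexBlock n w) _]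
  simp only [unitVolume_real_vertexBlock, Finset.sum_const, nsmul_eq_mul]
  field_simp

/-- The `i`-th of the consecutive groups of `m` vertices. -/
def vertexClass (n m i : ℕ) : Finset (Fin n) := {v | (v : ℕ) / m = i}

/-- The vertices adjacent to some vertex of `A`. -/
def vertexNeighbors {n : ℕ} (G : SimpleGraph (Fin n)) (A : Finset (Fin n)) : Finset (Fin n) :=
  A.biUnion fun v => {w | G.Adj v w}

theorem card_vertexClass_le {n m : ℕ} (hm : 0 < m) (i : ℕ) : (vertexClass n m i).card ≤ m := by
  have h : (vertexClass n m i).map Fin.valEmbedding ⊆ Finset.Ico (i * m) (i * m + m) := by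
    intro a ha
    simp only [vertexClass, Finset.mem_map, Finset.mem_filter, Finset.mem_univ, true_and,
      Fin.valEmbedding_apply] at ha
    obtain ⟨v, hv, rfl⟩ := ha
    rw [Nat.div_eq_iff hm] at hv
    rw [Finset.mem_Ico]
    omega
  simpa using Finset.card_le_card h

theorem sum_card_vertexNeighbors_le {n m : ℕ} (k : ℕ) (G : SimpleGraph (Fin n)) :
    ∑ i ∈ Finset.range k, (vertexNeighbors G (vertexClass n m i)).card
      ≤ ∑ v : Fin n, Finset.card {w | G.Adj v w} := by
  refine (Finset.sum_le_sum fun i _ => Finset.card_biUnion_le).trans ?_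
  rw [← Finset.sum_biUnion]
  · exact Finset.sum_le_sum_of_subset (Finset.subset_univ _)
  · intro i _ j _ hij
    rw [Function.onFun, Finset.disjoint_left]
    intro v hv hw
    simp only [vertexClass, Finset.mem_filter] at hv hw
    exact hij (hv.2.symm.trans hw.2)

theorem graphKernel_eq_zero {n : ℕ} (G : SimpleGraph (Fin n)) (A : Finset (Fin n)) {x y : ℝ}
    (hx : x ∈ vertexUnion A) (hy : y ∉ vertexUnion (vertexNeighbors G A)) :
    graphKernel n G x y = 0 := by
  refine if_neg ?_
  rintro ⟨i, j, hij, hi, hj⟩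
  simp only [vertexUnion, mem_iUnion] at hx hy
  obtain ⟨v, hv, hxv⟩ := hx
  obtain rfl := eq_of_mem_vertexBlock hi hxv
  exact hy ⟨j, by simpa [vertexNeighbors] using ⟨i, hv, hij⟩, hj⟩

theorem ae_prod_mem_Ioc : ∀ᵐ q ∂(unitVolume.prod unitVolume),
    q.1 ∈ Ioc (0 : ℝ) 1 ∧ q.2 ∈ Icc (0 : ℝ) 1 := by
  have h1 : ∀ᵐ x ∂unitVolume, x ∈ Ioc (0 : ℝ) 1 := by
    rw [unitVolume, ← Measure.restrict_congr_set Ioc_ae_eq_Icc]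
    exact ae_restrict_mem measurableSet_Ioc
  have h2 : ∀ᵐ x ∂unitVolume, x ∈ Icc (0 : ℝ) 1 := ae_restrict_mem measurableSet_Icc
  filter_upwards [Measure.quasiMeasurePreserving_fst.ae h1,
    Measure.quasiMeasurePreserving_snd.ae h2] with q hq1 hq2 using ⟨hq1, hq2⟩

/-- If the rectangles `S × T` see at most `ε` of the difference between the kernel of `G` and `f`,
then the mass of `f` is controlled by `ε` and by the mass of `f` above the level `K`. -/
theorem integral_le_of_cut_le {n k : ℕ} (hk : 0 < k) (hkn : k ≤ n) (G : SimpleGraph (Fin n))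
    {f : ℝ × ℝ → ℝ} (hf0 : ∀ q, 0 ≤ f q) (hf : Integrable f (unitVolume.prod unitVolume))
    {K ε : ℝ} (hK : 0 ≤ K)
    (hcut : ∀ S T : Set ℝ, MeasurableSet S → MeasurableSet T → S ⊆ Icc 0 1 → T ⊆ Icc 0 1 →
      |∫ q in S ×ˢ T, (Function.uncurry (graphKernel n G) q - f q)
        ∂(unitVolume.prod unitVolume)| ≤ ε) :
    ∫ q, f q ∂(unitVolume.prod unitVolume)
      ≤ ∫ q, max (f q - K) 0 ∂(unitVolume.prod unitVolume) + k * ε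
        + K * (2 / k * (∫ q, f q ∂(unitVolume.prod unitVolume) + ε)) := by
  set ν := unitVolume.prod unitVolume with hν
  have hn : 0 < n := hk.trans_le hkn
  have hn' : (0 : ℝ) < n := by exact_mod_cast hn
  have hk' : (0 : ℝ) < k := by exact_mod_cast hk
  set m := n / k + 1 with hm
  have hm0 : 0 < m := Nat.succ_pos _
  have hmn : (m : ℝ) ≤ 2 / k * n := by
    have h1 : ((n / k : ℕ) : ℝ) ≤ n / k := Nat.cast_div_le
    have h2 : (1 : ℝ) ≤ n / k := by rw [one_le_div hk']; exact_mod_cast hkn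
    rw [hm]; push_cast
    calc ((n / k : ℕ) : ℝ) + 1 ≤ n / k + n / k := by linarith
      _ = 2 / k * n := by ring
  set S : ℕ → Set ℝ := fun i => vertexUnion (vertexClass n m i) with hS
  set N : ℕ → Finset (Fin n) := fun i => vertexNeighbors G (vertexClass n m i) with hN
  set R : ℕ → Set ℝ := fun i => vertexUnion (N i) with hR
  have hSm : ∀ i, MeasurableSet (S i) := fun i => measurableSet_vertexUnion _
  have hRm : ∀ i, MeasurableSet (R i) := fun i => measurableSet_vertexUnion _
  have hTm : ∀ i, MeasurableSet (Icc 0 1 \ R i) := fun i => measurableSet_Icc.diff (hRm i)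
  have hpt : ∀ᵐ q ∂ν, f q ≤ max (f q - K) 0
      + ∑ i ∈ Finset.range k, (S i ×ˢ (Icc 0 1 \ R i)).indicator f q
      + ∑ i ∈ Finset.range k, (S i ×ˢ R i).indicator (fun _ => K) q := by
    filter_upwards [ae_prod_mem_Ioc] with q hq
    obtain ⟨v, hv⟩ := exists_mem_vertexBlock hn hq.1
    have hi : (v : ℕ) / m ∈ Finset.range k := by
      rw [Finset.mem_range, Nat.div_lt_iff_lt_mul hm0]
      exact v.isLt.trans (Nat.lt_mul_div_succ n hk)
    have hqS : q.1 ∈ S (v / m) := by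
      simp only [hS, vertexUnion, mem_iUnion]
      exact ⟨v, by simp [vertexClass], hv⟩
    have h1 : ∀ i ∈ Finset.range k, 0 ≤ (S i ×ˢ (Icc 0 1 \ R i)).indicator f q :=
      fun i _ => indicator_nonneg (fun q _ => hf0 q) q
    have h2 : ∀ i ∈ Finset.range k, 0 ≤ (S i ×ˢ R i).indicator (fun _ => K) q :=
      fun i _ => indicator_nonneg (fun _ _ => hK) q
    by_cases hqR : q.2 ∈ R (v / m)
    · have h3 := Finset.single_le_sum h2 hi
      rw [indicator_of_mem (show q ∈ S (v / m) ×ˢ R (v / m) from ⟨hqS, hqR⟩)] at h3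
      linarith [le_max_left (f q - K) 0, Finset.sum_nonneg h1]
    · have h3 := Finset.single_le_sum h1 hi
      rw [indicator_of_mem
        (show q ∈ S (v / m) ×ˢ (Icc 0 1 \ R (v / m)) from ⟨hqS, hq.2, hqR⟩)] at h3
      linarith [le_max_right (f q - K) 0, Finset.sum_nonneg h2]
  have hI1 : Integrable (fun q => max (f q - K) 0) ν := (hf.sub (integrable_const K)).pos_part
  have hI2 : ∀ i ∈ Finset.range k, Integrable ((S i ×ˢ (Icc 0 1 \ R i)).indicator f) ν :=
    fun i _ => hf.indicator ((hSm i).prod (hTm i))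
  have hI3 : ∀ i ∈ Finset.range k, Integrable ((S i ×ˢ R i).indicator fun _ => K) ν :=
    fun i _ => integrable_indicator_prod (hSm i) (hRm i) K
  have hint := integral_mono_ae hf
    ((hI1.add (integrable_finsetSum _ hI2)).add (integrable_finsetSum _ hI3)) hpt
  rw [integral_add' (hI1.add (integrable_finsetSum _ hI2)) (integrable_finsetSum _ hI3),
    integral_add' hI1 (integrable_finsetSum _ hI2), integral_finsetSum _ hI2,
    integral_finsetSum _ hI3] at hint
  have hfirst : ∑ i ∈ Finset.range k, ∫ q, (S i ×ˢ (Icc 0 1 \ R i)).indicator f q ∂ν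
      ≤ k * ε := by
    refine (Finset.sum_le_card_nsmul _ _ ε fun i _ => ?_).trans (by simp)
    rw [integral_indicator ((hSm i).prod (hTm i))]
    have h := hcut (S i) (Icc 0 1 \ R i) (hSm i) (hTm i) (vertexUnion_subset _) sdiff_subset
    rw [setIntegral_congr_fun (g := fun q => -f q) ((hSm i).prod (hTm i)), integral_neg,
      abs_neg] at h
    · exact (le_abs_self _).trans h
    · rintro ⟨x, y⟩ ⟨hx, hy⟩
      simp [graphKernel_eq_zero G _ hx hy.2]
  have hmass : (∑ v : Fin n, (Finset.card {w | G.Adj v w} : ℝ)) / n ≤ ∫ q, f q ∂ν + ε := by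
    have h := hcut (Icc 0 1) (Icc 0 1) measurableSet_Icc measurableSet_Icc subset_rfl subset_rfl
    rw [hν, ← Measure.prod_restrict, unitVolume, Measure.restrict_restrict_of_subset subset_rfl,
      integral_sub (integrable_graphKernel n G) hf, integral_graphKernel hn] at h
    linarith [(abs_le.1 h).2]
  have hsecond : ∑ i ∈ Finset.range k, ∫ q, (S i ×ˢ R i).indicator (fun _ => K) q ∂ν
      ≤ K * (2 / k * (∫ q, f q ∂ν + ε)) := by
    calc ∑ i ∈ Finset.range k, ∫ q, (S i ×ˢ R i).indicator (fun _ => K) q ∂ν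
        ≤ ∑ i ∈ Finset.range k, K * (2 / k) * ((N i).card / n) := by
          refine Finset.sum_le_sum fun i _ => ?_
          rw [integral_indicator_prod (hSm i) (hRm i)]
          have h1 : unitVolume.real (S i) ≤ 2 / k := by
            refine (unitVolume_real_vertexUnion_le _).trans ?_
            rw [div_le_iff₀ hn']
            exact (Nat.cast_le.2 (card_vertexClass_le hm0 i)).trans hmn
          have h2 : unitVolume.real (R i) ≤ (N i).card / n := unitVolume_real_vertexUnion_le _
          calc unitVolume.real (S i) * unitVolume.real (R i) * K
              ≤ 2 / k * ((N i).card / n) * K := by gcongr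
            _ = K * (2 / k) * ((N i).card / n) := by ring
      _ = K * (2 / k) * ((∑ i ∈ Finset.range k, ((N i).card : ℝ)) / n) := by
          rw [← Finset.mul_sum, Finset.sum_div]
      _ ≤ K * (2 / k) * ((∑ v : Fin n, (Finset.card {w | G.Adj v w} : ℝ)) / n) := by
          gcongr
          exact_mod_cast sum_card_vertexNeighbors_le k G
      _ ≤ K * (2 / k) * (∫ q, f q ∂ν + ε) := by gcongr
      _ = K * (2 / k * (∫ q, f q ∂ν + ε)) := by ring
  linarith

theorem tendsto_integral_max_sub_natCast {α : Type*} [MeasurableSpace α] {μ : Measure α}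
    {f : α → ℝ} (hf0 : ∀ q, 0 ≤ f q) (hf : Integrable f μ) :
    Tendsto (fun K : ℕ => ∫ q, max (f q - K) 0 ∂μ) atTop (nhds 0) := by
  have h := tendsto_integral_of_dominated_convergence (μ := μ) (F := fun (K : ℕ) q => max (f q - K) 0)
    (f := fun _ => 0) f
    (fun K => (hf.aestronglyMeasurable.sub aestronglyMeasurable_const).sup
      aestronglyMeasurable_const) hf
    (fun K => Eventually.of_forall fun q => by
      rw [Real.norm_of_nonneg (le_max_right _ _)]
      exact max_le (by linarith [(Nat.cast_nonneg K : (0 : ℝ) ≤ K)]) (hf0 q))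
    (Eventually.of_forall fun q => by
      refine tendsto_const_nhds.congr' ?_
      filter_upwards [eventually_ge_atTop ⌈f q⌉₊] with K hK
      rw [max_eq_right]
      linarith [Nat.ceil_le.1 hK])
  simpa using h

/-- With `p = 1/n`: if `κ` is a kernel (symmetric measurable, here with
`0 < ∫_{[0,1]²} κ < ∞`) and `(G_n)` is a sequence of graphs with `|G_n| = n`, then
`d_□(κ_{G_n}, κ)` is bounded away from zero, i.e. `liminf_{n→∞} d_□(κ_{G_n}, κ) > 0`:
there is `ε > 0` with `ε ≤ d_□(κ_{G_n}, κ)` for all large `n`. -/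
theorem cutDist_bounded_away_from_zero
    (κ : ℝ → ℝ → ℝ) (hκ : IsKernel κ)
    (hpos : 0 < ∫ q in (Set.Icc (0:ℝ) 1 ×ˢ Set.Icc (0:ℝ) 1), Function.uncurry κ q)
    (G : ∀ n : ℕ, SimpleGraph (Fin n)) :
    ∃ ε : ℝ, 0 < ε ∧ ∀ᶠ n in atTop, ε ≤ cutDist (graphKernel n (G n)) κ := by
  obtain ⟨-, -, hκ0, hκint⟩ := hκ
  rw [IntegrableOn, ← unitVolume_prod_eq] at hκint
  rw [← unitVolume_prod_eq] at hpos
  set ν := unitVolume.prod unitVolume with hν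
  set c := ∫ q, Function.uncurry κ q ∂ν with hc
  obtain ⟨K, hK⟩ := ((tendsto_integral_max_sub_natCast (f := Function.uncurry κ)
    (fun q => hκ0 q.1 q.2) hκint).eventually_lt_const (by positivity : 0 < c / 4)).exists
  obtain ⟨k, hk⟩ := exists_nat_gt (8 * K * (c + 1) / c)
  have hk' : (0 : ℝ) < k := lt_of_le_of_lt (by positivity) hk
  have hk0 : 0 < k := by exact_mod_cast hk'
  refine ⟨min 1 (c / (4 * k)), by positivity, ?_⟩
  filter_upwards [eventually_ge_atTop k] with n hn
  refine le_csInf ⟨_, id, ⟨bijOn_id _, MeasurePreserving.id _⟩, rfl⟩ ?_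
  rintro r ⟨τ, ⟨-, hτ⟩, rfl⟩
  by_contra! hlt
  set ε := min 1 (c / (4 * k)) with hε
  have hτ2 : MeasurePreserving (Prod.map τ τ) ν ν := hτ.prod hτ
  set f : ℝ × ℝ → ℝ := fun q => κ (τ q.1) (τ q.2) with hf
  have hfint : Integrable f ν := hτ2.integrable_comp_of_integrable hκint
  have hfc : ∫ q, f q ∂ν = c := by
    have h := integral_map hτ2.aemeasurable (f := Function.uncurry κ)
      (by rw [hτ2.map_eq]; exact hκint.aestronglyMeasurable)
    rw [hτ2.map_eq] at h
    exact h.symm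
  have hfK : ∫ q, max (f q - K) 0 ∂ν = ∫ q, max (Function.uncurry κ q - K) 0 ∂ν := by
    have h := integral_map hτ2.aemeasurable (f := fun q => max (Function.uncurry κ q - K) 0)
      (by
        rw [hτ2.map_eq]
        exact (hκint.aestronglyMeasurable.sub aestronglyMeasurable_const).sup
          aestronglyMeasurable_const)
    rw [hτ2.map_eq] at h
    exact h.symm
  have hmain := integral_le_of_cut_le hk0 hn (G n) (f := f) (fun q => hκ0 _ _) hfint
    (Nat.cast_nonneg K) (ε := ε) fun S T hS hT hS1 hT1 =>
      (abs_integral_prod_le_cutNorm (W := fun x y => graphKernel n (G n) x y - κ (τ x) (τ y))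
        ((integrable_graphKernel n (G n)).sub hfint) hS hT hS1 hT1).trans hlt.le
  rw [← hν, hfc, hfK] at hmain
  have h1 : k * ε ≤ c / 4 := by
    calc k * ε ≤ k * (c / (4 * k)) := by gcongr; exact min_le_right _ _
      _ = c / 4 := by field_simp
  have h2 : K * (2 / k * (c + ε)) ≤ c / 4 := by
    calc K * (2 / k * (c + ε)) ≤ K * (2 / k * (c + 1)) := by gcongr; exact min_le_left _ _
      _ = 8 * K * (c + 1) / (4 * k) := by ring
      _ ≤ c / 4 := by
        rw [div_lt_iff₀ hpos] at hk
        rw [div_le_div_iff₀ (by positivity) (by norm_num)]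
        linarith
  linarith
end
end

section
/- Fix the normalizing function p = 1/n. A sequence (G_n) of graphs with |G_n| = n is Cauchy with respect to the cut metric d_□ (i.e. for every ε > 0 there is N such that d_□(κ_{G_m}, κ_{G_n}) < ε for all m, n ≥ N) if and only if e(G_n) = o(n), i.e. e(G_n)/n → 0 as n → ∞. -/
open MeasureTheory Set Filter

noncomputable section
open scoped Classical

section Combinatorics

variable {V W : Type*} [Fintype V]

lemma card_filter_mem_mem (x z : V) :
    (((Finset.univ : Finset (Finset V)).filter fun S => x ∈ S ∧ z ∈ S).card : ℝ) =
      2 ^ Fintype.card V / 4 * (1 + if x = z then 1 else 0) := by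
  have h : (Finset.univ : Finset (Finset V)).filter (fun S => x ∈ S ∧ z ∈ S) =
      Finset.Icc {x, z} Finset.univ := by
    ext S
    simp [Finset.insert_subset_iff]
  rw [h, Finset.card_Icc_finset (Finset.subset_univ _), Finset.card_univ]
  have hc : ({x, z} : Finset V).card ≤ Fintype.card V := Finset.card_le_univ _
  push_cast
  rw [pow_sub₀ _ two_ne_zero hc]
  by_cases hxz : x = z
  · subst hxz
    simp
    ring
  · rw [Finset.card_pair hxz]
    simp [hxz]
    ring

/-- If all rectangle sums of a matrix are small, so is its sum along the graph of a function. -/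
lemma sum_apply_le_of_rectangle_sums_le (a : V → W → ℝ) (φ : W → V) (Y : Finset W) {ε : ℝ}
    (h : ∀ (S : Finset V) (T : Finset W), |∑ i ∈ S, ∑ j ∈ T, a i j| ≤ ε) :
    ∑ y ∈ Y, a (φ y) y ≤ 5 * ε := by
  have hsum : ∑ S : Finset V, ∑ x ∈ S, ∑ y ∈ Y.filter (fun y => φ y ∈ S), a x y =
      2 ^ Fintype.card V / 4 * (∑ x, ∑ y ∈ Y, a x y + ∑ y ∈ Y, a (φ y) y) := by
    calc ∑ S : Finset V, ∑ x ∈ S, ∑ y ∈ Y.filter (fun y => φ y ∈ S), a x y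
        = ∑ S : Finset V, ∑ x, ∑ y ∈ Y, if x ∈ S ∧ φ y ∈ S then a x y else 0 := by
          refine Finset.sum_congr rfl fun S _ => ?_
          rw [← Finset.sum_filter_add_sum_filter_not Finset.univ (fun x => x ∈ S)]
          rw [Finset.sum_eq_zero (s := Finset.univ.filter fun x => ¬ x ∈ S), add_zero]
          · simp only [Finset.filter_univ_mem]
            refine Finset.sum_congr rfl fun x hx => ?_
            simp [hx, Finset.sum_filter]
          · intro x hx
            simp [(Finset.mem_filter.1 hx).2]
      _ = ∑ x, ∑ y ∈ Y, a x y *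
            (((Finset.univ : Finset (Finset V)).filter fun S => x ∈ S ∧ φ y ∈ S).card : ℝ) := by
          rw [Finset.sum_comm]
          refine Finset.sum_congr rfl fun x _ => ?_
          rw [Finset.sum_comm]
          refine Finset.sum_congr rfl fun y _ => ?_
          rw [← Finset.sum_filter, Finset.sum_const, nsmul_eq_mul, mul_comm]
      _ = ∑ x, ∑ y ∈ Y, (2 ^ Fintype.card V / 4 * a x y +
            2 ^ Fintype.card V / 4 * (if x = φ y then a x y else 0)) := by
          refine Finset.sum_congr rfl fun x _ => Finset.sum_congr rfl fun y _ => ?_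
          rw [card_filter_mem_mem]
          split_ifs <;> ring
      _ = _ := by
          simp only [Finset.sum_add_distrib, ← Finset.mul_sum, mul_add]
          congr 2
          rw [Finset.sum_comm]
          simp
  have hle : ∑ S : Finset V, ∑ x ∈ S, ∑ y ∈ Y.filter (fun y => φ y ∈ S), a x y ≤
      2 ^ Fintype.card V * ε := by
    refine (Finset.sum_le_sum fun S _ => (le_abs_self _).trans (h S _)).trans ?_
    simp
  have htot := (abs_le.1 (h Finset.univ Y)).1
  have hpos : (0 : ℝ) < 2 ^ Fintype.card V := by positivity
  have : 2 ^ Fintype.card V * ((∑ x, ∑ y ∈ Y, a x y + ∑ y ∈ Y, a (φ y) y) / 4) ≤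
      2 ^ Fintype.card V * ε := by
    rw [hsum] at hle
    linarith
  have := le_of_mul_le_mul_left this hpos
  linarith

lemma sum_sum_adj_eq_two_mul_card_edgeSet (G : SimpleGraph V) :
    ∑ i, ∑ j, (if G.Adj i j then (1 : ℝ) else 0) = 2 * Nat.card G.edgeSet := by
  have h := G.two_mul_card_edgeFinset
  rw [Nat.card_eq_fintype_card, ← SimpleGraph.edgeFinset_card]
  have h' := congrArg (Nat.cast : ℕ → ℝ) h
  push_cast at h'
  rw [h', ← Finset.sum_product', Finset.sum_ite]
  simp

/-- The vertices incident to at least one edge. -/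
def nonisolated (G : SimpleGraph V) : Finset V :=
  Finset.univ.filter fun i => ∃ j, G.Adj j i

variable {G : SimpleGraph V} {u : V → V → ℝ} {c q ε : ℝ}

lemma card_nonisolated_le (hu : ∀ i j, u i j ≤ c)
    (h : ∀ S T : Finset V,
      |∑ i ∈ S, ∑ j ∈ T, (u i j - (if G.Adj i j then 1 else 0) * q)| ≤ ε) :
    ((nonisolated G).card : ℝ) * (q - c) ≤ 5 * ε := by
  have hex : ∀ i, ∃ j, i ∈ nonisolated G → G.Adj j i := by
    intro i
    by_cases hi : i ∈ nonisolated G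
    · obtain ⟨j, hj⟩ := (Finset.mem_filter.1 hi).2
      exact ⟨j, fun _ => hj⟩
    · exact ⟨i, fun h => absurd h hi⟩
  choose φ hφ using hex
  have key := sum_apply_le_of_rectangle_sums_le
    (fun i j => (if G.Adj i j then 1 else 0) * q - u i j) φ (nonisolated G) (ε := ε) (by
      intro S T
      rw [← abs_neg, ← Finset.sum_neg_distrib]
      simpa only [← Finset.sum_neg_distrib, neg_sub] using h S T)
  refine le_trans ?_ key
  rw [← nsmul_eq_mul]
  refine Finset.card_nsmul_le_sum _ _ _ fun i hi => ?_
  rw [if_pos (hφ i hi)]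
  linarith [hu (φ i) i]

lemma card_edgeSet_le (hu : ∀ i j, u i j ≤ c)
    (h : ∀ S T : Finset V,
      |∑ i ∈ S, ∑ j ∈ T, (u i j - (if G.Adj i j then 1 else 0) * q)| ≤ ε) :
    2 * (Nat.card G.edgeSet : ℝ) * q ≤ ε + c * ((nonisolated G).card : ℝ) ^ 2 := by
  have hsupp : ∑ i ∈ nonisolated G, ∑ j ∈ nonisolated G, (if G.Adj i j then (1 : ℝ) else 0) =
      2 * Nat.card G.edgeSet := by
    rw [← sum_sum_adj_eq_two_mul_card_edgeSet]
    rw [Finset.sum_subset (Finset.subset_univ (nonisolated G))]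
    · refine Finset.sum_congr rfl fun i _ => Finset.sum_subset (Finset.subset_univ _) ?_
      intro j _ hj
      refine if_neg fun hij => hj ?_
      simpa [nonisolated] using ⟨i, hij⟩
    · intro i _ hi
      refine Finset.sum_eq_zero fun j _ => if_neg fun hij => hi ?_
      simpa [nonisolated] using ⟨j, hij.symm⟩
  have h1 := (abs_le.1 (h (nonisolated G) (nonisolated G))).1
  simp only [Finset.sum_sub_distrib, ← Finset.sum_mul, hsupp] at h1
  have h2 : ∑ i ∈ nonisolated G, ∑ j ∈ nonisolated G, u i j ≤
      ∑ i ∈ nonisolated G, ∑ j ∈ nonisolated G, c :=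
    Finset.sum_le_sum fun i _ => Finset.sum_le_sum fun j _ => hu i j
  simp only [Finset.sum_const, nsmul_eq_mul] at h2
  linarith

end Combinatorics

section IteratedIntegrals

variable {F : ℝ → ℝ → ℝ} {C : ℝ} {S T : Set ℝ}

lemma integrableOn_of_subset_Icc {f : ℝ → ℝ} (hf : Measurable f) (hC : ∀ x, |f x| ≤ C)
    (hS : S ⊆ Icc 0 1) : IntegrableOn f S :=
  Measure.integrableOn_of_bounded (M := C)
    ((measure_mono hS).trans_lt measure_Icc_lt_top).ne hf.aestronglyMeasurable
    (Eventually.of_forall hC)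

lemma volume_real_le_one (hS : S ⊆ Icc 0 1) : volume.real S ≤ 1 := by
  simpa using measureReal_mono hS (measure_Icc_lt_top (μ := volume) (a := (0 : ℝ)) (b := 1)).ne

lemma abs_setIntegral_le {f : ℝ → ℝ} (hC : ∀ x, |f x| ≤ C) (hS : S ⊆ Icc 0 1) :
    |∫ x in S, f x| ≤ C := by
  have h := norm_setIntegral_le_of_norm_le_const (μ := volume) (f := f)
    ((measure_mono hS).trans_lt measure_Icc_lt_top) (fun x _ => hC x)
  have h0 : 0 ≤ C := (abs_nonneg _).trans (hC 0)
  exact h.trans (mul_le_of_le_one_right h0 (volume_real_le_one hS))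

lemma measurable_setIntegral (hF : Measurable (Function.uncurry F)) :
    Measurable fun x => ∫ y in T, F x y :=
  (hF.stronglyMeasurable.integral_prod_right (ν := volume.restrict T)).measurable

lemma setIntegral_setIntegral_sub {F' : ℝ → ℝ → ℝ} {C' : ℝ}
    (hF : Measurable (Function.uncurry F)) (hC : ∀ x y, |F x y| ≤ C)
    (hF' : Measurable (Function.uncurry F')) (hC' : ∀ x y, |F' x y| ≤ C')
    (hS : S ⊆ Icc 0 1) (hT : T ⊆ Icc 0 1) :
    ∫ x in S, ∫ y in T, (F x y - F' x y) =
      (∫ x in S, ∫ y in T, F x y) - ∫ x in S, ∫ y in T, F' x y := by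
  rw [← integral_sub]
  · congr 1
    ext x
    exact integral_sub (integrableOn_of_subset_Icc (hF.comp measurable_prodMk_left) (hC x) hT)
      (integrableOn_of_subset_Icc (hF'.comp measurable_prodMk_left) (hC' x) hT)
  · exact integrableOn_of_subset_Icc (measurable_setIntegral hF)
      (fun x => abs_setIntegral_le (hC x) hT) hS
  · exact integrableOn_of_subset_Icc (measurable_setIntegral hF')
      (fun x => abs_setIntegral_le (hC' x) hT) hS

lemma setIntegral_biUnion_setIntegral_biUnion {ι : Type*} {Q : ι → Set ℝ}
    (hF : Measurable (Function.uncurry F)) (hC : ∀ x y, |F x y| ≤ C)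
    (hQ : ∀ i, MeasurableSet (Q i)) (hQ' : ∀ i, Q i ⊆ Icc 0 1)
    (hd : Pairwise (Function.onFun Disjoint Q)) (A B : Finset ι) :
    ∫ x in ⋃ i ∈ A, Q i, ∫ y in ⋃ j ∈ B, Q j, F x y =
      ∑ i ∈ A, ∑ j ∈ B, ∫ x in Q i, ∫ y in Q j, F x y := by
  rw [integral_biUnion_finset A (fun i _ => hQ i) (fun i _ j _ hij => hd hij)]
  · refine Finset.sum_congr rfl fun i _ => ?_
    rw [← integral_finsetSum]
    · congr 1
      ext x
      exact integral_biUnion_finset B (fun i _ => hQ i) (fun i _ j _ hij => hd hij)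
        fun j _ => integrableOn_of_subset_Icc (hF.comp measurable_prodMk_left) (hC x) (hQ' j)
    · exact fun j _ => integrableOn_of_subset_Icc (measurable_setIntegral hF)
        (fun x => abs_setIntegral_le (hC x) (hQ' j)) (hQ' i)
  · exact fun i _ => integrableOn_of_subset_Icc (measurable_setIntegral hF)
      (fun x => abs_setIntegral_le (hC x) (iUnion₂_subset fun j _ => hQ' j)) (hQ' i)

lemma abs_setIntegral_setIntegral_le_cutNorm (hC : ∀ x y, |F x y| ≤ C)
    (hS : MeasurableSet S) (hT : MeasurableSet T) (hS' : S ⊆ Icc 0 1) (hT' : T ⊆ Icc 0 1) :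
    |∫ x in S, ∫ y in T, F x y| ≤ cutNorm F := by
  refine le_csSup ⟨C, ?_⟩ ⟨S, T, hS, hT, hS', hT', rfl⟩
  rintro r ⟨S', T', -, -, hS', hT', rfl⟩
  exact abs_setIntegral_le (fun x => abs_setIntegral_le (hC x) hT') hS'

lemma cutNorm_le (h : ∀ S T : Set ℝ, S ⊆ Icc 0 1 → T ⊆ Icc 0 1 →
    |∫ x in S, ∫ y in T, F x y| ≤ C) : cutNorm F ≤ C := by
  refine csSup_le ⟨_, ∅, ∅, .empty, .empty, empty_subset _, empty_subset _, rfl⟩ ?_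
  rintro r ⟨S, T, -, -, hS, hT, rfl⟩
  exact h S T hS hT

lemma cutNorm_nonneg (F : ℝ → ℝ → ℝ) : 0 ≤ cutNorm F := by
  refine Real.sSup_nonneg ?_
  rintro r ⟨S, T, -, -, -, -, rfl⟩
  exact abs_nonneg _

end IteratedIntegrals

section GraphKernel

variable {m n : ℕ} {G : SimpleGraph (Fin n)}

/-- The interval `(i/n, (i+1)/n]` of the vertex `i`. -/
def vertexInterval (n : ℕ) (i : Fin n) : Set ℝ :=
  Ioc ((i : ℝ) / n) (((i : ℝ) + 1) / n)

lemma measurableSet_vertexInterval (i : Fin n) : MeasurableSet (vertexInterval n i) :=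
  measurableSet_Ioc

lemma volume_vertexInterval (i : Fin n) :
    volume (vertexInterval n i) = ENNReal.ofReal (1 / n) := by
  rw [vertexInterval, Real.volume_Ioc]
  congr 1
  ring

lemma vertexInterval_subset_Icc (i : Fin n) : vertexInterval n i ⊆ Icc 0 1 := by
  have hn : (0 : ℝ) < n := by exact_mod_cast i.pos
  have hi : (i : ℝ) + 1 ≤ n := by exact_mod_cast i.isLt
  intro x hx
  exact ⟨(div_nonneg i.val.cast_nonneg hn.le).trans hx.1.le,
    hx.2.trans ((div_le_one hn).2 hi)⟩

lemma eq_of_mem_vertexInterval {i j : Fin n} {x : ℝ} (hi : x ∈ vertexInterval n i)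
    (hj : x ∈ vertexInterval n j) : i = j := by
  have hn : (0 : ℝ) < n := by exact_mod_cast i.pos
  have h1 := (div_lt_div_iff_of_pos_right hn).1 (hi.1.trans_le hj.2)
  have h2 := (div_lt_div_iff_of_pos_right hn).1 (hj.1.trans_le hi.2)
  have h1' : (i : ℕ) < j + 1 := by exact_mod_cast h1
  have h2' : (j : ℕ) < i + 1 := by exact_mod_cast h2
  exact Fin.ext (by omega)

lemma pairwise_disjoint_vertexInterval (n : ℕ) :
    Pairwise (Function.onFun Disjoint (vertexInterval n)) := by
  intro i j hij
  exact Set.disjoint_left.2 fun x hi hj => hij (eq_of_mem_vertexInterval hi hj)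

lemma graphKernel_eq_of_mem {i j : Fin n} {x y : ℝ} (hx : x ∈ vertexInterval n i)
    (hy : y ∈ vertexInterval n j) :
    graphKernel n G x y = (if G.Adj i j then 1 else 0) * n := by
  unfold graphKernel
  by_cases h : G.Adj i j
  · rw [if_pos ⟨i, j, h, hx, hy⟩, if_pos h, one_mul]
  · rw [if_neg, if_neg h, zero_mul]
    rintro ⟨i', j', h', hx', hy'⟩
    rw [eq_of_mem_vertexInterval hx hx', eq_of_mem_vertexInterval hy hy'] at h
    exact h h'

lemma graphKernel_nonneg (x y : ℝ) : 0 ≤ graphKernel n G x y := by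
  unfold graphKernel
  split_ifs <;> simp

lemma graphKernel_le (x y : ℝ) : graphKernel n G x y ≤ n := by
  unfold graphKernel
  split_ifs <;> simp

lemma abs_graphKernel_le (x y : ℝ) : |graphKernel n G x y| ≤ n := by
  rw [abs_of_nonneg (graphKernel_nonneg x y)]
  exact graphKernel_le x y

lemma measurable_graphKernel : Measurable (Function.uncurry (graphKernel n G)) := by
  unfold graphKernel Function.uncurry
  refine Measurable.ite ?_ measurable_const measurable_const
  simp only [ofPred_exists, ofPred_and]
  refine .iUnion fun i => .iUnion fun j => ?_
  exact (MeasurableSet.const _).inter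
    ((measurable_fst measurableSet_Ioc).inter (measurable_snd measurableSet_Ioc))

lemma graphKernel_eq_sum (x y : ℝ) :
    graphKernel n G x y = ∑ i, ∑ j, (if G.Adj i j then 1 else 0) * (n : ℝ) *
      ((vertexInterval n i).indicator 1 x * (vertexInterval n j).indicator 1 y) := by
  by_cases hx : ∃ i, x ∈ vertexInterval n i
  · by_cases hy : ∃ j, y ∈ vertexInterval n j
    · obtain ⟨i, hi⟩ := hx
      obtain ⟨j, hj⟩ := hy
      rw [graphKernel_eq_of_mem hi hj, Finset.sum_eq_single i, Finset.sum_eq_single j]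
      · simp [hi, hj]
      · intro j' _ hne
        rw [indicator_of_notMem (s := vertexInterval n j')
          fun h => hne (eq_of_mem_vertexInterval h hj)]
        simp
      · simp
      · intro i' _ hne
        rw [indicator_of_notMem (s := vertexInterval n i')
          fun h => hne (eq_of_mem_vertexInterval h hi)]
        simp
      · simp
    · push Not at hy
      rw [graphKernel, if_neg fun ⟨_, j, _, _, h⟩ => hy j h]
      simp [hy]
  · push Not at hx
    rw [graphKernel, if_neg fun ⟨i, _, _, h, _⟩ => hx i h]
    simp [hx]

lemma setIntegral_indicator_vertexInterval (S : Set ℝ) (i : Fin n) :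
    0 ≤ ∫ x in S, (vertexInterval n i).indicator (1 : ℝ → ℝ) x ∧
      ∫ x in S, (vertexInterval n i).indicator (1 : ℝ → ℝ) x ≤ 1 / n := by
  rw [integral_indicator_one (measurableSet_vertexInterval i)]
  refine ⟨measureReal_nonneg, ?_⟩
  rw [measureReal_def]
  refine ENNReal.toReal_le_of_le_ofReal (by positivity) ?_
  rw [← volume_vertexInterval i]
  exact Measure.restrict_apply_le _ _

lemma setIntegral_setIntegral_graphKernel_le {S T : Set ℝ} (hS : S ⊆ Icc 0 1)
    (hT : T ⊆ Icc 0 1) :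
    |∫ x in S, ∫ y in T, graphKernel n G x y| ≤ 2 * (Nat.card G.edgeSet / n) := by
  have hint : ∀ {R : Set ℝ}, R ⊆ Icc 0 1 → ∀ i : Fin n,
      IntegrableOn ((vertexInterval n i).indicator (1 : ℝ → ℝ)) R := by
    intro R hR i
    refine integrableOn_of_subset_Icc (C := 1)
      (measurable_one.indicator (measurableSet_vertexInterval i)) (fun x => ?_) hR
    by_cases hx : x ∈ vertexInterval n i <;> simp [hx]
  have hsum : ∫ x in S, ∫ y in T, graphKernel n G x y =
      ∑ i, ∑ j, (if G.Adj i j then 1 else 0) * n *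
        ((∫ x in S, (vertexInterval n i).indicator (1 : ℝ → ℝ) x) *
          ∫ y in T, (vertexInterval n j).indicator (1 : ℝ → ℝ) y) := by
    have hinner : ∀ x, ∫ y in T, graphKernel n G x y =
        ∑ i, ∑ j, (if G.Adj i j then 1 else 0) * n *
          ((vertexInterval n i).indicator (1 : ℝ → ℝ) x *
            ∫ y in T, (vertexInterval n j).indicator (1 : ℝ → ℝ) y) := by
      intro x
      simp only [graphKernel_eq_sum]
      rw [integral_finsetSum _ fun i _ => integrable_finsetSum _ fun j _ =>
        ((hint hT j).const_mul _).const_mul _]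
      refine Finset.sum_congr rfl fun i _ => ?_
      rw [integral_finsetSum _ fun j _ => ((hint hT j).const_mul _).const_mul _]
      simp only [integral_const_mul]
    simp only [hinner]
    rw [integral_finsetSum _ fun i _ => integrable_finsetSum _ fun j _ =>
      ((hint hS i).mul_const _).const_mul _]
    refine Finset.sum_congr rfl fun i _ => ?_
    rw [integral_finsetSum _ fun j _ => ((hint hS i).mul_const _).const_mul _]
    simp only [integral_const_mul, integral_mul_const]
  have hbound : (∑ i : Fin n, ∑ j : Fin n, (if G.Adj i j then (1 : ℝ) else 0) * n *
      (1 / n * (1 / n))) = 2 * (Nat.card G.edgeSet / n) := by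
    simp only [← Finset.sum_mul, sum_sum_adj_eq_two_mul_card_edgeSet]
    rcases eq_or_ne (n : ℝ) 0 with h | h
    · simp [h]
    · field_simp
  rw [hsum, ← hbound, abs_of_nonneg]
  · refine Finset.sum_le_sum fun i _ => Finset.sum_le_sum fun j _ => ?_
    refine mul_le_mul_of_nonneg_left ?_ (by split_ifs <;> simp)
    exact mul_le_mul (setIntegral_indicator_vertexInterval S i).2
      (setIntegral_indicator_vertexInterval T j).2
      (setIntegral_indicator_vertexInterval T j).1 (by positivity)
  · refine Finset.sum_nonneg fun i _ => Finset.sum_nonneg fun j _ => ?_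
    refine mul_nonneg (by split_ifs <;> simp) ?_
    exact mul_nonneg (setIntegral_indicator_vertexInterval S i).1
      (setIntegral_indicator_vertexInterval T j).1

lemma isMPBij_id : IsMPBij id :=
  ⟨bijOn_id _, MeasurePreserving.id _⟩

lemma cutDist_graphKernel_le (G : SimpleGraph (Fin m)) (H : SimpleGraph (Fin n)) :
    cutDist (graphKernel m G) (graphKernel n H) ≤
      2 * (Nat.card G.edgeSet / m) + 2 * (Nat.card H.edgeSet / n) := by
  have hbdd : BddBelow {r : ℝ | ∃ τ : ℝ → ℝ, IsMPBij τ ∧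
      r = cutNorm (fun x y => graphKernel m G x y - graphKernel n H (τ x) (τ y))} := by
    refine ⟨0, ?_⟩
    rintro r ⟨τ, -, rfl⟩
    exact cutNorm_nonneg _
  have hid : cutDist (graphKernel m G) (graphKernel n H) ≤
      cutNorm (fun x y => graphKernel m G x y - graphKernel n H x y) :=
    csInf_le hbdd ⟨id, isMPBij_id, rfl⟩
  refine hid.trans (cutNorm_le fun S T hS hT => ?_)
  rw [setIntegral_setIntegral_sub measurable_graphKernel abs_graphKernel_le
      measurable_graphKernel abs_graphKernel_le hS hT]
  exact (abs_sub _ _).trans (add_le_add (setIntegral_setIntegral_graphKernel_le hS hT)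
      (setIntegral_setIntegral_graphKernel_le hS hT))

/-- Averaging `κ_G` over the vertex blocks of `H` yields a matrix with small entries that
approximates the adjacency matrix of `H` up to the cut distance. -/
lemma exists_matrix_of_cutDist_lt {G : SimpleGraph (Fin m)} {H : SimpleGraph (Fin n)} {ε : ℝ}
    (h : cutDist (graphKernel m G) (graphKernel n H) < ε) :
    ∃ u : Fin n → Fin n → ℝ, (∀ i j, u i j ≤ m / (n : ℝ) ^ 2) ∧
      ∀ S T : Finset (Fin n),
        |∑ i ∈ S, ∑ j ∈ T, (u i j - (if H.Adj i j then 1 else 0) * (1 / n : ℝ))| ≤ ε := by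
  obtain ⟨_, ⟨τ, hτ, rfl⟩, hr⟩ := exists_lt_of_csInf_lt (by exact ⟨_, id, isMPBij_id, rfl⟩) h
  have hτm : Measurable τ := hτ.2.measurable
  set Q : Fin n → Set ℝ := fun i => Icc 0 1 ∩ τ ⁻¹' vertexInterval n i
  have hQm : ∀ i, MeasurableSet (Q i) := fun i =>
    measurableSet_Icc.inter (hτm (measurableSet_vertexInterval i))
  have hQs : ∀ i, Q i ⊆ Icc 0 1 := fun i => inter_subset_left
  have hQd : Pairwise (Function.onFun Disjoint Q) := fun i j hij =>
    ((pairwise_disjoint_vertexInterval n hij).preimage τ).mono inter_subset_right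
      inter_subset_right
  have hQv : ∀ i, volume.real (Q i) = 1 / n := by
    intro i
    have h1 := hτ.2.measure_preimage (measurableSet_vertexInterval i).nullMeasurableSet
    rw [Measure.restrict_apply (hτm (measurableSet_vertexInterval i)),
      Measure.restrict_apply (measurableSet_vertexInterval i),
      inter_eq_left.2 (vertexInterval_subset_Icc i), inter_comm, volume_vertexInterval] at h1
    rw [measureReal_def, h1, ENNReal.toReal_ofReal (by positivity)]
  have hτk : Measurable (Function.uncurry fun x y => graphKernel n H (τ x) (τ y)) :=
    measurable_graphKernel.comp (hτm.prodMap hτm)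
  have hWm : Measurable (Function.uncurry fun x y =>
      graphKernel m G x y - graphKernel n H (τ x) (τ y)) := measurable_graphKernel.sub hτk
  have hWb : ∀ x y, |graphKernel m G x y - graphKernel n H (τ x) (τ y)| ≤ m + n := fun x y =>
    (abs_sub _ _).trans (add_le_add (abs_graphKernel_le _ _) (abs_graphKernel_le _ _))
  refine ⟨fun i j => ∫ x in Q i, ∫ y in Q j, graphKernel m G x y, fun i j => ?_,
    fun S T => ?_⟩
  · have hin : ∀ x ∈ Q i, ‖∫ y in Q j, graphKernel m G x y‖ ≤ m * (1 / n) := by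
      intro x _
      rw [← hQv j]
      exact norm_setIntegral_le_of_norm_le_const
        ((measure_mono (hQs j)).trans_lt measure_Icc_lt_top) fun y _ => abs_graphKernel_le _ _
    have hout := norm_setIntegral_le_of_norm_le_const (μ := volume)
      ((measure_mono (hQs i)).trans_lt measure_Icc_lt_top) hin
    rw [hQv] at hout
    refine (le_abs_self _).trans (hout.trans_eq ?_)
    ring
  · have hentry : ∀ i j, ∫ x in Q i, ∫ y in Q j,
        (graphKernel m G x y - graphKernel n H (τ x) (τ y)) =
        (∫ x in Q i, ∫ y in Q j, graphKernel m G x y) -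
          (if H.Adj i j then 1 else 0) * (1 / n : ℝ) := by
      intro i j
      rw [setIntegral_setIntegral_sub measurable_graphKernel abs_graphKernel_le hτk
        (fun _ _ => abs_graphKernel_le _ _) (hQs i) (hQs j)]
      congr 1
      have hconst : ∀ x ∈ Q i, ∫ y in Q j, graphKernel n H (τ x) (τ y) =
          1 / n * ((if H.Adj i j then 1 else 0) * n) := by
        intro x hx
        rw [setIntegral_congr_fun (hQm j) fun y hy => graphKernel_eq_of_mem hx.2 hy.2]
        simp [hQv]
      rw [setIntegral_congr_fun (hQm i) hconst, setIntegral_const, hQv, smul_eq_mul]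
      have hn : (n : ℝ) ≠ 0 := by exact_mod_cast i.pos.ne'
      field_simp
    have hle := abs_setIntegral_setIntegral_le_cutNorm hWb
      (Finset.measurableSet_biUnion S fun i _ => hQm i)
      (Finset.measurableSet_biUnion T fun i _ => hQm i)
      (iUnion₂_subset fun i _ => hQs i) (iUnion₂_subset fun i _ => hQs i)
    rw [setIntegral_biUnion_setIntegral_biUnion hWm hWb hQm hQs hQd] at hle
    simp only [hentry] at hle
    exact hle.trans hr.le

lemma card_nonisolated_div_le {G : SimpleGraph (Fin m)} {H : SimpleGraph (Fin n)} {ε : ℝ}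
    (h : cutDist (graphKernel m G) (graphKernel n H) < ε) (hn : 0 < n) :
    ((nonisolated H).card : ℝ) / n ≤ 5 * ε + m / n := by
  obtain ⟨u, hu, hrect⟩ := exists_matrix_of_cutDist_lt h
  have h1 := card_nonisolated_le hu hrect
  have hn' : (0 : ℝ) < n := by exact_mod_cast hn
  have h2 : ((nonisolated H).card : ℝ) ≤ n := by
    exact_mod_cast (Finset.card_le_univ (nonisolated H)).trans_eq (Fintype.card_fin n)
  have h3 : ((nonisolated H).card : ℝ) * (m / (n : ℝ) ^ 2) ≤ n * (m / (n : ℝ) ^ 2) := by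
    gcongr
  have h4 : (n : ℝ) * (m / (n : ℝ) ^ 2) = m / n := by field_simp
  have h5 : ((nonisolated H).card : ℝ) / n = (nonisolated H).card * (1 / n : ℝ) := by ring
  linarith

lemma card_edgeSet_div_le {G : SimpleGraph (Fin m)} {H : SimpleGraph (Fin n)} {ε : ℝ}
    (h : cutDist (graphKernel m G) (graphKernel n H) < ε) :
    2 * ((Nat.card H.edgeSet : ℝ) / n) ≤ ε + m * ((nonisolated H).card / n : ℝ) ^ 2 := by
  obtain ⟨u, hu, hrect⟩ := exists_matrix_of_cutDist_lt h
  have h1 := card_edgeSet_le hu hrect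
  calc 2 * ((Nat.card H.edgeSet : ℝ) / n) = 2 * (Nat.card H.edgeSet : ℝ) * (1 / n) := by ring
    _ ≤ _ := h1
    _ = _ := by ring

end GraphKernel

lemma tendsto_card_nonisolated_div_of_cauchy {G : ∀ n : ℕ, SimpleGraph (Fin n)}
    (h : ∀ ε : ℝ, 0 < ε → ∃ N : ℕ, ∀ m, N ≤ m → ∀ n, N ≤ n →
        cutDist (graphKernel m (G m)) (graphKernel n (G n)) < ε) :
    Tendsto (fun n : ℕ => ((nonisolated (G n)).card : ℝ) / n) atTop (nhds 0) := by
  refine tendsto_order.2 ⟨fun a ha => Eventually.of_forall fun n => ha.trans_le (by positivity),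
    fun a ha => ?_⟩
  obtain ⟨N, hN⟩ := h (a / 10) (by positivity)
  have hlim : Tendsto (fun n : ℕ => (N : ℝ) / n) atTop (nhds 0) :=
    tendsto_const_div_atTop_nhds_zero_nat _
  filter_upwards [hlim.eventually_lt_const (half_pos ha), eventually_ge_atTop N,
    eventually_gt_atTop 0] with n h1 h2 h3
  have := card_nonisolated_div_le (hN N le_rfl n h2) h3
  linarith

/-- With `p = 1/n`: a sequence `(G_n)` of graphs with `|G_n| = n` is
Cauchy with respect to the cut metric `d_□` (for every `ε > 0` there is `N` such that
`d_□(κ_{G_m}, κ_{G_n}) < ε` for all `m, n ≥ N`) if and only if `e(G_n) = o(n)`,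
i.e. `e(G_n)/n → 0` as `n → ∞`. -/
theorem cauchy_cutDist_iff_sublinear_edges (G : ∀ n : ℕ, SimpleGraph (Fin n)) :
    (∀ ε : ℝ, 0 < ε → ∃ N : ℕ, ∀ m, N ≤ m → ∀ n, N ≤ n →
        cutDist (graphKernel m (G m)) (graphKernel n (G n)) < ε) ↔
      Tendsto (fun n : ℕ => (Nat.card (G n).edgeSet : ℝ) / n) atTop (nhds 0) := by
  constructor
  · intro h
    refine tendsto_order.2
      ⟨fun a ha => Eventually.of_forall fun n => ha.trans_le (by positivity), fun a ha => ?_⟩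
    obtain ⟨N, hN⟩ := h a ha
    have hlim : Tendsto (fun n : ℕ => (N : ℝ) * ((nonisolated (G n)).card / n : ℝ) ^ 2)
        atTop (nhds 0) := by
      simpa using ((tendsto_card_nonisolated_div_of_cauchy h).pow 2).const_mul (N : ℝ)
    filter_upwards [hlim.eventually_lt_const ha, eventually_ge_atTop N] with n h1 h2
    have := card_edgeSet_div_le (hN N le_rfl n h2)
    linarith
  · intro h ε hε
    obtain ⟨N, hN⟩ := eventually_atTop.1 (h.eventually_lt_const (show 0 < ε / 4 by positivity))
    refine ⟨N, fun m hm n hn => ?_⟩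
    have := cutDist_graphKernel_le (G m) (G n)
    linarith [hN m hm, hN n hn]
end
end

section
/- Fix p = 1/n. Let (G_n) and (G_n') be sequences of graphs with |G_n| = |G_n'| = n and e(G_n), e(G_n') = O(n). Suppose that any o(n) vertices of G_n meet o(n) edges of G_n, and the same holds for G_n'; precisely: for every ε > 0 there exist δ > 0 and N such that for all n ≥ N, every set of at most δn vertices of G_n (respectively of G_n') is incident to at most εn edges. Then d̂_□(G_n, G_n') → 0 if and only if d_edit(G_n, G_n') → 0. -/
open Filter

noncomputable section
open scoped Classical symmDiff

/-- `e_G(S,T)`: the number of ordered pairs `(s,t) ∈ S × T` with `st` an edge of `G`. -/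
def pairCount {n : ℕ} (G : SimpleGraph (Fin n)) (S T : Set (Fin n)) : ℕ :=
  Nat.card {p : Fin n × Fin n // p.1 ∈ S ∧ p.2 ∈ T ∧ G.Adj p.1 p.2}

/-- The graph cut distance (normalization `p = 1/n`):
`d̂_□(G₁,G₂) = (1/n) · min over graphs G₂' on V(G₁) isomorphic to G₂ of
max_{S,T ⊆ V(G₁)} |e_{G₁}(S,T) − e_{G₂'}(S,T)|`. -/
def graphCutDist {n : ℕ} (G₁ G₂ : SimpleGraph (Fin n)) : ℝ :=
  sInf { r : ℝ | ∃ G₂' : SimpleGraph (Fin n), Nonempty (G₂' ≃g G₂) ∧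
    r = (sSup { s : ℝ | ∃ S T : Set (Fin n),
          s = |(pairCount G₁ S T : ℝ) - (pairCount G₂' S T : ℝ)| }) / n }

/-- The unnormalized edit distance between two graphs on the same `n`-element vertex
set: `min{|E(G₁) △ E(G₂')| : G₂' a graph on V(G₁) isomorphic to G₂}`. -/
def editDist {n : ℕ} (G₁ G₂ : SimpleGraph (Fin n)) : ℕ :=
  sInf { k : ℕ | ∃ G₂' : SimpleGraph (Fin n), Nonempty (G₂' ≃g G₂) ∧
    k = Nat.card ↥(G₁.edgeSet ∆ G₂'.edgeSet) }

/-- The number of edges of `G` meeting (incident to) the vertex set `V`. -/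
def incidentEdgeCount {n : ℕ} (G : SimpleGraph (Fin n)) (V : Set (Fin n)) : ℕ :=
  Nat.card {e : Sym2 (Fin n) // e ∈ G.edgeSet ∧ ∃ v ∈ V, v ∈ e}

lemma pairCount_eq_ncard {n : ℕ} (G : SimpleGraph (Fin n)) (S T : Set (Fin n)) :
    pairCount G S T = {p : Fin n × Fin n | p.1 ∈ S ∧ p.2 ∈ T ∧ G.Adj p.1 p.2}.ncard := rfl

lemma incidentEdgeCount_eq_ncard {n : ℕ} (G : SimpleGraph (Fin n)) (V : Set (Fin n)) :
    incidentEdgeCount G V = {e : Sym2 (Fin n) | e ∈ G.edgeSet ∧ ∃ v ∈ V, v ∈ e}.ncard := rfl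

lemma card_edgeSet_eq_of_iso {n : ℕ} {G H : SimpleGraph (Fin n)} (f : G ≃g H) :
    Nat.card G.edgeSet = Nat.card H.edgeSet :=
  Nat.card_congr f.mapEdgeSet

lemma incidentEdgeCount_le_of_iso {n : ℕ} {G H : SimpleGraph (Fin n)} (f : G ≃g H)
    (V : Set (Fin n)) : incidentEdgeCount G V ≤ incidentEdgeCount H (f '' V) := by
  rw [incidentEdgeCount_eq_ncard, incidentEdgeCount_eq_ncard]
  refine Set.ncard_le_ncard_of_injOn (Sym2.map f) ?_
    (Sym2.map.injective f.injective).injOn (Set.toFinite _)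
  rintro e ⟨he, v, hv, hve⟩
  refine ⟨?_, f v, ⟨v, hv, rfl⟩, Sym2.mem_map.2 ⟨v, hve, rfl⟩⟩
  exact (f.mapEdgeSet ⟨e, he⟩).2

/-- The ordered pairs spanned by a set of edges are at most twice as many as the edges. -/
lemma ncard_mk_preimage_le {α : Type*} [Finite α] (E : Set (Sym2 α)) :
    {p : α × α | s(p.1, p.2) ∈ E}.ncard ≤ 2 * E.ncard := by
  have := Fintype.ofFinite α
  rw [Set.ncard_eq_toFinset_card', Set.ncard_eq_toFinset_card']
  refine Finset.card_le_mul_card_image_of_maps_to (f := fun p : α × α => s(p.1, p.2))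
    (by intro p hp; simpa using hp) 2 ?_
  intro e he
  induction e with
  | _ a b =>
    refine (Finset.card_le_card (t := {(a, b), (b, a)}) ?_).trans Finset.card_le_two
    rintro ⟨x, y⟩ h
    simp only [Finset.mem_filter, Sym2.eq_iff] at h
    simp only [Finset.mem_insert, Finset.mem_singleton, Prod.mk.injEq]
    exact h.2

lemma pairCount_le_add {n : ℕ} (G H : SimpleGraph (Fin n)) (S T : Set (Fin n)) :
    pairCount G S T ≤ pairCount H S T + 2 * (G.edgeSet ∆ H.edgeSet).ncard := by
  rw [pairCount_eq_ncard, pairCount_eq_ncard]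
  refine le_trans ?_ (Nat.add_le_add_left (ncard_mk_preimage_le _) _)
  refine le_trans (Set.ncard_le_ncard ?_ (Set.toFinite _)) (Set.ncard_union_le _ _)
  rintro ⟨x, y⟩ ⟨hx, hy, h⟩
  by_cases hH : H.Adj x y
  · exact Or.inl ⟨hx, hy, hH⟩
  · exact Or.inr (Or.inl ⟨h, hH⟩)

lemma abs_pairCount_sub_le {n : ℕ} (G H : SimpleGraph (Fin n)) (S T : Set (Fin n)) :
    |(pairCount G S T : ℝ) - pairCount H S T| ≤ 2 * (G.edgeSet ∆ H.edgeSet).ncard := by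
  have h₁ : (pairCount G S T : ℝ) ≤ pairCount H S T + 2 * (G.edgeSet ∆ H.edgeSet).ncard :=
    mod_cast pairCount_le_add G H S T
  have h₂ : (pairCount H S T : ℝ) ≤ pairCount G S T + 2 * (G.edgeSet ∆ H.edgeSet).ncard := by
    rw [symmDiff_comm]
    exact mod_cast pairCount_le_add H G S T
  rw [abs_le]
  constructor <;> linarith

lemma bddAbove_pairCount_sub {n : ℕ} (G H : SimpleGraph (Fin n)) :
    BddAbove {s : ℝ | ∃ S T : Set (Fin n),
      s = |(pairCount G S T : ℝ) - (pairCount H S T : ℝ)|} :=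
  ⟨_, by rintro _ ⟨S, T, rfl⟩; exact abs_pairCount_sub_le G H S T⟩

lemma sSup_pairCount_sub_div_nonneg {n : ℕ} (G H : SimpleGraph (Fin n)) :
    0 ≤ sSup {s : ℝ | ∃ S T : Set (Fin n),
      s = |(pairCount G S T : ℝ) - (pairCount H S T : ℝ)|} / n := by
  refine div_nonneg (Real.sSup_nonneg ?_) (Nat.cast_nonneg n)
  rintro _ ⟨S, T, rfl⟩
  exact abs_nonneg _

lemma graphCutDist_nonneg {n : ℕ} (G H : SimpleGraph (Fin n)) : 0 ≤ graphCutDist G H := by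
  refine Real.sInf_nonneg ?_
  rintro _ ⟨K, _, rfl⟩
  exact sSup_pairCount_sub_div_nonneg G K

lemma graphCutDist_le_two_mul_editDist_div {n : ℕ} (G H : SimpleGraph (Fin n)) :
    graphCutDist G H ≤ 2 * ((editDist G H : ℝ) / n) := by
  obtain ⟨K, hK, hcard⟩ := Nat.sInf_mem (s := {k : ℕ | ∃ K : SimpleGraph (Fin n),
    Nonempty (K ≃g H) ∧ k = Nat.card ↥(G.edgeSet ∆ K.edgeSet)})
    ⟨_, H, ⟨SimpleGraph.Iso.refl⟩, rfl⟩
  have hedit : editDist G H = (G.edgeSet ∆ K.edgeSet).ncard := hcard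
  unfold graphCutDist
  refine (csInf_le ⟨0, ?_⟩ (by exact ⟨K, hK, rfl⟩)).trans ?_
  · rintro _ ⟨L, _, rfl⟩
    exact sSup_pairCount_sub_div_nonneg G L
  · rw [← mul_div_assoc, hedit]
    refine div_le_div_of_nonneg_right (csSup_le ⟨_, ∅, ∅, rfl⟩ ?_) (Nat.cast_nonneg n)
    rintro _ ⟨S, T, rfl⟩
    exact abs_pairCount_sub_le G K S T

lemma exists_iso_of_graphCutDist_lt {n : ℕ} (hn : 0 < n) {G H : SimpleGraph (Fin n)} {γ : ℝ}
    (h : graphCutDist G H < γ) : ∃ K : SimpleGraph (Fin n), Nonempty (K ≃g H) ∧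
      ∀ S T : Set (Fin n), |(pairCount G S T : ℝ) - pairCount K S T| ≤ γ * n := by
  unfold graphCutDist at h
  obtain ⟨_, ⟨K, hK, rfl⟩, hlt⟩ := exists_lt_of_csInf_lt
    (by exact ⟨_, H, ⟨SimpleGraph.Iso.refl⟩, rfl⟩) h
  refine ⟨K, hK, fun S T => ?_⟩
  rw [div_lt_iff₀ (by exact_mod_cast hn)] at hlt
  exact (le_csSup (bddAbove_pairCount_sub G K) ⟨S, T, rfl⟩).trans hlt.le

/-- A set of pairs that are edges of `G` but not of `H`, with all degrees at most `D`, contains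
a large subset `M` whose first and second coordinates span no edge of `H`. -/
lemma exists_subset_forall_not_adj {V : Type*} [Fintype V] (G H : SimpleGraph V) (D : ℕ)
    (F : Finset (V × V))
    (hF : ∀ p ∈ F, G.Adj p.1 p.2 ∧ ¬ H.Adj p.1 p.2)
    (hD : ∀ p ∈ F, G.degree p.1 ≤ D ∧ G.degree p.2 ≤ D ∧ H.degree p.1 ≤ D ∧ H.degree p.2 ≤ D) :
    ∃ M ⊆ F, (∀ p ∈ M, ∀ q ∈ M, ¬ H.Adj p.1 q.2) ∧ F.card ≤ M.card * (1 + 2 * D ^ 2) := by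
  obtain ⟨M, hM, hmax⟩ := Finset.exists_max_image
    (F.powerset.filter fun M => ∀ p ∈ M, ∀ q ∈ M, ¬ H.Adj p.1 q.2) Finset.card
    ⟨∅, by simp⟩
  simp only [Finset.mem_filter, Finset.mem_powerset] at hM hmax
  refine ⟨M, hM.1, hM.2, ?_⟩
  let A (p : V × V) : Finset (V × V) := F.filter fun q => H.Adj p.1 q.2
  let B (p : V × V) : Finset (V × V) := F.filter fun q => H.Adj q.1 p.2
  have hA : ∀ p ∈ F, (A p).card ≤ D ^ 2 := by
    intro p hp
    rw [sq]
    refine (Finset.card_le_mul_card_image_of_maps_to (f := Prod.snd)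
      (t := H.neighborFinset p.1) ?_ D ?_).trans
      (Nat.mul_le_mul_left _ (by simpa using (hD p hp).2.2.1))
    · intro q hq
      simpa [A] using (Finset.mem_filter.1 hq).2
    · intro y _
      by_cases hne : ((A p).filter fun q => q.2 = y).Nonempty
      · obtain ⟨q, hq⟩ := hne
        simp only [A, Finset.mem_filter] at hq
        have hy : G.degree y ≤ D := hq.2 ▸ (hD q hq.1.1).2.1
        refine le_trans (Finset.card_le_card_of_injOn Prod.fst ?_ ?_)
          ((G.card_neighborFinset_eq_degree y).le.trans hy)
        · rintro ⟨a, b⟩ h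
          simp only [A, Finset.coe_filter, Finset.mem_filter, Set.mem_ofPred_eq] at h
          have := (hF _ h.1.1).1
          simp only [h.2] at this
          simpa using this.symm
        · rintro ⟨a, b⟩ h ⟨c, d⟩ h' hac
          simp only [Finset.coe_filter, Set.mem_ofPred_eq] at h h'
          exact Prod.ext hac (h.2.trans h'.2.symm)
      · simp [Finset.not_nonempty_iff_eq_empty.1 hne]
  have hB : ∀ p ∈ F, (B p).card ≤ D ^ 2 := by
    intro p hp
    rw [sq]
    refine (Finset.card_le_mul_card_image_of_maps_to (f := Prod.fst)
      (t := H.neighborFinset p.2) ?_ D ?_).trans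
      (Nat.mul_le_mul_left _ (by simpa using (hD p hp).2.2.2))
    · intro q hq
      simpa [B] using (Finset.mem_filter.1 hq).2.symm
    · intro x _
      by_cases hne : ((B p).filter fun q => q.1 = x).Nonempty
      · obtain ⟨q, hq⟩ := hne
        simp only [B, Finset.mem_filter] at hq
        have hx : G.degree x ≤ D := hq.2 ▸ (hD q hq.1.1).1
        refine le_trans (Finset.card_le_card_of_injOn Prod.snd ?_ ?_)
          ((G.card_neighborFinset_eq_degree x).le.trans hx)
        · rintro ⟨a, b⟩ h
          simp only [B, Finset.coe_filter, Finset.mem_filter, Set.mem_ofPred_eq] at h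
          have := (hF _ h.1.1).1
          simp only [h.2] at this
          simpa using this
        · rintro ⟨a, b⟩ h ⟨c, d⟩ h' hac
          simp only [Finset.coe_filter, Set.mem_ofPred_eq] at h h'
          exact Prod.ext (h.2.trans h'.2.symm) hac
      · simp [Finset.not_nonempty_iff_eq_empty.1 hne]
  have hcover : F ⊆ M.biUnion fun p => {p} ∪ (A p ∪ B p) := by
    intro q hq
    simp only [A, B, Finset.mem_biUnion, Finset.mem_union, Finset.mem_singleton,
      Finset.mem_filter]
    by_contra! hcon
    have hqM : q ∉ M := fun h => (hcon q h).1 rfl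
    have := hmax (insert q M) ⟨Finset.insert_subset hq hM.1, by
      intro a ha' b hb'
      rcases Finset.mem_insert.1 ha' with rfl | ha <;>
        rcases Finset.mem_insert.1 hb' with rfl | hb
      · exact (hF _ hq).2
      · exact (hcon b hb).2.2 hq
      · exact (hcon a ha).2.1 hq
      · exact hM.2 a ha b hb⟩
    rw [Finset.card_insert_of_notMem hqM] at this
    omega
  refine (Finset.card_le_card hcover).trans (Finset.card_biUnion_le_card_mul _ _ _ ?_)
  intro p hp
  have h₁ := hA p (hM.1 hp)
  have h₂ := hB p (hM.1 hp)
  have h₃ := Finset.card_union_le {p} (A p ∪ B p)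
  have h₄ := Finset.card_union_le (A p) (B p)
  rw [Finset.card_singleton] at h₃
  omega

/-- The number of edges of `G` missing from `H` is controlled by the cut discrepancy, up to the
edges of `G` at vertices of degree larger than `D`. -/
lemma ncard_edgeSet_diff_le {n : ℕ} (G H : SimpleGraph (Fin n)) (D : ℕ) (c : ℝ)
    (hc : ∀ S T : Set (Fin n), |(pairCount G S T : ℝ) - pairCount H S T| ≤ c) :
    ((G.edgeSet \ H.edgeSet).ncard : ℝ) ≤
      c * (1 + 2 * D ^ 2) + incidentEdgeCount G {v | D < G.degree v ∨ D < H.degree v} := by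
  set W : Set (Fin n) := {v | D < G.degree v ∨ D < H.degree v} with hW
  have hWn : ∀ v, v ∉ W → G.degree v ≤ D ∧ H.degree v ≤ D := by
    intro v hv
    simpa [hW] using hv
  let F : Finset (Fin n × Fin n) := Finset.univ.filter fun p =>
    (G.Adj p.1 p.2 ∧ ¬ H.Adj p.1 p.2) ∧ p.1 ∉ W ∧ p.2 ∉ W
  obtain ⟨M, hMF, hM, hcard⟩ := exists_subset_forall_not_adj G H D F
    (fun p hp => (Finset.mem_filter.1 hp).2.1) (fun p hp => by
      have h := (Finset.mem_filter.1 hp).2.2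
      exact ⟨(hWn _ h.1).1, (hWn _ h.2).1, (hWn _ h.1).2, (hWn _ h.2).2⟩)
  have hMc : (M.card : ℝ) ≤ c := by
    let S : Set (Fin n) := {x | ∃ p ∈ M, p.1 = x}
    let T : Set (Fin n) := {y | ∃ p ∈ M, p.2 = y}
    have hH : pairCount H S T = 0 := by
      rw [pairCount_eq_ncard, Set.ncard_eq_zero (Set.toFinite _), Set.eq_empty_iff_forall_notMem]
      rintro ⟨x, y⟩ ⟨⟨p, hp, hpx⟩, ⟨q, hq, hqy⟩, hxy⟩
      dsimp only at hpx hqy hxy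
      rw [← hpx, ← hqy] at hxy
      exact hM p hp q hq hxy
    have hGM : M.card ≤ pairCount G S T := by
      rw [pairCount_eq_ncard, ← Set.ncard_coe_finset]
      refine Set.ncard_le_ncard ?_ (Set.toFinite _)
      intro p hp
      exact ⟨⟨p, hp, rfl⟩, ⟨p, hp, rfl⟩, (Finset.mem_filter.1 (hMF hp)).2.1.1⟩
    have h := (le_abs_self _).trans (hc S T)
    rw [hH, Nat.cast_zero, sub_zero] at h
    exact (Nat.cast_le.2 hGM).trans h
  have hsplit : (G.edgeSet \ H.edgeSet).ncard ≤ F.card + incidentEdgeCount G W := by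
    have hsub : G.edgeSet \ H.edgeSet ⊆ (fun p : Fin n × Fin n => s(p.1, p.2)) '' (F : Set _) ∪
        {e : Sym2 (Fin n) | e ∈ G.edgeSet ∧ ∃ v ∈ W, v ∈ e} := by
      intro e
      induction e with
      | _ x y =>
        rintro ⟨hG, hH⟩
        by_cases hx : x ∈ W
        · exact Or.inr ⟨hG, x, hx, Sym2.mem_mk_left x y⟩
        by_cases hy : y ∈ W
        · exact Or.inr ⟨hG, y, hy, Sym2.mem_mk_right x y⟩
        exact Or.inl ⟨(x, y), by
          simp only [F, Finset.coe_filter, Finset.mem_univ, true_and, Set.mem_ofPred_eq]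
          exact ⟨⟨hG, hH⟩, hx, hy⟩, rfl⟩
    refine (Set.ncard_le_ncard hsub (Set.toFinite _)).trans ((Set.ncard_union_le _ _).trans ?_)
    rw [incidentEdgeCount_eq_ncard]
    refine Nat.add_le_add_right ((Set.ncard_image_le (Set.toFinite _)).trans ?_) _
    rw [Set.ncard_coe_finset]
  have h₁ : ((G.edgeSet \ H.edgeSet).ncard : ℝ) ≤ F.card + incidentEdgeCount G W :=
    mod_cast hsplit
  have h₂ : (F.card : ℝ) ≤ M.card * (1 + 2 * D ^ 2) := mod_cast hcard
  have h₃ : (M.card : ℝ) * (1 + 2 * D ^ 2) ≤ c * (1 + 2 * D ^ 2) :=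
    mul_le_mul_of_nonneg_right hMc (by positivity)
  linarith

lemma ncard_lt_degree_mul_le {n : ℕ} (G H : SimpleGraph (Fin n)) (D : ℕ) :
    {v | D < G.degree v ∨ D < H.degree v}.ncard * D ≤
      2 * (Nat.card G.edgeSet + Nat.card H.edgeSet) := by
  have hG := G.sum_degrees_eq_twice_card_edges
  have hH := H.sum_degrees_eq_twice_card_edges
  have hcG : Nat.card G.edgeSet = G.edgeFinset.card := by
    rw [Nat.card_eq_fintype_card, SimpleGraph.edgeFinset_card]
  have hcH : Nat.card H.edgeSet = H.edgeFinset.card := by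
    rw [Nat.card_eq_fintype_card, SimpleGraph.edgeFinset_card]
  rw [hcG, hcH, mul_add, ← hG, ← hH, ← Finset.sum_add_distrib, Set.ncard_eq_toFinset_card',
    ← smul_eq_mul]
  refine (Finset.card_nsmul_le_sum _ (fun v => G.degree v + H.degree v) D ?_).trans
    (Finset.sum_le_sum_of_subset (Finset.subset_univ _))
  intro v hv
  rw [Set.mem_toFinset] at hv
  rcases hv with hv | hv <;> omega

/-- With `p = 1/n`: let `(G_n)`, `(G_n')` be sequences of graphs on `n`
vertices with `O(n)` edges, such that any `o(n)` vertices of `G_n` (resp. `G_n'`) meet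
`o(n)` edges.  Then `d̂_□(G_n, G_n') → 0` iff `d_edit(G_n, G_n') → 0` (here
`d_edit = editDist / n` is the normalized edit distance). -/
theorem graphCutDist_tendsto_zero_iff_editDist
    (G G' : ∀ n : ℕ, SimpleGraph (Fin n)) (C : ℝ)
    (hG : ∀ n, (Nat.card (G n).edgeSet : ℝ) ≤ C * n)
    (hG' : ∀ n, (Nat.card (G' n).edgeSet : ℝ) ≤ C * n)
    (hsmall : ∀ ε : ℝ, 0 < ε → ∃ δ : ℝ, 0 < δ ∧ ∃ N : ℕ, ∀ n, N ≤ n →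
      ∀ V : Set (Fin n), (V.ncard : ℝ) ≤ δ * n →
        (incidentEdgeCount (G n) V : ℝ) ≤ ε * n ∧
          (incidentEdgeCount (G' n) V : ℝ) ≤ ε * n) :
    Tendsto (fun n => graphCutDist (G n) (G' n)) atTop (nhds 0) ↔
      Tendsto (fun n => (editDist (G n) (G' n) : ℝ) / n) atTop (nhds 0) := by
  constructor
  · intro hcut
    rw [Metric.tendsto_atTop]
    intro ε hε
    obtain ⟨δ, hδ, N, hN⟩ := hsmall (ε / 8) (by positivity)
    obtain ⟨D, hD⟩ := exists_nat_gt (max (4 * C / δ) 0)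
    have hD0 : (0 : ℝ) < D := (le_max_right _ _).trans_lt hD
    have hDC : 4 * C ≤ D * δ := ((div_lt_iff₀ hδ).1 ((le_max_left _ _).trans_lt hD)).le
    have hK : (0 : ℝ) < 1 + 2 * D ^ 2 := by positivity
    have hγ : 0 < ε / 8 / (1 + 2 * (D : ℝ) ^ 2) := by positivity
    obtain ⟨N', hN'⟩ := eventually_atTop.1 (hcut.eventually_lt_const hγ)
    refine ⟨max (max N N') 1, fun n hn => ?_⟩
    have hn0 : 0 < n := (le_max_right _ _).trans hn
    have hn0' : (0 : ℝ) < n := Nat.cast_pos.2 hn0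
    obtain ⟨K, ⟨f⟩, hKcut⟩ := exists_iso_of_graphCutDist_lt hn0
      (hN' n (((le_max_right _ _).trans (le_max_left _ _)).trans hn))
    have hsm := hN n (((le_max_left _ _).trans (le_max_left _ _)).trans hn)
    set W : Set (Fin n) := {v | D < (G n).degree v ∨ D < K.degree v} with hW
    have hWcard : (W.ncard : ℝ) ≤ δ * n := by
      have h : (W.ncard : ℝ) * D ≤ 2 * (Nat.card (G n).edgeSet + Nat.card K.edgeSet) :=
        mod_cast ncard_lt_degree_mul_le (G n) K D
      rw [card_edgeSet_eq_of_iso f] at h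
      have h₁ := mul_le_mul_of_nonneg_right hDC hn0'.le
      refine le_of_mul_le_mul_right ?_ hD0
      linarith [hG n, hG' n]
    have hincG := (hsm W hWcard).1
    have hincK : (incidentEdgeCount K W : ℝ) ≤ ε / 8 * n := by
      refine le_trans (mod_cast incidentEdgeCount_le_of_iso f W) (hsm (f '' W) ?_).2
      rwa [Set.ncard_image_of_injective _ f.injective]
    have h₁ := ncard_edgeSet_diff_le (G n) K D _ hKcut
    have h₂ := ncard_edgeSet_diff_le K (G n) D _
      (fun S T => by rw [abs_sub_comm]; exact hKcut S T)
    have hW' : {v | D < K.degree v ∨ D < (G n).degree v} = W := by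
      ext v
      exact or_comm
    rw [hW'] at h₂
    have hc : ε / 8 / (1 + 2 * (D : ℝ) ^ 2) * n * (1 + 2 * (D : ℝ) ^ 2) = ε / 8 * n := by
      field_simp
    rw [hc] at h₁ h₂
    have hedit : editDist (G n) (G' n) ≤
        ((G n).edgeSet \ K.edgeSet).ncard + (K.edgeSet \ (G n).edgeSet).ncard :=
      (Nat.sInf_le (by exact ⟨K, ⟨f⟩, rfl⟩)).trans (Set.ncard_union_le _ _)
    have hedit' : (editDist (G n) (G' n) : ℝ) ≤
        ((G n).edgeSet \ K.edgeSet).ncard + (K.edgeSet \ (G n).edgeSet).ncard :=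
      mod_cast hedit
    rw [Real.dist_eq, sub_zero, abs_of_nonneg (by positivity), div_lt_iff₀ hn0']
    have := mul_pos hε hn0'
    linarith
  · intro hedit
    have h := hedit.const_mul 2
    rw [mul_zero] at h
    exact squeeze_zero (fun n => graphCutDist_nonneg _ _)
      (fun n => graphCutDist_le_two_mul_editDist_div _ _) h
end
end

section
/- For every constant c > 1 there is a δ = δ(c) > 0 such that, if G₁ and G₂ are independent instances of the Erdős–Rényi random graph G(n, c/n), then with high probability (probability tending to 1 as n → ∞) the unnormalized edit distance between G₁ and G₂ is at least δn; i.e. every graph isomorphic to G₂ on the vertex set of G₁ differs from G₁ in at least δn edges. -/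
open Filter

noncomputable section
open scoped Classical symmDiff

/-- The probability that the Erdős–Rényi random graph `G(n,p)` (each of the
`n(n-1)/2` possible edges present independently with probability `p`) equals a
given graph `G` on `{1,…,n}`. -/
def erProb (n : ℕ) (p : ℝ) (G : SimpleGraph (Fin n)) : ℝ :=
  p ^ (Nat.card G.edgeSet) * (1 - p) ^ (n.choose 2 - Nat.card G.edgeSet)

section Bernoulli

open Finset

/-- The expectation of `f ω` when `ω` is a random subset of `S` that contains each element
independently with probability `p`. -/
def bernExp {α : Type*} (S : Finset α) (p : ℝ) (f : Finset α → ℝ) : ℝ :=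
  ∑ ω ∈ S.powerset, p ^ #ω * (1 - p) ^ (#S - #ω) * f ω

/-- The probability of `P ω` when `ω` is a random subset of `S` that contains each element
independently with probability `p`. -/
def bernProb {α : Type*} (S : Finset α) (p : ℝ) (P : Finset α → Prop) : ℝ :=
  bernExp S p (fun ω => if P ω then 1 else 0)

variable {α : Type*} {S : Finset α} {p : ℝ}

lemma bernExp_congr {f g : Finset α → ℝ} (h : ∀ ω ⊆ S, f ω = g ω) :
    bernExp S p f = bernExp S p g :=
  Finset.sum_congr rfl fun ω hω => by rw [h ω (mem_powerset.1 hω)]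

lemma bernExp_mono (h0 : 0 ≤ p) (h1 : p ≤ 1) {f g : Finset α → ℝ} (h : ∀ ω ⊆ S, f ω ≤ g ω) :
    bernExp S p f ≤ bernExp S p g := by
  have h2 : 0 ≤ 1 - p := sub_nonneg.2 h1
  exact Finset.sum_le_sum fun ω hω =>
    mul_le_mul_of_nonneg_left (h ω (mem_powerset.1 hω)) (by positivity)

lemma bernExp_add (f g : Finset α → ℝ) :
    bernExp S p (fun ω => f ω + g ω) = bernExp S p f + bernExp S p g := by
  simp only [bernExp, mul_add, Finset.sum_add_distrib]

lemma bernExp_sum {ι : Type*} (I : Finset ι) (f : ι → Finset α → ℝ) :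
    bernExp S p (fun ω => ∑ i ∈ I, f i ω) = ∑ i ∈ I, bernExp S p (f i) := by
  simp only [bernExp, Finset.mul_sum]
  exact Finset.sum_comm

lemma bernExp_const (a : ℝ) : bernExp S p (fun _ => a) = a := by
  rw [bernExp, ← Finset.sum_mul, Finset.sum_pow_mul_eq_add_pow]
  simp

lemma bernProb_le_sum (h0 : 0 ≤ p) (h1 : p ≤ 1) {P : Finset α → Prop} {ι : Type*} (I : Finset ι)
    (Q : ι → Finset α → Prop) (h : ∀ ω ⊆ S, P ω → ∃ i ∈ I, Q i ω) :
    bernProb S p P ≤ ∑ i ∈ I, bernProb S p (Q i) := by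
  simp only [bernProb]
  rw [← bernExp_sum]
  refine bernExp_mono h0 h1 fun ω hω => ?_
  have hnn : ∀ i ∈ I, (0 : ℝ) ≤ if Q i ω then 1 else 0 := fun i _ => by split_ifs <;> simp
  split_ifs with hP
  · obtain ⟨i, hi, hQ⟩ := h ω hω hP
    exact le_trans (by rw [if_pos hQ]) (Finset.single_le_sum hnn hi)
  · exact Finset.sum_nonneg hnn

lemma bernProb_eq_zero {P : Finset α → Prop} (h : ∀ ω ⊆ S, ¬ P ω) : bernProb S p P = 0 := by
  rw [← bernExp_const (S := S) (p := p) 0]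
  exact bernExp_congr fun ω hω => if_neg (h ω hω)

lemma bernProb_mono (h0 : 0 ≤ p) (h1 : p ≤ 1) {P Q : Finset α → Prop}
    (h : ∀ ω ⊆ S, P ω → Q ω) : bernProb S p P ≤ bernProb S p Q := by
  refine bernExp_mono h0 h1 fun ω hω => ?_
  by_cases hP : P ω
  · rw [if_pos hP, if_pos (h ω hω hP)]
  · rw [if_neg hP]
    split_ifs <;> simp

lemma bernProb_congr {P Q : Finset α → Prop} (h : ∀ ω ⊆ S, (P ω ↔ Q ω)) :
    bernProb S p P = bernProb S p Q :=
  bernExp_congr fun ω hω => by simp [h ω hω]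

variable [DecidableEq α]

lemma bernExp_insert {a : α} (ha : a ∉ S) (f : Finset α → ℝ) :
    bernExp (insert a S) p f =
      p * bernExp S p (fun ω => f (insert a ω)) + (1 - p) * bernExp S p f := by
  rw [bernExp, Finset.sum_powerset_insert ha, add_comm, bernExp, bernExp, Finset.mul_sum,
    Finset.mul_sum]
  congr 1 <;> refine Finset.sum_congr rfl fun ω hω => ?_
  · have hω' := mem_powerset.1 hω
    rw [card_insert_of_notMem ha, card_insert_of_notMem (fun h => ha (hω' h)),
      Nat.add_sub_add_right]
    ring
  · have hω' := card_le_card (mem_powerset.1 hω)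
    rw [card_insert_of_notMem ha, Nat.succ_sub hω', pow_succ]
    ring

lemma bernExp_split {a : α} (ha : a ∈ S) (f : Finset α → ℝ) :
    bernExp S p f = p * bernExp S p (fun ω => f (insert a ω)) +
      (1 - p) * bernExp S p (fun ω => f (ω.erase a)) := by
  obtain ⟨S, haS, rfl⟩ : ∃ S', a ∉ S' ∧ insert a S' = S :=
    ⟨S.erase a, notMem_erase a S, insert_erase ha⟩
  have h : bernExp S p (fun ω => f (ω.erase a)) = bernExp S p f :=
    bernExp_congr fun ω hω => by rw [erase_eq_of_notMem fun h => haS (hω h)]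
  have h' : bernExp S p (fun ω => f ((insert a ω).erase a)) = bernExp S p f :=
    bernExp_congr fun ω hω => by rw [erase_insert fun h => haS (hω h)]
  rw [bernExp_insert haS, bernExp_insert haS, bernExp_insert haS, h, h']
  simp only [insert_idem]
  ring

lemma bernProb_split {a : α} (ha : a ∈ S) (P : Finset α → Prop) :
    bernProb S p P = p * bernProb S p (fun ω => P (insert a ω)) +
      (1 - p) * bernProb S p (fun ω => P (ω.erase a)) :=
  bernExp_split ha _

lemma bernExp_union {p₁ p₂ : ℝ} (hp : 1 - p = (1 - p₁) * (1 - p₂)) (f : Finset α → ℝ) :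
    bernExp S p f = bernExp S p₁ fun ω₁ => bernExp S p₂ fun ω₂ => f (ω₁ ∪ ω₂) := by
  induction S using Finset.induction_on generalizing f with
  | empty => simp [bernExp]
  | insert a S ha ih =>
    have hp' : p = 1 - (1 - p₁) * (1 - p₂) := by linarith
    have key (g : Finset α → Finset α → ℝ) :
        bernExp (insert a S) p₁ (fun ω₁ => bernExp (insert a S) p₂ (g ω₁)) =
        p₁ * (p₂ * bernExp S p₁ (fun ω₁ => bernExp S p₂ fun ω₂ => g (insert a ω₁) (insert a ω₂))
          + (1 - p₂) * bernExp S p₁ (fun ω₁ => bernExp S p₂ fun ω₂ => g (insert a ω₁) ω₂)) +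
        (1 - p₁) * (p₂ * bernExp S p₁ (fun ω₁ => bernExp S p₂ fun ω₂ => g ω₁ (insert a ω₂))
          + (1 - p₂) * bernExp S p₁ (fun ω₁ => bernExp S p₂ fun ω₂ => g ω₁ ω₂)) := by
      have hlin (c d : ℝ) (u v : Finset α → ℝ) :
          bernExp S p₁ (fun ω => c * u ω + d * v ω) = c * bernExp S p₁ u + d * bernExp S p₁ v := by
        rw [bernExp_add]
        simp only [bernExp, Finset.mul_sum]
        congr 1 <;> exact Finset.sum_congr rfl fun ω _ => by ring
      simp only [bernExp_insert ha, hlin]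
    rw [bernExp_insert ha, key, ih, ih]
    simp only [insert_union, union_insert, insert_idem]
    rw [hp']
    ring

lemma bernProb_superset_le (h0 : 0 ≤ p) (I : Finset α) :
    bernProb S p (fun ω => I ⊆ ω) ≤ p ^ #I := by
  induction I using Finset.induction_on with
  | empty => simp [bernProb, bernExp_const]
  | insert a I ha ih =>
    by_cases haS : a ∈ S
    · rw [bernProb_split haS, card_insert_of_notMem ha, pow_succ',
        bernProb_eq_zero (P := fun ω => insert a I ⊆ ω.erase a)
          fun ω _ h => notMem_erase a ω (h (mem_insert_self a I)),
        bernProb_congr (Q := fun ω => I ⊆ ω) fun ω _ => insert_subset_insert_iff ha, mul_zero,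
        add_zero]
      exact mul_le_mul_of_nonneg_left ih h0
    · rw [bernProb_eq_zero fun ω hω h => haS (hω (h (mem_insert_self a I)))]
      positivity

/-- Lower tail of the number of successes in an adaptive sequence of `T` distinct queries to a
random subset. The invariant `Inv Q Y` says that `Q` may have been queried with the elements of `Y`
found to be present. -/
lemma bernProb_adaptive_le (h0 : 0 ≤ p) (h1 : p ≤ 1) {θ : ℝ} (hθ : 0 ≤ θ) (T k : ℕ)
    (bad : Finset α → Prop) (Inv : Finset α → Finset α → Prop) (hinit : Inv ∅ ∅)
    (hstep : ∀ Q Y, Inv Q Y → #Q < T → (∃ ω, Y ⊆ ω ∧ bad ω) →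
      ∃ e ∈ S, e ∉ Q ∧ Inv (insert e Q) (insert e Y) ∧ Inv (insert e Q) Y)
    (hend : ∀ Q Y, Inv Q Y → #Q = T → (∃ ω, Y ⊆ ω ∧ bad ω) → #Y ≤ k) :
    bernProb S p bad ≤ Real.exp (θ * (k - p * T / (1 + θ))) := by
  set z : ℝ := (1 + θ)⁻¹ with hz
  have hz0 : 0 < z := by positivity
  have hz1 : z ≤ 1 := inv_le_one_of_one_le₀ (by linarith)
  have hb : 0 ≤ p * z + (1 - p) := by nlinarith [mul_nonneg h0 hz0.le]
  have main : ∀ t Q Y, Inv Q Y → Y ⊆ Q → #Q + t = T →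
      bernProb S p (fun ω => bad (ω \ Q ∪ Y)) ≤ z ^ #Y * (1 + θ) ^ k * (p * z + (1 - p)) ^ t := by
    intro t
    induction t with
    | zero =>
      intro Q Y hI _ hQ
      rw [pow_zero, mul_one, ← bernExp_const (S := S) (p := p) (z ^ #Y * (1 + θ) ^ k)]
      refine bernExp_mono h0 h1 fun ω _ => ?_
      split_ifs with hbad
      · have hk := hend Q Y hI hQ ⟨_, subset_union_right, hbad⟩
        calc (1 : ℝ) = z ^ #Y * (1 + θ) ^ #Y := by
              rw [← mul_pow, hz, inv_mul_cancel₀ (by positivity), one_pow]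
          _ ≤ z ^ #Y * (1 + θ) ^ k := by gcongr; linarith
      · positivity
    | succ t ih =>
      intro Q Y hI hYQ hQ
      by_cases hex : ∃ ω, Y ⊆ ω ∧ bad ω
      · obtain ⟨e, heS, heQ, hyes, hno⟩ := hstep Q Y hI (by omega) hex
        have hc : #(insert e Q) + t = T := by rw [card_insert_of_notMem heQ]; omega
        have i1 := ih _ _ hyes (insert_subset_insert e hYQ) hc
        have i2 := ih _ _ hno (hYQ.trans (subset_insert e Q)) hc
        rw [card_insert_of_notMem fun h => heQ (hYQ h)] at i1
        have e1 (ω : Finset α) : insert e ω \ Q ∪ Y = ω \ insert e Q ∪ insert e Y := by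
          ext x
          by_cases hx : x = e <;> simp [hx, heQ]
        have e2 (ω : Finset α) : ω.erase e \ Q ∪ Y = ω \ insert e Q ∪ Y := by
          ext x
          by_cases hx : x = e <;> simp [hx]
        rw [bernProb_split heS]
        simp only [e1, e2]
        calc _ ≤ p * (z ^ (#Y + 1) * (1 + θ) ^ k * (p * z + (1 - p)) ^ t) +
              (1 - p) * (z ^ #Y * (1 + θ) ^ k * (p * z + (1 - p)) ^ t) :=
              add_le_add (mul_le_mul_of_nonneg_left i1 h0)
                (mul_le_mul_of_nonneg_left i2 (sub_nonneg.2 h1))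
          _ = _ := by ring
      · rw [bernProb, ← bernExp_const (S := S) (p := p)
          (z ^ #Y * (1 + θ) ^ k * (p * z + (1 - p)) ^ (t + 1))]
        refine bernExp_mono h0 h1 fun ω _ => ?_
        rw [if_neg fun h => hex ⟨_, subset_union_right, h⟩]
        positivity
  have h := main T ∅ ∅ hinit (Subset.refl _) (by simp)
  simp only [sdiff_empty, union_empty, card_empty, pow_zero, one_mul] at h
  refine h.trans ?_
  have hzθ : 1 - z = θ / (1 + θ) := by rw [hz]; field_simp; ring
  have b1 : (1 + θ) ^ k ≤ Real.exp (k * θ) := by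
    rw [Real.exp_nat_mul]
    exact pow_le_pow_left₀ (by positivity) (by linarith [Real.add_one_le_exp θ]) k
  have b2 : (p * z + (1 - p)) ^ T ≤ Real.exp (T * (-(p * (1 - z)))) := by
    rw [Real.exp_nat_mul]
    exact pow_le_pow_left₀ hb (by linarith [Real.add_one_le_exp (-(p * (1 - z)))]) T
  calc _ ≤ Real.exp (k * θ) * Real.exp (T * (-(p * (1 - z)))) := by gcongr
    _ = _ := by
      rw [← Real.exp_add, hzθ]
      congr 1
      ring

end Bernoulli

section DepthFirstSearch

open Finset

variable {V : Type*}

/-- The graph with edge set `ω` has no path with `L` vertices. -/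
def NoPath (L : ℕ) (ω : Finset (Sym2 V)) : Prop :=
  ∀ U : List V, U.Nodup → U.IsChain (fun a b => s(a, b) ∈ ω) → U.length ≠ L

lemma NoPath.length_lt {L : ℕ} {ω : Finset (Sym2 V)} (h : NoPath L ω) {U : List V} (hnd : U.Nodup)
    (hc : U.IsChain fun a b => s(a, b) ∈ ω) : U.length < L := by
  by_contra hlt
  refine h (U.take L) (hnd.sublist (List.take_sublist L U)) (hc.take L) ?_
  rw [List.length_take]
  omega

variable [Fintype V] [DecidableEq V]

/-- A state of depth-first search in which the pairs in `Q` have been queried, those in `Y` have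
been found to be edges, the stack is the path `U`, the vertices in `R` are undiscovered and all
other vertices are finished. There are at most `m` finished vertices and at most `L` vertices on the
stack. -/
structure DFSState (m L : ℕ) (Q Y : Finset (Sym2 V)) (U : List V) (R : Finset V) : Prop where
  nodup : U.Nodup
  notMem : ∀ v ∈ U, v ∉ R
  isChain : U.IsChain fun a b => s(a, b) ∈ Y
  queried : ∀ a r, a ∉ R → a ∉ U → r ∈ R → s(a, r) ∈ Q
  card_found : #Y + #R ≤ Fintype.card V
  card_finished : Fintype.card V ≤ #R + U.length + m
  length_le : U.length ≤ L

variable {m L : ℕ} {Q Y : Finset (Sym2 V)} {U : List V} {R : Finset V}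

/-- If all pairs between the finished and the undiscovered vertices have been queried, then the
number of such pairs is at most the number of queries. -/
lemma card_mul_card_le_of_queried (hnd : U.Nodup) (hUR : ∀ v ∈ U, v ∉ R)
    (hq : ∀ a r, a ∉ R → a ∉ U → r ∈ R → s(a, r) ∈ Q) :
    (Fintype.card V - #R - U.length) * #R ≤ #Q := by
  set A : Finset V := univ \ (R ∪ U.toFinset) with hA
  have hdisj : Disjoint R U.toFinset := by
    rw [Finset.disjoint_left]
    intro v hv hvU
    exact hUR v (List.mem_toFinset.1 hvU) hv
  have hcard : #A = Fintype.card V - #R - U.length := by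
    rw [hA, card_sdiff_of_subset (subset_univ _), card_univ, card_union_of_disjoint hdisj,
      List.toFinset_card_of_nodup hnd, Nat.sub_sub]
  have hAm : ∀ a ∈ A, a ∉ R ∧ a ∉ U := by
    intro a ha
    simpa [hA] using ha
  rw [← hcard, ← card_product]
  refine card_le_card_of_injOn (fun x => s(x.1, x.2)) ?_ ?_
  · rintro ⟨a, r⟩ hx
    have hx' := mem_product.1 (mem_coe.1 hx)
    exact hq a r (hAm a hx'.1).1 (hAm a hx'.1).2 hx'.2
  · rintro ⟨a, r⟩ hx ⟨a', r'⟩ hx' h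
    have hx := mem_product.1 (mem_coe.1 hx)
    have hx' := mem_product.1 (mem_coe.1 hx')
    rcases Sym2.eq_iff.1 h with ⟨h1, h2⟩ | ⟨h1, -⟩
    · exact Prod.ext h1 h2
    · exact absurd hx'.2 (h1 ▸ (hAm a hx.1).1)

lemma DFSState.exists_query (hL : 1 ≤ L)
    (hQ : #Q < (m + 1) * (Fintype.card V - (m + 1) - L)) (h : DFSState m L Q Y U R) :
    ∃ v U' R', DFSState m L Q Y (v :: U') R' ∧ ∃ w ∈ R', s(v, w) ∉ Q := by
  have hV : (m + 1) + L < Fintype.card V := by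
    by_contra hcon
    rw [Nat.sub_sub, Nat.sub_eq_zero_of_le (not_lt.1 hcon)] at hQ
    omega
  induction hk : 2 * #R + U.length using Nat.strong_induction_on generalizing U R with
  | _ k ih =>
  cases U with
  | nil =>
    have hc := h.card_finished
    have hRpos : 0 < #R := by simp at hc; omega
    obtain ⟨r, hr⟩ := card_pos.1 hRpos
    have hcr := card_erase_of_mem hr
    refine ih (2 * #(R.erase r) + 1) (by simp at hk; omega) (U := [r]) (R := R.erase r) ?_ (by simp)
    refine ⟨by simp, by simp, by simp, fun a b ha hau hb => ?_, ?_, ?_, by simpa using hL⟩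
    · have har : a ≠ r := by simpa using hau
      exact h.queried a b (fun haR => ha (mem_erase.2 ⟨har, haR⟩)) (by simp) (mem_of_mem_erase hb)
    · have := h.card_found
      omega
    · simp at hc ⊢
      omega
  | cons v U =>
    by_cases hw : ∃ w ∈ R, s(v, w) ∉ Q
    · exact ⟨v, U, R, h, hw⟩
    push Not at hw
    refine ih (2 * #R + U.length) (by simp at hk; omega) (U := U) (R := R) ?_ rfl
    have hnd := List.nodup_cons.1 h.nodup
    have hq : ∀ a r, a ∉ R → a ∉ U → r ∈ R → s(a, r) ∈ Q := by
      intro a r haR haU hr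
      by_cases hav : a = v
      · exact hav ▸ hw r hr
      · exact h.queried a r haR (by simp [hav, haU]) hr
    have hUR : ∀ u ∈ U, u ∉ R := fun u hu => h.notMem u (List.mem_cons_of_mem v hu)
    have hlen := h.length_le
    have hc := h.card_finished
    simp only [List.length_cons] at hlen hc
    refine ⟨hnd.2, hUR, h.isChain.tail, hq, h.card_found, ?_, by omega⟩
    by_contra hcon
    have hprod := card_mul_card_le_of_queried hnd.2 hUR hq
    have e1 : Fintype.card V - #R - U.length = m + 1 := by omega
    have e2 : Fintype.card V - (m + 1) - L ≤ #R := by omega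
    rw [e1] at hprod
    exact absurd (hQ.trans_le (Nat.mul_le_mul_left _ e2)) (not_lt.2 hprod)

lemma bernProb_noPath_le {p : ℝ} (h0 : 0 ≤ p) (h1 : p ≤ 1) {θ : ℝ} (hθ : 0 ≤ θ) (hL : 1 ≤ L)
    {S : Finset (Sym2 V)} (hS : ∀ v w : V, v ≠ w → s(v, w) ∈ S) :
    bernProb S p (NoPath L) ≤ Real.exp (θ * ((m + L : ℕ) -
      p * ((m + 1) * (Fintype.card V - (m + 1) - L) : ℕ) / (1 + θ))) := by
  refine bernProb_adaptive_le h0 h1 hθ _ _ _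
    (fun Q Y => ∃ U R, DFSState m L Q Y U R) ⟨[], univ, ?_⟩ ?_ ?_
  · exact ⟨by simp, by simp, by simp, by simp, by simp, by simp, by simp⟩
  · rintro Q Y ⟨U₀, R₀, h₀⟩ hQ ⟨ω, hYω, hω⟩
    obtain ⟨v, U, R, h, w, hw, hvw⟩ := h₀.exists_query hL hQ
    have hvR := h.notMem v (by simp)
    have hne : v ≠ w := fun e => hvR (e ▸ hw)
    have hlt := hω.length_lt h.nodup (h.isChain.imp fun _ _ hab => hYω hab)
    have hcard := card_erase_of_mem hw
    have hpos := card_pos.2 ⟨w, hw⟩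
    have hcf := h.card_found
    have hcd := h.card_finished
    refine ⟨s(v, w), hS v w hne, hvw, ⟨w :: v :: U, R.erase w, ?_⟩, ⟨v :: U, R, ?_⟩⟩
    · refine ⟨List.nodup_cons.2 ⟨fun hmem => h.notMem w hmem hw, h.nodup⟩, ?_, ?_, ?_, ?_, ?_, ?_⟩
      · intro u hu
        rcases List.mem_cons.1 hu with rfl | hu
        · exact notMem_erase _ _
        · exact fun huR => h.notMem u hu (mem_of_mem_erase huR)
      · refine List.isChain_cons_cons.2 ⟨?_, h.isChain.imp fun _ _ hab => mem_insert_of_mem hab⟩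
        rw [Sym2.eq_swap]
        exact mem_insert_self _ _
      · intro a r haR haU hr
        have haw : a ≠ w := fun e => haU (by simp [e])
        exact mem_insert_of_mem (h.queried a r (fun ha => haR (mem_erase.2 ⟨haw, ha⟩))
          (fun ha => haU (List.mem_cons_of_mem w ha)) (mem_of_mem_erase hr))
      · have := card_insert_le s(v, w) Y
        omega
      · simp only [List.length_cons] at hcd ⊢
        omega
      · simp only [List.length_cons] at hlt ⊢
        omega
    · exact ⟨h.nodup, h.notMem, h.isChain,
        fun a r ha hau hr => mem_insert_of_mem (h.queried a r ha hau hr), hcf, hcd, h.length_le⟩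
  · rintro Q Y ⟨U, R, h⟩ - -
    have h1 := h.card_found
    have h2 := h.card_finished
    have h3 := h.length_le
    omega

end DepthFirstSearch

section Excess

open Finset

variable {V : Type*} [DecidableEq V]

/-- The graph with edge set `ω` has a subgraph with `j` more edges than vertices. -/
def HasExcess (j : ℕ) (ω : Finset (Sym2 V)) : Prop :=
  ∃ W : Finset V, ∃ F ⊆ ω, F ⊆ W.sym2 ∧ #F = #W + j

lemma exists_edges_of_isChain {ω : Finset (Sym2 V)} (v : V) (U : List V) (hnd : (v :: U).Nodup)
    (hc : (v :: U).IsChain fun a b => s(a, b) ∈ ω) :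
    ∃ F ⊆ ω, F ⊆ (v :: U).toFinset.sym2 ∧ #F = U.length := by
  induction U generalizing v with
  | nil => exact ⟨∅, by simp, by simp, by simp⟩
  | cons u U ih =>
    obtain ⟨hv, hnd'⟩ := List.nodup_cons.1 hnd
    obtain ⟨hvu, hc'⟩ := List.isChain_cons_cons.1 hc
    obtain ⟨F, hFω, hFU, hF⟩ := ih u hnd' hc'
    have hnew : s(v, u) ∉ F := fun h =>
      hv (List.mem_toFinset.1 (mem_sym2_iff.1 (hFU h) v (Sym2.mem_mk_left v u)))
    refine ⟨insert s(v, u) F, insert_subset hvu hFω, insert_subset ?_ ?_, ?_⟩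
    · simp
    · refine hFU.trans (sym2_mono fun x hx => ?_)
      simp only [List.mem_toFinset] at hx ⊢
      exact List.mem_cons_of_mem v hx
    · rw [card_insert_of_notMem hnew, hF, List.length_cons]

lemma bernProb_card_inter_le {α : Type*} [DecidableEq α] {S : Finset α} {p : ℝ} (h0 : 0 ≤ p)
    (h1 : p ≤ 1) {θ : ℝ} (hθ : 0 ≤ θ) {K : Finset α} (hK : K ⊆ S) (j : ℕ) :
    bernProb S p (fun ω => #(ω ∩ K) ≤ j) ≤ Real.exp (θ * (j - p * #K / (1 + θ))) := by
  refine bernProb_adaptive_le h0 h1 hθ #K j _ (fun Q Y => Q ⊆ K ∧ Y ⊆ Q) (by simp) ?_ ?_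
  · rintro Q Y ⟨hQK, hYQ⟩ hQ -
    obtain ⟨e, heK, heQ⟩ := exists_mem_notMem_of_card_lt_card hQ
    exact ⟨e, hK heK, heQ, ⟨insert_subset heK hQK, insert_subset_insert e hYQ⟩,
      insert_subset heK hQK, hYQ.trans (subset_insert e Q)⟩
  · rintro Q Y ⟨hQK, hYQ⟩ - ⟨ω, hYω, hω⟩
    exact (card_le_card (subset_inter hYω (hYQ.trans hQK))).trans hω

lemma bernProb_le_one {α : Type*} {S : Finset α} {p : ℝ} (h0 : 0 ≤ p) (h1 : p ≤ 1)
    (P : Finset α → Prop) : bernProb S p P ≤ 1 := by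
  refine le_trans (bernExp_mono h0 h1 (g := fun _ => 1) fun ω _ => ?_) (bernExp_const 1).le
  split_ifs <;> simp

/-- Sprinkling: a long path in the first round yields a subgraph with large excess after the
second round. -/
lemma bernProb_not_hasExcess_le {S : Finset (Sym2 V)} (hS : ∀ v w : V, v ≠ w → s(v, w) ∈ S)
    {p p₁ p₂ : ℝ} (h₁ : 0 ≤ p₁) (h₁' : p₁ ≤ 1) (h₂ : 0 ≤ p₂) (h₂' : p₂ ≤ 1)
    (hp : 1 - p = (1 - p₁) * (1 - p₂)) {L : ℕ} (hL : 1 ≤ L) (j : ℕ) {θ : ℝ} (hθ : 0 ≤ θ) :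
    bernProb S p (fun ω => ¬ HasExcess j ω) ≤ bernProb S p₁ (NoPath L) +
      Real.exp (θ * (j - p₂ * (L.choose 2 - L : ℕ) / (1 + θ))) := by
  rw [bernProb, bernExp_union hp, ← bernExp_const (S := S) (p := p₁)
    (Real.exp (θ * (j - p₂ * (L.choose 2 - L : ℕ) / (1 + θ)))), bernProb, ← bernExp_add]
  refine bernExp_mono h₁ h₁' fun ω₁ _ => ?_
  change bernProb S p₂ (fun ω₂ => ¬ HasExcess j (ω₁ ∪ ω₂)) ≤ _
  split_ifs with hpath
  · exact (bernProb_le_one h₂ h₂' _).trans (le_add_of_nonneg_right (Real.exp_pos _).le)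
  · simp only [NoPath, not_forall, not_not] at hpath
    obtain ⟨U, hnd, hc, hlen⟩ := hpath
    obtain ⟨F, hFω, hFU, hF⟩ : ∃ F ⊆ ω₁, F ⊆ U.toFinset.sym2 ∧ #F + 1 = L := by
      cases U with
      | nil => simp at hlen; omega
      | cons v U =>
        obtain ⟨F, hFω, hFU, hF⟩ := exists_edges_of_isChain v U hnd hc
        exact ⟨F, hFω, hFU, by rw [hF, ← hlen, List.length_cons]⟩
    have hW : #U.toFinset = L := by rw [List.toFinset_card_of_nodup hnd, hlen]
    set K : Finset (Sym2 V) := U.toFinset.offDiag.image Sym2.mk.uncurry \ F with hK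
    have hKS : K ⊆ S := by
      intro e he
      obtain ⟨⟨v, w⟩, hvw, rfl⟩ := mem_image.1 (mem_sdiff.1 he).1
      exact hS v w (mem_offDiag.1 hvw).2.2
    have hKU : K ⊆ U.toFinset.sym2 := by
      intro e he
      obtain ⟨⟨v, w⟩, hvw, rfl⟩ := mem_image.1 (mem_sdiff.1 he).1
      have hvw := mem_offDiag.1 hvw
      exact mk_mem_sym2_iff.2 ⟨hvw.1, hvw.2.1⟩
    have hKcard : L.choose 2 - L ≤ #K := by
      have h := le_card_sdiff F (U.toFinset.offDiag.image Sym2.mk.uncurry)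
      rw [Sym2.card_image_offDiag, hW] at h
      rw [hK]
      omega
    rw [zero_add]
    calc bernProb S p₂ (fun ω₂ => ¬ HasExcess j (ω₁ ∪ ω₂))
        ≤ bernProb S p₂ (fun ω₂ => #(ω₂ ∩ K) ≤ j) := by
          refine bernProb_mono h₂ h₂' fun ω₂ _ hex => ?_
          by_contra hlt
          refine hex ?_
          have hdisj : Disjoint F (ω₂ ∩ K) :=
            (disjoint_sdiff (s := F)).mono_right inter_subset_right
          have hle : #U.toFinset + j ≤ #(F ∪ ω₂ ∩ K) := by
            rw [card_union_of_disjoint hdisj]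
            omega
          obtain ⟨F', hF', hcard⟩ := exists_subset_card_eq hle
          exact ⟨U.toFinset, F', hF'.trans (union_subset_union hFω inter_subset_left),
            hF'.trans (union_subset hFU (inter_subset_right.trans hKU)), hcard⟩
      _ ≤ Real.exp (θ * (j - p₂ * #K / (1 + θ))) := bernProb_card_inter_le h₂ h₂' hθ hKS j
      _ ≤ _ := by gcongr

/-- All but `d` of the edges in any set of edges of `ω₁` are also edges of a suitable
relabelling of `ω₂`. -/
def NearlyEmbeds (d : ℕ) (ω₁ ω₂ : Finset (Sym2 V)) : Prop :=
  ∃ π : Equiv.Perm V, ∀ F ⊆ ω₁, #F ≤ #(F ∩ ω₂.image (Sym2.map π)) + d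

lemma bernProb_nearlyEmbeds_le [Fintype V] {S : Finset (Sym2 V)} {p : ℝ} (h0 : 0 ≤ p) (h1 : p ≤ 1)
    {ω₁ W : Finset _} {F : Finset (Sym2 V)} (hF : F ⊆ ω₁) (hFW : F ⊆ W.sym2) (d : ℕ) :
    bernProb S p (NearlyEmbeds d ω₁) ≤ Fintype.card V ^ #W * 2 ^ #F * p ^ (#F - d) := by
  let ext : (W → V) → V → V := fun φ v => if h : v ∈ W then φ ⟨v, h⟩ else v
  let im : (W → V) × Finset (Sym2 V) → Finset (Sym2 V) := fun x => x.2.image (Sym2.map (ext x.1))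
  let I : Finset ((W → V) × Finset (Sym2 V)) :=
    {x ∈ univ ×ˢ F.powerset | #F - d ≤ #(im x)}
  have hI : #I ≤ Fintype.card V ^ #W * 2 ^ #F := by
    refine (card_filter_le _ _).trans ?_
    rw [card_product, card_powerset, card_univ, Fintype.card_fun, Fintype.card_coe]
  calc bernProb S p (NearlyEmbeds d ω₁)
      ≤ ∑ x ∈ I, bernProb S p (fun ω => im x ⊆ ω) := by
        refine bernProb_le_sum h0 h1 _ _ ?_
        rintro ω - ⟨π, hπ⟩
        have hmap : ∀ e ∈ W.sym2, Sym2.map (ext fun w => π.symm w) e = Sym2.map π.symm e := by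
          intro e he
          refine Sym2.map_congr fun v hv => ?_
          simp [ext, mem_sym2_iff.1 he v hv]
        have him : im (fun w => π.symm w, F ∩ ω.image (Sym2.map π)) =
            (F ∩ ω.image (Sym2.map π)).image (Sym2.map π.symm) :=
          image_congr fun e he => hmap e (hFW (mem_inter.1 (mem_coe.1 he)).1)
        refine ⟨(fun w => π.symm w, F ∩ ω.image (Sym2.map π)), ?_, ?_⟩
        · refine mem_filter.2 ⟨by simp, ?_⟩
          rw [him, card_image_of_injective _ (Sym2.map.injective π.symm.injective)]
          have := hπ F hF
          omega
        · rw [him]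
          intro e he
          obtain ⟨e', he', rfl⟩ := mem_image.1 he
          obtain ⟨e, heω, rfl⟩ := mem_image.1 (mem_inter.1 he').2
          simpa [Sym2.map_map] using heω
    _ ≤ ∑ _x ∈ I, p ^ (#F - d) := by
        refine Finset.sum_le_sum fun x hx => (bernProb_superset_le h0 _).trans ?_
        exact pow_le_pow_of_le_one h0 h1 (mem_filter.1 hx).2
    _ = #I * p ^ (#F - d) := by rw [sum_const, nsmul_eq_mul]
    _ ≤ _ := by
        gcongr
        exact_mod_cast hI

end Excess

section ErdosRenyi

open Finset

/-- The set of all possible edges on `n` vertices. -/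
def allEdges (n : ℕ) : Finset (Sym2 (Fin n)) := (univ : Finset (Fin n)).offDiag.image Sym2.mk.uncurry

lemma card_allEdges (n : ℕ) : #(allEdges n) = n.choose 2 := by
  rw [allEdges, Sym2.card_image_offDiag, card_univ, Fintype.card_fin]

lemma mk_mem_allEdges {n : ℕ} {v w : Fin n} : s(v, w) ∈ allEdges n ↔ v ≠ w := by
  constructor
  · intro h
    obtain ⟨⟨a, b⟩, hab, h⟩ := mem_image.1 h
    have hne := (mem_offDiag.1 hab).2.2
    rcases Sym2.eq_iff.1 h with ⟨rfl, rfl⟩ | ⟨rfl, rfl⟩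
    · exact hne
    · exact hne.symm
  · exact fun h => mem_image.2 ⟨(v, w), by simpa using h, rfl⟩

/-- The edge set of a graph as a finite set. -/
def edges {n : ℕ} (G : SimpleGraph (Fin n)) : Finset (Sym2 (Fin n)) := {e | e ∈ G.edgeSet}

lemma sum_erProb_mul (n : ℕ) (p : ℝ) (f : Finset (Sym2 (Fin n)) → ℝ) :
    ∑ G : SimpleGraph (Fin n), erProb n p G * f (edges G) = bernExp (allEdges n) p f := by
  rw [bernExp]
  refine Finset.sum_nbij' edges (fun ω => SimpleGraph.fromEdgeSet (ω : Set (Sym2 (Fin n))))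
    ?_ ?_ ?_ ?_ ?_
  · intro G _
    refine mem_powerset.2 fun e he => ?_
    induction e with
    | _ v w =>
      have : G.Adj v w := by simpa [edges] using he
      exact mk_mem_allEdges.2 this.ne
  · simp
  · intro G _
    ext v w
    simp [edges]
  · intro ω hω
    ext e
    induction e with
    | _ v w =>
      simpa [edges] using fun h => mk_mem_allEdges.1 (mem_powerset.1 hω h)
  · intro G _
    have hc : Nat.card G.edgeSet = #(edges G) := by
      rw [edges, Nat.card_eq_fintype_card, Fintype.card_subtype]
    rw [erProb, hc, card_allEdges]

lemma nearlyEmbeds_of_editDist_le {n d : ℕ} {G₁ G₂ : SimpleGraph (Fin n)}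
    (h : editDist G₁ G₂ ≤ d) : NearlyEmbeds d (edges G₁) (edges G₂) := by
  obtain ⟨G₂', ⟨f⟩, hk⟩ : editDist G₁ G₂ ∈ { k : ℕ | ∃ G₂' : SimpleGraph (Fin n),
      Nonempty (G₂' ≃g G₂) ∧ k = Nat.card ↥(G₁.edgeSet ∆ G₂'.edgeSet) } :=
    Nat.sInf_mem ⟨_, G₂, ⟨SimpleGraph.Iso.refl⟩, rfl⟩
  refine ⟨f.symm.toEquiv, fun F hF => ?_⟩
  have himage : edges G₂' ⊆ (edges G₂).image (Sym2.map f.symm.toEquiv) := by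
    intro e he
    refine mem_image.2 ⟨Sym2.map f e, ?_, ?_⟩
    · induction e with
      | _ v w =>
        have : G₂'.Adj v w := by simpa [edges] using he
        simpa [edges] using f.map_adj_iff.2 this
    · induction e with
      | _ v w => simp
  have hdiff : #(F \ edges G₂') ≤ editDist G₁ G₂ := by
    rw [hk, Nat.card_eq_fintype_card, Fintype.card_subtype]
    refine card_le_card fun e he => ?_
    obtain ⟨h1, h2⟩ := mem_sdiff.1 he
    have h1' := hF h1
    simp only [edges, mem_filter, mem_univ, true_and] at h1' h2
    exact mem_filter.2 ⟨mem_univ e, Or.inl ⟨h1', h2⟩⟩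
  have hsum := card_inter_add_card_sdiff F (edges G₂')
  have hle := card_le_card (inter_subset_inter (Subset.refl F) himage)
  omega

lemma sum_editDist_lt_le {n : ℕ} {p δ B : ℝ} (h0 : 0 ≤ p) (h1 : p ≤ 1) (j : ℕ)
    (hB : ∀ w ≤ n, (n : ℝ) ^ w * 2 ^ (w + j) * p ^ (w + j - ⌊δ * n⌋₊) ≤ B) :
    (∑ G₁ : SimpleGraph (Fin n), ∑ G₂ : SimpleGraph (Fin n),
      if (editDist G₁ G₂ : ℝ) < δ * n then erProb n p G₁ * erProb n p G₂ else 0) ≤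
    bernProb (allEdges n) p (fun ω => ¬ HasExcess j ω) + B := by
  have hB0 : 0 ≤ B := le_trans (by positivity) (hB 0 (Nat.zero_le n))
  have hnn (G : SimpleGraph (Fin n)) : 0 ≤ erProb n p G := by
    have : 0 ≤ 1 - p := sub_nonneg.2 h1
    rw [erProb]
    positivity
  calc _ ≤ ∑ G₁ : SimpleGraph (Fin n), erProb n p G₁ *
          bernProb (allEdges n) p (NearlyEmbeds ⌊δ * n⌋₊ (edges G₁)) := by
        refine Finset.sum_le_sum fun G₁ _ => ?_
        rw [bernProb, ← sum_erProb_mul, Finset.mul_sum]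
        refine Finset.sum_le_sum fun G₂ _ => ?_
        by_cases h : (editDist G₁ G₂ : ℝ) < δ * n
        · rw [if_pos h, if_pos (nearlyEmbeds_of_editDist_le (Nat.le_floor h.le)), mul_one]
        · rw [if_neg h]
          have h1 := hnn G₁
          have h2 := hnn G₂
          split_ifs <;> positivity
    _ = bernExp (allEdges n) p fun ω =>
          bernProb (allEdges n) p (NearlyEmbeds ⌊δ * n⌋₊ ω) :=
        sum_erProb_mul n p fun ω => bernProb (allEdges n) p (NearlyEmbeds ⌊δ * n⌋₊ ω)
    _ ≤ _ := by
        rw [← bernExp_const (S := allEdges n) (p := p) B, bernProb, ← bernExp_add]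
        refine bernExp_mono h0 h1 fun ω _ => ?_
        by_cases hex : HasExcess j ω
        · rw [if_neg (not_not.2 hex), zero_add]
          obtain ⟨W, F, hF, hFW, hcard⟩ := hex
          refine (bernProb_nearlyEmbeds_le h0 h1 hF hFW _).trans ?_
          rw [hcard, Fintype.card_fin]
          refine hB #W ?_
          simpa using card_le_univ W
        · rw [if_pos hex]
          exact (bernProb_le_one h0 h1 _).trans (le_add_of_nonneg_right hB0)

end ErdosRenyi

section Asymptotics

open Finset

lemma bernProb_noPath_le_exp {n : ℕ} {θ : ℝ} (hθ : 0 < θ) (hθ' : θ ≤ 1 / 8)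
    (hn : 2 ≤ θ ^ 2 * n) :
    bernProb (allEdges n) ((1 + 8 * θ) / n) (NoPath ⌊θ ^ 2 * n⌋₊) ≤
      Real.exp (-(θ ^ 3 / 2) * n) := by
  have hn0 : (0 : ℝ) < n := by
    by_contra h
    nlinarith [sq_nonneg θ]
  have hn' : 2 ≤ θ * n := by nlinarith
  set m := ⌊θ * n⌋₊ with hm
  set L := ⌊θ ^ 2 * n⌋₊ with hLdef
  have hL : 1 ≤ L := Nat.le_floor (by push_cast; linarith)
  have hmle : (m : ℝ) ≤ θ * n := Nat.floor_le (by positivity)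
  have hLle : (L : ℝ) ≤ θ ^ 2 * n := Nat.floor_le (by positivity)
  have hmlt : θ * n < m + 1 := Nat.lt_floor_add_one _
  have hp1 : (1 + 8 * θ) / n ≤ 1 := by
    rw [div_le_one hn0]
    nlinarith
  refine (bernProb_noPath_le (m := m) (by positivity) hp1 hθ.le hL
    fun v w h => mk_mem_allEdges.2 h).trans ?_
  rw [Real.exp_le_exp, Fintype.card_fin]
  have hT : θ * n * (n - θ * n - 1 - θ ^ 2 * n) ≤ ((m + 1) * (n - (m + 1) - L) : ℕ) := by
    have hsub : (n : ℝ) - (m + 1) - L ≤ (n - (m + 1) - L : ℕ) := by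
      have : n ≤ (n - (m + 1) - L) + ((m + 1) + L) := by omega
      have : (n : ℝ) ≤ ((n - (m + 1) - L : ℕ) : ℝ) + ((m + 1) + L) := by exact_mod_cast this
      linarith
    rw [Nat.cast_mul]
    have hpos : 0 ≤ (n : ℝ) - θ * n - 1 - θ ^ 2 * n := by nlinarith
    push_cast
    exact mul_le_mul hmlt.le (by linarith) hpos (by positivity)
  have hpT : θ * (n * (1 + 5 * θ) - 2) ≤
      (1 + 8 * θ) / n * ((m + 1) * (n - (m + 1) - L) : ℕ) := by
    calc θ * (n * (1 + 5 * θ) - 2) ≤ (1 + 8 * θ) * θ * (n - θ * n - 1 - θ ^ 2 * n) := by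
          have h2 : 1 + 5 * θ ≤ (1 + 8 * θ) * (1 - θ - θ ^ 2) := by nlinarith [sq_nonneg θ]
          have h3 := mul_le_mul_of_nonneg_left h2 hn0.le
          have h4 : n * (1 + 5 * θ) - 2 ≤ (1 + 8 * θ) * (n - θ * n - 1 - θ ^ 2 * n) := by
            nlinarith
          nlinarith [mul_le_mul_of_nonneg_left h4 hθ.le]
      _ = (1 + 8 * θ) / n * (θ * n * (n - θ * n - 1 - θ ^ 2 * n)) := by
          field_simp
      _ ≤ _ := by gcongr
  have hmain : ((m + L : ℕ) : ℝ) - (1 + 8 * θ) / n * ((m + 1) * (n - (m + 1) - L) : ℕ) / (1 + θ) ≤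
      -(θ ^ 2 / 2) * n := by
    have h1θ : 0 < 1 + θ := by linarith
    rw [sub_le_iff_le_add, ← sub_le_iff_le_add', le_div_iff₀ h1θ]
    refine le_trans ?_ hpT
    push_cast
    have hmL : ((m : ℝ) + L + θ ^ 2 / 2 * n) * (1 + θ) ≤
        (θ * n + θ ^ 2 * n + θ ^ 2 / 2 * n) * (1 + θ) := by gcongr
    have hfin : (θ * n + θ ^ 2 * n + θ ^ 2 / 2 * n) * (1 + θ) ≤ θ * (n * (1 + 5 * θ) - 2) := by
      have h5 : (n + θ * n + θ / 2 * n) * (1 + θ) ≤ n * (1 + 5 * θ) - 2 := by nlinarith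
      nlinarith [mul_le_mul_of_nonneg_left h5 hθ.le]
    linarith
  calc _ ≤ θ * (-(θ ^ 2 / 2) * n) := mul_le_mul_of_nonneg_left hmain hθ.le
    _ = _ := by ring

lemma sprinkling_exponent_le {n : ℕ} {μ s p : ℝ} (hs : 0 < s) (hn : 8 ≤ μ * n)
    (hn0 : (0 : ℝ) < n) (hp : s / n ≤ p) :
    1 * ((⌊s * μ ^ 2 / 32 * n⌋₊ : ℝ) - p * (⌊μ * n⌋₊.choose 2 - ⌊μ * n⌋₊ : ℕ) / (1 + 1)) ≤
      -(s * μ ^ 2 / 32) * n := by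
  set L := ⌊μ * n⌋₊ with hL
  have hL8 : 8 ≤ L := Nat.le_floor (by exact_mod_cast hn)
  have hLr : (8 : ℝ) ≤ L := by exact_mod_cast hL8
  have hlt : μ * n < L + 1 := Nat.lt_floor_add_one _
  have hK : (μ * n) ^ 2 / 8 ≤ (L.choose 2 - L : ℕ) := by
    have h1 : ((L.choose 2 : ℕ) : ℝ) ≤ ((L.choose 2 - L : ℕ) : ℝ) + L := by
      have : L.choose 2 ≤ (L.choose 2 - L) + L := by omega
      exact_mod_cast this
    rw [Nat.cast_choose_two] at h1
    nlinarith
  have hj : (⌊s * μ ^ 2 / 32 * n⌋₊ : ℝ) ≤ s * μ ^ 2 / 32 * n := Nat.floor_le (by positivity)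
  have hpK : s * μ ^ 2 * n / 8 ≤ p * (L.choose 2 - L : ℕ) := by
    calc s * μ ^ 2 * n / 8 = s / n * ((μ * n) ^ 2 / 8) := by field_simp
      _ ≤ _ := mul_le_mul hp hK (by positivity) (le_trans (by positivity) hp)
  linarith

lemma embedding_bound {n : ℕ} {c ε : ℝ} (hc : 1 ≤ c) (hε : 0 < ε) (hε' : ε ≤ 1)
    (hn : 4 ≤ ε * n) (hlog : 4 / ε * (2 * Real.log (2 * c) + 1) ≤ Real.log n) (w : ℕ)
    (hw : w ≤ n) :
    (n : ℝ) ^ w * 2 ^ (w + ⌊ε * n⌋₊) * (c / n) ^ (w + ⌊ε * n⌋₊ - ⌊ε / 2 * n⌋₊) ≤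
      Real.exp (-n) := by
  have hn0 : (0 : ℝ) < n := by
    by_contra h
    nlinarith
  have hn1 : (1 : ℝ) ≤ n := by nlinarith
  set j := ⌊ε * n⌋₊ with hj
  set d := ⌊ε / 2 * n⌋₊ with hd
  have hjle : (j : ℝ) ≤ ε * n := Nat.floor_le (by positivity)
  have hjlt : ε * n < j + 1 := Nat.lt_floor_add_one _
  have hdle : (d : ℝ) ≤ ε / 2 * n := Nat.floor_le (by positivity)
  have hdj : d ≤ j := Nat.floor_mono (by nlinarith)
  have hjn : j ≤ n := by
    have : (j : ℝ) ≤ n := by nlinarith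
    exact_mod_cast this
  obtain ⟨t, ht⟩ := Nat.exists_eq_add_of_le hdj
  have htr : ε / 4 * n ≤ t := by
    have : (j : ℝ) = d + t := by exact_mod_cast ht
    linarith
  have hwt : w + j - d = w + t := by omega
  have hlogn : 0 ≤ Real.log n := Real.log_nonneg hn1
  have hlogc : 0 ≤ Real.log (2 * c) := Real.log_nonneg (by linarith)
  calc (n : ℝ) ^ w * 2 ^ (w + j) * (c / n) ^ (w + j - d)
      = 2 ^ (w + j) * c ^ (w + t) / (n : ℝ) ^ t := by
        rw [hwt, div_pow, pow_add (n : ℝ)]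
        field_simp
    _ ≤ 2 ^ (2 * n) * c ^ (2 * n) / (n : ℝ) ^ t := by
        have e1 : w + j ≤ 2 * n := by omega
        have e2 : w + t ≤ 2 * n := by omega
        gcongr
        norm_num
    _ = Real.exp (2 * n * Real.log (2 * c) - t * Real.log n) := by
        rw [← mul_pow, Real.exp_sub, Real.exp_nat_mul, Real.exp_log hn0]
        congr 1
        have := Real.exp_nat_mul (Real.log (2 * c)) (2 * n)
        rw [Real.exp_log (by linarith)] at this
        rw [← this]
        push_cast
        rfl
    _ ≤ Real.exp (-n) := by
        rw [Real.exp_le_exp]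
        have h1 : ε / 4 * n * Real.log n ≤ t * Real.log n := by gcongr
        have h2 : ε / 4 * n * (4 / ε * (2 * Real.log (2 * c) + 1)) ≤ ε / 4 * n * Real.log n := by
          gcongr
        have h3 : ε / 4 * n * (4 / ε * (2 * Real.log (2 * c) + 1)) =
            n * (2 * Real.log (2 * c) + 1) := by
          field_simp
        linarith

lemma tendsto_exp_neg_mul_nat {a : ℝ} (ha : 0 < a) :
    Tendsto (fun n : ℕ => Real.exp (-a * n)) atTop (nhds 0) :=
  Real.tendsto_exp_atBot.comp
    (tendsto_natCast_atTop_atTop.const_mul_atTop_of_neg (neg_neg_of_pos ha))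

end Asymptotics


/-- For every constant `c > 1` there is `δ = δ(c) > 0` such that, if
`G₁, G₂` are independent instances of `G(n, c/n)`, then whp the unnormalized edit
distance between `G₁` and `G₂` is at least `δn`; equivalently, the probability that
`editDist G₁ G₂ < δ n` tends to `0` as `n → ∞`. -/
theorem whp_editDist_large (c : ℝ) (hc : 1 < c) :
    ∃ δ : ℝ, 0 < δ ∧
      Tendsto (fun n : ℕ =>
          ∑ G₁ : SimpleGraph (Fin n), ∑ G₂ : SimpleGraph (Fin n),
            if (editDist G₁ G₂ : ℝ) < δ * n then
              erProb n (c / n) G₁ * erProb n (c / n) G₂ else 0)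
        atTop (nhds 0) := by
  obtain ⟨θ, hθ, hθ8, hθc⟩ : ∃ θ : ℝ, 0 < θ ∧ θ ≤ 1 / 8 ∧ 1 + 8 * θ < c :=
    ⟨min (1 / 8) ((c - 1) / 16), lt_min (by norm_num) (by linarith), min_le_left _ _, by
      linarith [min_le_right (1 / 8) ((c - 1) / 16)]⟩
  obtain ⟨s, hs, hs1, hsc⟩ : ∃ s : ℝ, 0 < s ∧ s ≤ 1 ∧ s ≤ c - (1 + 8 * θ) :=
    ⟨min 1 (c - (1 + 8 * θ)), lt_min one_pos (by linarith), min_le_left _ _, min_le_right _ _⟩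
  set ε : ℝ := s * (θ ^ 2) ^ 2 / 32 with hε
  have hε0 : 0 < ε := by positivity
  have hε1 : ε ≤ 1 := by
    have h1 : (θ ^ 2) ^ 2 ≤ 1 := pow_le_one₀ (by positivity) (pow_le_one₀ hθ.le (by linarith))
    have h2 : s * (θ ^ 2) ^ 2 ≤ 1 := mul_le_one₀ hs1 (by positivity) h1
    rw [hε]
    linarith
  refine ⟨ε / 2, by positivity, ?_⟩
  have hlim : Tendsto (fun n : ℕ => Real.exp (-(θ ^ 3 / 2) * n) + Real.exp (-ε * n) +
      Real.exp (-1 * n)) atTop (nhds 0) := by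
    simpa using ((tendsto_exp_neg_mul_nat (a := θ ^ 3 / 2) (by positivity)).add
      (tendsto_exp_neg_mul_nat hε0)).add (tendsto_exp_neg_mul_nat one_pos)
  have hcast := tendsto_natCast_atTop_atTop (R := ℝ)
  refine squeeze_zero' ?_ ?_ hlim
  · filter_upwards [hcast.eventually_ge_atTop c] with n hn
    have h0 : 0 ≤ 1 - c / n := sub_nonneg.2 (div_le_one_of_le₀ hn (by linarith))
    have h1 : 0 ≤ c / n := by positivity
    refine Finset.sum_nonneg fun G₁ _ => Finset.sum_nonneg fun G₂ _ => ?_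
    split_ifs
    · rw [erProb, erProb]
      positivity
    · exact le_rfl
  · filter_upwards [hcast.eventually_ge_atTop c, hcast.eventually_ge_atTop (8 / θ ^ 2),
      hcast.eventually_ge_atTop (4 / ε), hcast.eventually_ge_atTop 3,
      (Real.tendsto_log_atTop.comp hcast).eventually_ge_atTop
        (4 / ε * (2 * Real.log (2 * c) + 1))] with n hnc hnθ hnε hn3 hlog
    have hn0 : (0 : ℝ) < n := by linarith
    rw [div_le_iff₀' (by positivity)] at hnθ hnε
    have hp1 : c / n ≤ 1 := div_le_one_of_le₀ hnc hn0.le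
    have hq0 : 0 ≤ (1 + 8 * θ) / n := by positivity
    have hq1 : (1 + 8 * θ) / n < 1 := by
      rw [div_lt_one hn0]
      linarith
    have hqp : (1 + 8 * θ) / n + s / n ≤ c / n := by
      rw [← add_div]
      gcongr
      linarith
    set p := c / (n : ℝ) with hp
    set q := (1 + 8 * θ) / (n : ℝ) with hq
    have hq' : 0 < 1 - q := by linarith
    have hsn : 0 < s / n := by positivity
    have hr : s / n ≤ (p - q) / (1 - q) := by
      rw [le_div_iff₀ hq']
      nlinarith
    have hr1 : (p - q) / (1 - q) ≤ 1 := by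
      rw [div_le_one hq']
      linarith
    have hpq : 1 - p = (1 - q) * (1 - (p - q) / (1 - q)) := by
      field_simp
      ring
    have hL : 1 ≤ ⌊θ ^ 2 * n⌋₊ := Nat.le_floor (by push_cast; linarith)
    refine (sum_editDist_lt_le (by positivity) hp1 ⌊ε * n⌋₊
      (embedding_bound hc.le hε0 hε1 hnε hlog)).trans ?_
    rw [neg_one_mul]
    gcongr
    refine (bernProb_not_hasExcess_le (fun v w h => mk_mem_allEdges.2 h) hq0 hq1.le
      (hsn.le.trans hr) hr1 hpq hL ⌊ε * n⌋₊ zero_le_one).trans ?_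
    exact add_le_add (bernProb_noPath_le_exp hθ hθ8 (by linarith))
      (Real.exp_le_exp.2 (sprinkling_exponent_le hs hnθ hn0 hr))
end
end

section
/- Let κ₁ and κ₂ be finite-type kernels. Then the following are equivalent: (i) there is a finite-type kernel κ_r with κ_r ≺ κ₁ and κ_r ≺ κ₂ (a common refinement); (ii) there is a finite-type kernel κ_c with κ₁ ≺ κ_c and κ₂ ≺ κ_c (a common coarsening). -/
noncomputable section
open scoped Classical

/-- `(μ, κ)` is a finite-type kernel on the finite probability space `(Fin m, μ)`:
`μ` is a probability measure on `Fin m` and `κ` is symmetric and nonnegative. -/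
def IsFinKernel {m : ℕ} (μ : Fin m → ℝ) (κ : Fin m → Fin m → ℝ) : Prop :=
  (∀ x, 0 ≤ μ x) ∧ (∑ x, μ x = 1) ∧ (∀ x y, κ x y = κ y x) ∧ (∀ x y, 0 ≤ κ x y)

/-- `κ₁ ≺ κ₂` (`κ₁` refines `κ₂`): there is a measure-preserving map
`τ : S₁ → S₂` such that for every `x ∈ S₁` with `μ₁(x) > 0` and every `z ∈ S₂`,
`Σ_{y : τ(y) = z} κ₁(x,y) μ₁(y) = κ₂(τ(x), z) μ₂(z)`. -/
def Refines {m₁ m₂ : ℕ} (μ₁ : Fin m₁ → ℝ) (κ₁ : Fin m₁ → Fin m₁ → ℝ)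
    (μ₂ : Fin m₂ → ℝ) (κ₂ : Fin m₂ → Fin m₂ → ℝ) : Prop :=
  ∃ τ : Fin m₁ → Fin m₂,
    (∀ z, μ₂ z = ∑ y ∈ Finset.univ.filter (fun y => τ y = z), μ₁ y) ∧
    (∀ x, 0 < μ₁ x → ∀ z,
      (∑ y ∈ Finset.univ.filter (fun y => τ y = z), κ₁ x y * μ₁ y) = κ₂ (τ x) z * μ₂ z)

/-- The pushforward of a weight function along a map of finite types. -/
def pushforward {S T : Type*} [Fintype S] [DecidableEq T] (τ : S → T) (a : S → ℝ) (z : T) : ℝ :=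
  ∑ y ∈ Finset.univ.filter (fun y => τ y = z), a y

theorem sum_pushforward {S T : Type*} [Fintype S] [Fintype T] [DecidableEq T]
    (τ : S → T) (a : S → ℝ) : ∑ z, pushforward τ a z = ∑ y, a y :=
  Finset.sum_fiberwise Finset.univ τ a

theorem pushforward_nonneg {S T : Type*} [Fintype S] [DecidableEq T] (τ : S → T) {a : S → ℝ}
    (ha : ∀ x, 0 ≤ a x) (z : T) : 0 ≤ pushforward τ a z :=
  Finset.sum_nonneg fun x _ => ha x

theorem le_pushforward {S T : Type*} [Fintype S] [DecidableEq T] (τ : S → T) {a : S → ℝ}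
    (ha : ∀ x, 0 ≤ a x) (x : S) : a x ≤ pushforward τ a (τ x) :=
  Finset.single_le_sum (f := a) (fun y _ => ha y) (by simp)

theorem pushforward_pushforward {S T U : Type*} [Fintype S] [Fintype T] [DecidableEq T]
    [DecidableEq U] (τ : S → T) (σ : T → U) (a : S → ℝ) :
    pushforward σ (pushforward τ a) = pushforward (σ ∘ τ) a := by
  funext z
  simp only [pushforward, Finset.sum_filter, Function.comp]
  have h (t : T) : (if σ t = z then ∑ y, if τ y = t then a y else 0 else 0) =
      ∑ y, if τ y = t then (if σ (τ y) = z then a y else 0) else 0 := by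
    split_ifs with ht
    · refine Finset.sum_congr rfl fun y _ => ?_
      split_ifs <;> simp_all
    · refine (Finset.sum_eq_zero fun y _ => ?_).symm
      split_ifs <;> simp_all
  simp_rw [h]
  rw [Finset.sum_comm]
  simp

theorem pushforward_congr {S T : Type*} [Fintype S] [DecidableEq T] {τ σ : S → T} {a : S → ℝ}
    (h : ∀ x, a x ≠ 0 → τ x = σ x) : pushforward τ a = pushforward σ a := by
  funext z
  simp only [pushforward, Finset.sum_filter]
  refine Finset.sum_congr rfl fun x _ => ?_
  by_cases hx : a x = 0
  · simp [hx]
  · rw [h x hx]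

theorem pushforward_comp_equiv {S S' T : Type*} [Fintype S] [Fintype S'] [DecidableEq T]
    (e : S' ≃ S) (τ : S → T) (a : S → ℝ) :
    pushforward (τ ∘ e) (a ∘ e) = pushforward τ a := by
  funext z
  simp only [pushforward, Finset.sum_filter, Function.comp]
  exact Equiv.sum_comp e fun x => if τ x = z then a x else 0

/-- The conditionally independent coupling of two weight functions over a common base. -/
def coupling {S T U : Type*} [DecidableEq U] (τ : S → U) (σ : T → U) (a : S → ℝ) (b : T → ℝ)
    (c : U → ℝ) (p : S × T) : ℝ :=
  if τ p.1 = σ p.2 then a p.1 * b p.2 / c (τ p.1) else 0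

theorem coupling_swap {S T U : Type*} [DecidableEq U] (τ : S → U) (σ : T → U) (a : S → ℝ)
    (b : T → ℝ) (c : U → ℝ) : coupling σ τ b a c ∘ Prod.swap = coupling τ σ a b c := by
  funext p
  by_cases h : τ p.1 = σ p.2
  · simp [coupling, h, mul_comm]
  · simp [coupling, h, Ne.symm h]

theorem pushforward_fst_coupling {S T U : Type*} [Fintype S] [Fintype T] [DecidableEq S]
    [DecidableEq U] (τ : S → U) (σ : T → U) {a : S → ℝ} {b : T → ℝ} {c : U → ℝ}
    (ha : ∀ x, 0 ≤ a x) (hac : pushforward τ a = c) (hbc : pushforward σ b = c) :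
    pushforward Prod.fst (coupling τ σ a b c) = a := by
  funext x
  have hsum : ∑ y, (if τ x = σ y then a x * b y / c (τ x) else 0) =
      a x / c (τ x) * pushforward σ b (τ x) := by
    rw [pushforward, Finset.sum_filter, Finset.mul_sum]
    refine Finset.sum_congr rfl fun y _ => ?_
    by_cases h : τ x = σ y
    · simp [h]; ring
    · simp [h, Ne.symm h]
  have hle := hac ▸ le_pushforward τ ha x
  rw [pushforward, Finset.sum_filter, Fintype.sum_prod_type, Finset.sum_eq_single x]
  · simp only [coupling, if_true]
    rw [hsum, hbc]
    by_cases hc : c (τ x) = 0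
    · rw [hc] at hle
      simp [hc, le_antisymm hle (ha x)]
    · field_simp
  · intro y _ hy
    simp [hy]
  · simp

theorem pushforward_snd_coupling {S T U : Type*} [Fintype S] [Fintype T] [DecidableEq T]
    [DecidableEq U] (τ : S → U) (σ : T → U) {a : S → ℝ} {b : T → ℝ} {c : U → ℝ}
    (hb : ∀ x, 0 ≤ b x) (hac : pushforward τ a = c) (hbc : pushforward σ b = c) :
    pushforward Prod.snd (coupling τ σ a b c) = b := by
  rw [← coupling_swap]
  exact (pushforward_comp_equiv (Equiv.prodComm S T) Prod.fst _).trans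
    (pushforward_fst_coupling σ τ hb hbc hac)

/-- `τ` witnesses that `(μ₁, κ₁)` refines `(μ₂, κ₂)`, phrased through pushforwards. -/
def IsRefinementMap {S T : Type*} [Fintype S] [DecidableEq T] (μ₁ : S → ℝ) (κ₁ : S → S → ℝ)
    (μ₂ : T → ℝ) (κ₂ : T → T → ℝ) (τ : S → T) : Prop :=
  pushforward τ μ₁ = μ₂ ∧ ∀ x, 0 < μ₁ x → pushforward τ (κ₁ x * μ₁) = κ₂ (τ x) * μ₂

theorem refines_iff_exists_isRefinementMap {m₁ m₂ : ℕ} {μ₁ : Fin m₁ → ℝ}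
    {κ₁ : Fin m₁ → Fin m₁ → ℝ} {μ₂ : Fin m₂ → ℝ} {κ₂ : Fin m₂ → Fin m₂ → ℝ} :
    Refines μ₁ κ₁ μ₂ κ₂ ↔ ∃ τ, IsRefinementMap μ₁ κ₁ μ₂ κ₂ τ := by
  simp only [Refines, IsRefinementMap, funext_iff, pushforward, Pi.mul_apply, eq_comm (a := μ₂ _)]

theorem IsRefinementMap.comp_equiv {S S' T : Type*} [Fintype S] [Fintype S'] [DecidableEq T]
    {μ₁ : S → ℝ} {κ₁ : S → S → ℝ} {μ₂ : T → ℝ} {κ₂ : T → T → ℝ} {τ : S → T}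
    (h : IsRefinementMap μ₁ κ₁ μ₂ κ₂ τ) (e : S' ≃ S) :
    IsRefinementMap (μ₁ ∘ e) (fun x y => κ₁ (e x) (e y)) μ₂ κ₂ (τ ∘ e) :=
  ⟨(pushforward_comp_equiv e τ μ₁).trans h.1, fun x hx =>
    (pushforward_comp_equiv e τ (κ₁ (e x) * μ₁)).trans (h.2 (e x) hx)⟩

/-- The product kernel on a fibre product, normalised by the base kernel. -/
def fiberProductKernel {S T U : Type*} (τ : S → U) (κ₁ : S → S → ℝ) (κ₂ : T → T → ℝ)
    (κc : U → U → ℝ) (p q : S × T) : ℝ :=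
  κ₁ p.1 q.1 * κ₂ p.2 q.2 / κc (τ p.1) (τ q.1)

theorem fiberProductKernel_mul_coupling {S T U : Type*} [DecidableEq U] (τ : S → U) (σ : T → U)
    (μ₁ : S → ℝ) (κ₁ : S → S → ℝ) (μ₂ : T → ℝ) (κ₂ : T → T → ℝ) (μc : U → ℝ)
    (κc : U → U → ℝ) (p : S × T) :
    fiberProductKernel τ κ₁ κ₂ κc p * coupling τ σ μ₁ μ₂ μc =
      coupling τ σ (κ₁ p.1 * μ₁) (κ₂ p.2 * μ₂) (κc (τ p.1) * μc) := by
  funext q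
  simp only [fiberProductKernel, coupling, Pi.mul_apply]
  split_ifs
  · rw [div_mul_div_comm]
    ring
  · simp

theorem pos_and_pos_and_eq_of_coupling_pos {S T U : Type*} [DecidableEq U] {τ : S → U} {σ : T → U}
    {a : S → ℝ} {b : T → ℝ} {c : U → ℝ} (ha : ∀ x, 0 ≤ a x) (hb : ∀ x, 0 ≤ b x) {p : S × T}
    (h : 0 < coupling τ σ a b c p) : 0 < a p.1 ∧ 0 < b p.2 ∧ τ p.1 = σ p.2 := by
  unfold coupling at h
  split_ifs at h with hp
  · refine ⟨(ha _).lt_of_ne ?_, (hb _).lt_of_ne ?_, hp⟩ <;>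
    · intro h0
      simp [← h0] at h
  · exact absurd h (lt_irrefl 0)

theorem exists_common_refinement_of_isRefinementMap {m₁ m₂ n : ℕ} {μ₁ : Fin m₁ → ℝ}
    {κ₁ : Fin m₁ → Fin m₁ → ℝ} {μ₂ : Fin m₂ → ℝ} {κ₂ : Fin m₂ → Fin m₂ → ℝ} {μc : Fin n → ℝ}
    {κc : Fin n → Fin n → ℝ} (h₁ : IsFinKernel μ₁ κ₁) (h₂ : IsFinKernel μ₂ κ₂)
    (hc : IsFinKernel μc κc) {τ : Fin m₁ → Fin n} {σ : Fin m₂ → Fin n}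
    (hτ : IsRefinementMap μ₁ κ₁ μc κc τ) (hσ : IsRefinementMap μ₂ κ₂ μc κc σ) :
    ∃ (m₀ : ℕ) (μ₀ : Fin m₀ → ℝ) (κ₀ : Fin m₀ → Fin m₀ → ℝ),
      IsFinKernel μ₀ κ₀ ∧ Refines μ₀ κ₀ μ₁ κ₁ ∧ Refines μ₀ κ₀ μ₂ κ₂ := by
  obtain ⟨μ₁_nonneg, μ₁_sum, κ₁_symm, κ₁_nonneg⟩ := h₁
  obtain ⟨μ₂_nonneg, -, κ₂_symm, κ₂_nonneg⟩ := h₂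
  obtain ⟨μc_nonneg, -, κc_symm, κc_nonneg⟩ := hc
  set μ := coupling τ σ μ₁ μ₂ μc with hμ
  set κ := fiberProductKernel τ κ₁ κ₂ κc with hκ
  have hfst : IsRefinementMap μ κ μ₁ κ₁ Prod.fst := by
    refine ⟨pushforward_fst_coupling τ σ μ₁_nonneg hτ.1 hσ.1, fun p hp => ?_⟩
    obtain ⟨hp₁, hp₂, hp⟩ := pos_and_pos_and_eq_of_coupling_pos μ₁_nonneg μ₂_nonneg hp
    rw [hκ, hμ, fiberProductKernel_mul_coupling]
    exact pushforward_fst_coupling τ σ (fun x => mul_nonneg (κ₁_nonneg _ _) (μ₁_nonneg x))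
      (hτ.2 _ hp₁) (hp ▸ hσ.2 _ hp₂)
  have hsnd : IsRefinementMap μ κ μ₂ κ₂ Prod.snd := by
    refine ⟨pushforward_snd_coupling τ σ μ₂_nonneg hτ.1 hσ.1, fun p hp => ?_⟩
    obtain ⟨hp₁, hp₂, hp⟩ := pos_and_pos_and_eq_of_coupling_pos μ₁_nonneg μ₂_nonneg hp
    rw [hκ, hμ, fiberProductKernel_mul_coupling]
    exact pushforward_snd_coupling τ σ (fun x => mul_nonneg (κ₂_nonneg _ _) (μ₂_nonneg x))
      (hτ.2 _ hp₁) (hp ▸ hσ.2 _ hp₂)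
  let e : Fin (m₁ * m₂) ≃ Fin m₁ × Fin m₂ := finProdFinEquiv.symm
  refine ⟨m₁ * m₂, μ ∘ e, fun x y => κ (e x) (e y), ⟨fun x => ?_, ?_, fun x y => ?_, fun x y => ?_⟩,
    refines_iff_exists_isRefinementMap.2 ⟨_, hfst.comp_equiv e⟩,
    refines_iff_exists_isRefinementMap.2 ⟨_, hsnd.comp_equiv e⟩⟩
  · simp only [hμ, coupling, Function.comp]
    split_ifs
    · exact div_nonneg (mul_nonneg (μ₁_nonneg _) (μ₂_nonneg _)) (μc_nonneg _)
    · exact le_rfl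
  · rw [← sum_pushforward (Prod.fst ∘ e), (hfst.comp_equiv e).1, μ₁_sum]
  · simp only [hκ, fiberProductKernel]
    rw [κ₁_symm, κ₂_symm, κc_symm]
  · exact div_nonneg (mul_nonneg (κ₁_nonneg _ _) (κ₂_nonneg _ _)) (κc_nonneg _ _)

/-- The pushout of two maps with finite codomains, indexed by some `Fin n`. -/
theorem exists_fin_pushout {R S T : Type*} [Finite S] [Finite T] (f : R → S) (g : R → T) :
    ∃ (n : ℕ) (τ : S → Fin n) (σ : T → Fin n), (∀ u, τ (f u) = σ (g u)) ∧
      ∀ (φ : S → ℝ) (ψ : T → ℝ), (∀ u, φ (f u) = ψ (g u)) →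
        ∃ F : Fin n → ℝ, (∀ x, F (τ x) = φ x) ∧ ∀ y, F (σ y) = ψ y := by
  let r : S ⊕ T → S ⊕ T → Prop := fun p q => ∃ u, p = .inl (f u) ∧ q = .inr (g u)
  obtain ⟨n, ⟨e⟩⟩ := Finite.exists_equiv_fin (Quot r)
  refine ⟨n, fun x => e (Quot.mk r (.inl x)), fun y => e (Quot.mk r (.inr y)),
    fun u => congrArg e (Quot.sound ⟨u, rfl, rfl⟩), fun φ ψ h => ?_⟩
  have hr (p q : S ⊕ T) : r p q → Sum.elim φ ψ p = Sum.elim φ ψ q := by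
    rintro ⟨u, rfl, rfl⟩
    exact h u
  exact ⟨fun z => Quot.lift (Sum.elim φ ψ) hr (e.symm z), by simp, by simp⟩

/-- The average of a kernel over pairs of fibres. -/
def averagedKernel {S T : Type*} [Fintype S] [DecidableEq T] (τ : S → T) (μ : S → ℝ)
    (κ : S → S → ℝ) (C D : T) : ℝ :=
  pushforward τ (fun x => pushforward τ (κ x * μ) D * μ x) C /
    (pushforward τ μ C * pushforward τ μ D)

theorem averagedKernel_symm {S T : Type*} [Fintype S] [DecidableEq T] (τ : S → T) (μ : S → ℝ)
    {κ : S → S → ℝ} (hκ : ∀ x y, κ x y = κ y x) (C D : T) :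
    averagedKernel τ μ κ C D = averagedKernel τ μ κ D C := by
  simp only [averagedKernel]
  congr 1
  · simp only [pushforward, Finset.sum_mul, Pi.mul_apply]
    rw [Finset.sum_comm]
    refine Finset.sum_congr rfl fun x _ => Finset.sum_congr rfl fun y _ => ?_
    rw [hκ]
    ring
  · ring

theorem averagedKernel_mul_pushforward {S T : Type*} [Fintype S] [DecidableEq T] (τ : S → T)
    (μ : S → ℝ) (κ : S → S → ℝ) {F : T → ℝ} {C D : T}
    (hF : ∀ x, F (τ x) = pushforward τ (κ x * μ) D) (hC : pushforward τ μ C ≠ 0)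
    (hD : pushforward τ μ D ≠ 0) :
    averagedKernel τ μ κ C D * pushforward τ μ D = F C := by
  have h : pushforward τ (fun x => pushforward τ (κ x * μ) D * μ x) C =
      F C * pushforward τ μ C := by
    rw [pushforward, pushforward, Finset.mul_sum]
    refine Finset.sum_congr rfl fun x hx => ?_
    rw [← hF, (Finset.mem_filter.1 hx).2]
  rw [averagedKernel, h]
  field_simp

theorem pushforward_mul_eq_zero {S T : Type*} [Fintype S] [DecidableEq T] (τ : S → T)
    {μ : S → ℝ} (hμ : ∀ x, 0 ≤ μ x) (k : S → ℝ) {D : T} (hD : pushforward τ μ D = 0) :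
    pushforward τ (k * μ) D = 0 := by
  refine Finset.sum_eq_zero fun x hx => ?_
  simp [(Finset.sum_eq_zero_iff_of_nonneg fun y _ => hμ y).1 hD x hx]

theorem isRefinementMap_of_factor {S T : Type*} [Fintype S] [DecidableEq T] {τ : S → T}
    {μ : S → ℝ} (hμ : ∀ x, 0 ≤ μ x) {κ : S → S → ℝ} {κc : T → T → ℝ} {F : T → T → ℝ}
    (hF : ∀ D x, F D (τ x) = pushforward τ (κ x * μ) D)
    (hκc : ∀ C D, pushforward τ μ C ≠ 0 → pushforward τ μ D ≠ 0 →
      κc C D * pushforward τ μ D = F D C) :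
    IsRefinementMap μ κ (pushforward τ μ) κc τ := by
  refine ⟨rfl, fun x hx => funext fun D => ?_⟩
  rw [Pi.mul_apply]
  by_cases hD : pushforward τ μ D = 0
  · rw [pushforward_mul_eq_zero τ hμ _ hD, hD, mul_zero]
  · rw [hκc _ _ (hx.trans_le (le_pushforward τ hμ x)).ne' hD, hF]

theorem exists_common_coarsening_of_isRefinementMap {m₀ m₁ m₂ : ℕ} {μ₀ : Fin m₀ → ℝ}
    {κ₀ : Fin m₀ → Fin m₀ → ℝ} {μ₁ : Fin m₁ → ℝ} {κ₁ : Fin m₁ → Fin m₁ → ℝ} {μ₂ : Fin m₂ → ℝ}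
    {κ₂ : Fin m₂ → Fin m₂ → ℝ} (h₀ : IsFinKernel μ₀ κ₀) (h₁ : IsFinKernel μ₁ κ₁)
    (h₂ : IsFinKernel μ₂ κ₂) {π₁ : Fin m₀ → Fin m₁} {π₂ : Fin m₀ → Fin m₂}
    (hπ₁ : IsRefinementMap μ₀ κ₀ μ₁ κ₁ π₁) (hπ₂ : IsRefinementMap μ₀ κ₀ μ₂ κ₂ π₂) :
    ∃ (n : ℕ) (μc : Fin n → ℝ) (κc : Fin n → Fin n → ℝ),
      IsFinKernel μc κc ∧ Refines μ₁ κ₁ μc κc ∧ Refines μ₂ κ₂ μc κc := by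
  obtain ⟨n, τ, σ, hτσ, hfactor⟩ := exists_fin_pushout
    (fun u : {u // 0 < μ₀ u} => π₁ u) (fun u => π₂ u)
  have heq {a : Fin m₀ → ℝ} (ha : ∀ u, μ₀ u = 0 → a u = 0) :
      pushforward τ (pushforward π₁ a) = pushforward σ (pushforward π₂ a) := by
    rw [pushforward_pushforward, pushforward_pushforward]
    exact pushforward_congr fun u hu => hτσ ⟨u, (h₀.1 u).lt_of_ne fun h => hu (ha u h.symm)⟩
  have hμ : pushforward τ μ₁ = pushforward σ μ₂ := by
    rw [← hπ₁.1, ← hπ₂.1, heq fun _ => id]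
  choose F hFτ hFσ using fun D => hfactor (fun x => pushforward τ (κ₁ x * μ₁) D)
    (fun x => pushforward σ (κ₂ x * μ₂) D) fun ⟨u, hu⟩ => by
      rw [← hπ₁.2 u hu, ← hπ₂.2 u hu, heq fun v hv => by simp [hv]]
  have hκ (C D) := averagedKernel_mul_pushforward τ μ₁ κ₁ (C := C) (hFτ D)
  refine ⟨n, pushforward τ μ₁, averagedKernel τ μ₁ κ₁, ⟨pushforward_nonneg τ h₁.1, ?_,
    averagedKernel_symm τ μ₁ h₁.2.2.1, fun C D => ?_⟩,
    refines_iff_exists_isRefinementMap.2 ⟨τ, isRefinementMap_of_factor h₁.1 hFτ hκ⟩,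
    refines_iff_exists_isRefinementMap.2 ⟨σ, ?_⟩⟩
  · rw [sum_pushforward, h₁.2.1]
  · exact div_nonneg (pushforward_nonneg τ (fun x => mul_nonneg (pushforward_nonneg τ
      (fun y => mul_nonneg (h₁.2.2.2 x y) (h₁.1 y)) D) (h₁.1 x)) C)
      (mul_nonneg (pushforward_nonneg τ h₁.1 C) (pushforward_nonneg τ h₁.1 D))
  · rw [hμ] at hκ ⊢
    exact isRefinementMap_of_factor h₂.1 hFσ hκ

/-- Let `κ₁` and `κ₂` be finite-type kernels.  Then the following are
equivalent: (i) there is a finite-type kernel `κ_r` with `κ_r ≺ κ₁` and `κ_r ≺ κ₂`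
(a common refinement); (ii) there is a finite-type kernel `κ_c` with `κ₁ ≺ κ_c` and
`κ₂ ≺ κ_c` (a common coarsening). -/
theorem common_refinement_iff_common_coarsening
    {m₁ m₂ : ℕ} (μ₁ : Fin m₁ → ℝ) (κ₁ : Fin m₁ → Fin m₁ → ℝ)
    (μ₂ : Fin m₂ → ℝ) (κ₂ : Fin m₂ → Fin m₂ → ℝ)
    (h₁ : IsFinKernel μ₁ κ₁) (h₂ : IsFinKernel μ₂ κ₂) :
    (∃ (m₀ : ℕ) (μ₀ : Fin m₀ → ℝ) (κ₀ : Fin m₀ → Fin m₀ → ℝ),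
        IsFinKernel μ₀ κ₀ ∧ Refines μ₀ κ₀ μ₁ κ₁ ∧ Refines μ₀ κ₀ μ₂ κ₂) ↔
      (∃ (mc : ℕ) (μc : Fin mc → ℝ) (κc : Fin mc → Fin mc → ℝ),
        IsFinKernel μc κc ∧ Refines μ₁ κ₁ μc κc ∧ Refines μ₂ κ₂ μc κc) := by
  constructor
  · rintro ⟨m₀, μ₀, κ₀, h₀, hr₁, hr₂⟩
    obtain ⟨π₁, hπ₁⟩ := refines_iff_exists_isRefinementMap.1 hr₁
    obtain ⟨π₂, hπ₂⟩ := refines_iff_exists_isRefinementMap.1 hr₂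
    exact exists_common_coarsening_of_isRefinementMap h₀ h₁ h₂ hπ₁ hπ₂
  · rintro ⟨n, μc, κc, hc, hr₁, hr₂⟩
    obtain ⟨τ, hτ⟩ := refines_iff_exists_isRefinementMap.1 hr₁
    obtain ⟨σ, hσ⟩ := refines_iff_exists_isRefinementMap.1 hr₂
    exact exists_common_refinement_of_isRefinementMap h₁ h₂ hc hτ hσ
end
end

section
/- Let κ₁ and κ₂ be finite-type kernels. Then s(T, κ₁) = s(T, κ₂) for every finite tree T (equivalently, the multi-type Poisson Galton–Watson branching processes associated to κ₁ and κ₂ give the same distribution on rooted trees when types are forgotten) if and only if there is a finite-type kernel κ_c with κ₁ ≺ κ_c and κ₂ ≺ κ_c. -/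
noncomputable section
open scoped Classical

/-- The homomorphism density `s(F,κ)` of a finite graph `F` (on vertex set `Fin k`) in a
finite-type kernel `(μ, κ)`:
`s(F,κ) = Σ_{x : Fin k → S} (∏_{ij ∈ E(F)} κ(x_i,x_j)) (∏_i μ(x_i))`. -/
def sFin {k m : ℕ} (F : SimpleGraph (Fin k)) (μ : Fin m → ℝ)
    (κ : Fin m → Fin m → ℝ) : ℝ :=
  ∑ x : Fin k → Fin m,
    (∏ q ∈ Finset.univ.filter (fun q : Fin k × Fin k => q.1 < q.2 ∧ F.Adj q.1 q.2),
        κ (x q.1) (x q.2)) * ∏ i, μ (x i)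

section WeightedSums

variable {S V W : Type}

/-- The integral operator `f ↦ ∫ K(·, y) f(y) dμ(y)` of a symmetric kernel. -/
def kernelOp [Fintype S] (μ : S → ℝ) (K : Sym2 S → ℝ) (f : S → ℝ) (x : S) : ℝ :=
  ∑ y, K s(x, y) * (f y * μ y)

/-- The homomorphism density of `G` in a symmetric kernel, with a weight function at every
vertex of `G`. -/
def weightedSum [Fintype S] [Fintype V] [DecidableEq V] (μ : S → ℝ) (K : Sym2 S → ℝ)
    (G : SimpleGraph V) (f : V → S → ℝ) : ℝ :=
  ∑ x : V → S, (∏ e : Sym2 V with e ∈ G.edgeSet, K (e.map x)) * ∏ v, f v (x v) * μ (x v)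

theorem weightedSum_iso [Fintype S] [Fintype V] [Fintype W] [DecidableEq V] [DecidableEq W]
    (μ : S → ℝ) (K : Sym2 S → ℝ) {G : SimpleGraph V} {H : SimpleGraph W}
    (φ : G ≃g H) (f : W → S → ℝ) :
    weightedSum μ K G (fun v => f (φ v)) = weightedSum μ K H f := by
  unfold weightedSum
  refine Fintype.sum_equiv (φ.toEquiv.arrowCongr (Equiv.refl S)) _ _ fun x => ?_
  have hx : ∀ v, φ.toEquiv.arrowCongr (Equiv.refl S) x (φ v) = x v := fun v =>
    congrArg x (φ.symm_apply_apply v)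
  congr 1
  · have hφ : Function.Bijective (Sym2.map φ) :=
      Function.bijective_iff_has_inverse.2 ⟨Sym2.map φ.symm,
        fun e => by induction e with | _ a b => simp,
        fun e => by induction e with | _ a b => simp⟩
    refine Finset.prod_bijective (Sym2.map φ) hφ ?_ ?_
    · intro e
      induction e with | _ a b => simpa using (φ.map_adj_iff).symm
    · intro e _
      induction e with | _ a b => simp only [Sym2.map_mk, hx]
  · exact Fintype.prod_equiv φ.toEquiv _ _ fun v => by
      simp only [RelIso.coe_fn_toEquiv, hx]

/-- The graph `G` with a new leaf `none` attached to `u`. -/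
def addLeaf (G : SimpleGraph V) (u : V) : SimpleGraph (Option V) :=
  G.map Function.Embedding.some ⊔ SimpleGraph.edge none (some u)

@[simp]
theorem addLeaf_adj_none_some (G : SimpleGraph V) (u v : V) :
    (addLeaf G u).Adj none (some v) ↔ v = u := by
  rw [addLeaf, SimpleGraph.sup_adj, SimpleGraph.map_adj]
  simp [SimpleGraph.edge_adj, eq_comm]

@[simp]
theorem addLeaf_adj_some_some (G : SimpleGraph V) (u v w : V) :
    (addLeaf G u).Adj (some v) (some w) ↔ G.Adj v w := by
  rw [addLeaf, SimpleGraph.sup_adj, SimpleGraph.map_adj]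
  simp [SimpleGraph.edge_adj]

theorem edgeSet_addLeaf (G : SimpleGraph V) (u : V) :
    (addLeaf G u).edgeSet =
      insert s(none, some u) (Function.Embedding.some.sym2Map '' G.edgeSet) := by
  rw [addLeaf, SimpleGraph.edgeSet_sup, SimpleGraph.edgeSet_map,
    SimpleGraph.edgeSet_edge_of_ne (by simp), Set.union_comm, Set.singleton_union]

theorem mk_none_notMem_image_sym2Map (s : Set (Sym2 V)) (a : Option V) :
    s(none, a) ∉ Function.Embedding.some.sym2Map '' s := by
  rintro ⟨e, -, he⟩
  induction e with | _ b c => simp at he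

theorem prod_edgeSet_addLeaf [Fintype V] (G : SimpleGraph V) (u : V) (F : Sym2 (Option V) → ℝ) :
    ∏ e with e ∈ (addLeaf G u).edgeSet, F e =
      F s(none, some u) * ∏ e with e ∈ G.edgeSet, F (e.map some) := by
  have h : (Finset.univ.filter fun e => e ∈ (addLeaf G u).edgeSet) =
      Finset.cons s(none, some u)
        ((Finset.univ.filter fun e => e ∈ G.edgeSet).map Function.Embedding.some.sym2Map)
        (fun h => mk_none_notMem_image_sym2Map G.edgeSet (some u) (by simpa using h)) := by
    ext e
    simp [edgeSet_addLeaf]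
  rw [h, Finset.prod_cons, Finset.prod_map]
  rfl

theorem weightedSum_addLeaf [Fintype S] [Fintype V] [DecidableEq V] (μ : S → ℝ)
    (K : Sym2 S → ℝ) (G : SimpleGraph V) (u : V) (f : Option V → S → ℝ) :
    weightedSum μ K (addLeaf G u) f =
      weightedSum μ K G
        (fun v => f (some v) * if v = u then kernelOp μ K (f none) else 1) := by
  unfold weightedSum
  rw [← (Equiv.piOptionEquivProd (β := fun _ => S)).symm.sum_comp, Fintype.sum_prod_type,
    Finset.sum_comm]
  refine Finset.sum_congr rfl fun x _ => ?_
  have h : ∏ v, (f (some v) * if v = u then kernelOp μ K (f none) else 1) (x v) * μ (x v) =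
      kernelOp μ K (f none) (x u) * ∏ v, f (some v) (x v) * μ (x v) := by
    have h' : ∀ v, (f (some v) * if v = u then kernelOp μ K (f none) else 1) (x v) * μ (x v) =
        (if v = u then kernelOp μ K (f none) (x v) else 1) * (f (some v) (x v) * μ (x v)) := by
      intro v
      split_ifs <;> simp [mul_comm, mul_left_comm]
    simp_rw [h', Finset.prod_mul_distrib]
    simp
  rw [h, kernelOp, Finset.sum_mul, Finset.mul_sum]
  refine Finset.sum_congr rfl fun a _ => ?_
  rw [prod_edgeSet_addLeaf, Fintype.prod_option]
  have h1 : ∀ e : Sym2 V, (e.map some).map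
      ((Equiv.piOptionEquivProd (β := fun _ => S)).symm (a, x)) = e.map x := by
    intro e
    induction e with | _ b c => simp [Equiv.piOptionEquivProd]
  simp_rw [h1]
  simp only [Equiv.piOptionEquivProd, Equiv.coe_fn_symm_mk, Sym2.map_mk]
  rw [Sym2.eq_swap]
  ring

theorem isTree_addLeaf [Finite V] {G : SimpleGraph V} (hG : G.IsTree) (u : V) :
    (addLeaf G u).IsTree := by
  rw [SimpleGraph.isTree_iff_connected_and_card] at hG ⊢
  refine ⟨(SimpleGraph.connected_iff_exists_forall_reachable _).2 ⟨some u, ?_⟩, ?_⟩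
  · rintro (_ | v)
    · exact (SimpleGraph.Adj.reachable (by simp)).symm
    · exact (hG.1.preconnected u v).map ⟨some, fun {a b} h => by simpa using h⟩
  · have h := hG.2
    rw [Nat.card_coe_set_eq] at h ⊢
    rw [edgeSet_addLeaf, Set.ncard_insert_of_notMem (mk_none_notMem_image_sym2Map _ _),
      Set.ncard_image_of_injective _ (Function.Embedding.injective _), h]
    simp

/-- Every tree with at least two vertices arises from a smaller tree by attaching a leaf. -/
theorem exists_iso_addLeaf [Fintype V] [Nontrivial V] {G : SimpleGraph V} (hG : G.IsTree) :
    ∃ (v : V) (H : SimpleGraph {a // a ≠ v}) (u : {a // a ≠ v}),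
      H.IsTree ∧ Nonempty (addLeaf H u ≃g G) := by
  obtain ⟨v, hv⟩ := hG.exists_vert_degree_one_of_nontrivial
  obtain ⟨u, hu⟩ := Finset.card_eq_one.1 hv
  have hadj : ∀ w, G.Adj v w ↔ w = u := fun w => by
    rw [← SimpleGraph.mem_neighborFinset, hu, Finset.mem_singleton]
  have huv : u ≠ v := ((hadj u).2 rfl).ne'
  refine ⟨v, G.induce {a | a ≠ v}, ⟨u, huv⟩,
    ⟨hG.1.induce_compl_singleton_of_degree_eq_one hv, hG.2.induce _⟩,
    ⟨⟨Equiv.optionSubtypeNe v, ?_⟩⟩⟩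
  rintro (_ | a) (_ | b)
  · simp
  · simp [hadj, Subtype.ext_iff]
  · rw [SimpleGraph.adj_comm, SimpleGraph.adj_comm (addLeaf _ _)]
    simp [hadj, Subtype.ext_iff]
  · simp

theorem weightedSum_of_subsingleton [Fintype S] [Fintype V] [DecidableEq V] [Subsingleton V]
    (μ : S → ℝ) (K : Sym2 S → ℝ) (G : SimpleGraph V) (f : V → S → ℝ) (v : V) :
    weightedSum μ K G f = ∑ x, f v x * μ x := by
  have hG : ∀ e, e ∉ G.edgeSet := fun e => by
    induction e with | _ a b => simp [Subsingleton.elim a b]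
  have : Unique V := ⟨⟨v⟩, fun _ => Subsingleton.elim _ _⟩
  unfold weightedSum
  refine Fintype.sum_equiv (Equiv.funUnique V S) _ _ fun x => ?_
  simp [hG, Subsingleton.elim default v]

end WeightedSums

theorem sFin_eq_weightedSum {k m : ℕ} (F : SimpleGraph (Fin k)) (μ : Fin m → ℝ)
    (κ : Fin m → Fin m → ℝ) (hκ : ∀ x y, κ x y = κ y x) :
    sFin F μ κ = weightedSum μ (Sym2.lift ⟨κ, hκ⟩) F 1 := by
  unfold sFin weightedSum
  refine Finset.sum_congr (Finset.ext fun _ => by simp) fun x _ => ?_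
  congr 1
  · refine Finset.prod_bij (fun q _ => s(q.1, q.2)) ?_ ?_ ?_ ?_
    · simp
    · simp only [Finset.mem_filter, Finset.mem_univ, true_and, Sym2.eq_iff]
      rintro ⟨a, b⟩ h ⟨c, d⟩ h' (e | e)
      · exact Prod.ext e.1 e.2
      · exact absurd h'.1 (by rw [← e.1, ← e.2]; exact h.1.le.not_gt)
    · intro e he
      induction e with | _ a b =>
      have hab : F.Adj a b := by simpa using he
      rcases lt_or_gt_of_ne hab.ne with h | h
      · exact ⟨(a, b), by simp [h, hab], rfl⟩
      · exact ⟨(b, a), by simp [h, hab.symm], Sym2.eq_swap⟩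
    · simp
  · simp

section Coarsening

variable {S S' : Type} [Fintype S] [Fintype S'] [DecidableEq S'] {μ : S → ℝ}
  {K : Sym2 S → ℝ} {μ' : S' → ℝ} {K' : Sym2 S' → ℝ}

theorem sum_comp_mul_eq_sum_fiber {τ : S → S'} {f : S → ℝ} {f' : S' → ℝ} (hμ : ∀ x, 0 ≤ μ x)
    (hf : ∀ x, 0 < μ x → f x = f' (τ x)) (k : S → ℝ) :
    ∑ x, k x * (f x * μ x) = ∑ z, f' z * ∑ x with τ x = z, k x * μ x := by
  rw [← Finset.sum_fiberwise Finset.univ τ]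
  refine Finset.sum_congr rfl fun z _ => ?_
  rw [Finset.mul_sum]
  refine Finset.sum_congr rfl fun x hx => ?_
  obtain rfl := (Finset.mem_filter.1 hx).2
  rcases (hμ x).eq_or_lt with h | h
  · simp [← h]
  · rw [hf x h]
    ring

/-- Weighted tree densities are preserved by passing to a coarser kernel. -/
theorem weightedSum_eq_of_coarsening {τ : S → S'} (hμ : ∀ x, 0 ≤ μ x)
    (hτ : ∀ z, μ' z = ∑ y with τ y = z, μ y)
    (hK : ∀ x, 0 < μ x → ∀ z, ∑ y with τ y = z, K s(x, y) * μ y = K' s(τ x, z) * μ' z)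
    (n : ℕ) : ∀ (V : Type) [Fintype V] [DecidableEq V] (G : SimpleGraph V), Fintype.card V = n →
      G.IsTree → ∀ (f : V → S → ℝ) (f' : V → S' → ℝ),
      (∀ v x, 0 < μ x → f v x = f' v (τ x)) →
      weightedSum μ K G f = weightedSum μ' K' G f' := by
  induction n with
  | zero =>
    intro V _ _ G hV hG
    have := hG.1.nonempty
    exact absurd hV Fintype.card_ne_zero
  | succ n ih =>
    intro V _ _ G hV hG f f' hf
    rcases subsingleton_or_nontrivial V with hs | hs
    · have := hG.1.nonempty
      let v := Classical.arbitrary V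
      rw [weightedSum_of_subsingleton μ K G f v, weightedSum_of_subsingleton μ' K' G f' v]
      simpa [← hτ] using sum_comp_mul_eq_sum_fiber hμ (hf v) 1
    · obtain ⟨v, H, u, hH, ⟨φ⟩⟩ := exists_iso_addLeaf hG
      rw [← weightedSum_iso μ K φ, ← weightedSum_iso μ' K' φ, weightedSum_addLeaf,
        weightedSum_addLeaf]
      refine ih _ H ?_ hH _ _ fun w x hx => ?_
      · have := Fintype.card_congr (Equiv.optionSubtypeNe v)
        rw [Fintype.card_option] at this
        omega
      · have hop : kernelOp μ K (f (φ none)) x = kernelOp μ' K' (f' (φ none)) (τ x) := by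
          unfold kernelOp
          rw [sum_comp_mul_eq_sum_fiber hμ (hf (φ none))]
          simp_rw [hK x hx]
          exact Finset.sum_congr rfl fun z _ => by ring
        simp only [Pi.mul_apply, hf _ x hx]
        split_ifs
        · rw [hop]
        · rfl

end Coarsening

/-- Finite rooted trees, built from a single vertex by joining the root of a second tree to the
root of the first one. -/
inductive BranchingTree
  | single
  | graft (a b : BranchingTree)

namespace BranchingTree

/-- The number of edges. -/
def size : BranchingTree → ℕ
  | single => 0
  | graft a b => a.size + b.size + 1

/-- The tree obtained by identifying the roots of two rooted trees. -/
def mul (a : BranchingTree) : BranchingTree → BranchingTree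
  | single => a
  | graft b c => graft (mul a b) c

variable {S : Type} [Fintype S]

/-- The homomorphism density of a rooted tree, as a function of the type of the root. -/
def eval (μ : S → ℝ) (K : Sym2 S → ℝ) : BranchingTree → S → ℝ
  | single => 1
  | graft a b => a.eval μ K * kernelOp μ K (b.eval μ K)

theorem eval_mul (μ : S → ℝ) (K : Sym2 S → ℝ) (a b : BranchingTree) :
    (a.mul b).eval μ K = a.eval μ K * b.eval μ K := by
  induction b with
  | single => simp [mul, eval]
  | graft b c ih => simp [mul, eval, ih, mul_assoc]

end BranchingTree

open BranchingTree

section Separation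

variable {S S' : Type} [Fintype S] [Fintype S'] {μ : S → ℝ} {K : Sym2 S → ℝ} {μ' : S' → ℝ}
  {K' : Sym2 S' → ℝ}

/-- Equality of all tree densities implies equality of the densities weighted by rooted trees. -/
theorem weightedSum_eval_eq
    (h : ∀ (k : ℕ) (T : SimpleGraph (Fin k)), T.IsTree →
      weightedSum μ K T 1 = weightedSum μ' K' T 1) (n : ℕ) :
    ∀ (V : Type) [Fintype V] [DecidableEq V] (G : SimpleGraph V) (t : V → BranchingTree),
      ∑ v, (t v).size ≤ n → G.IsTree →
      weightedSum μ K G (fun v => (t v).eval μ K) =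
        weightedSum μ' K' G (fun v => (t v).eval μ' K') := by
  induction n with
  | zero =>
    intro V _ _ G t ht hG
    have hs : ∀ v, t v = single := fun v => by
      have hv : (t v).size = 0 := by simpa using (Finset.sum_eq_zero_iff.1 (Nat.le_zero.1 ht)) v
      cases hc : t v with
      | single => rfl
      | graft a b => simp [hc, size] at hv
    let φ := SimpleGraph.Iso.map (Fintype.equivFin V) G
    have := h _ _ (φ.isTree_iff.1 hG)
    rw [← weightedSum_iso μ K φ, ← weightedSum_iso μ' K' φ] at this
    simpa only [hs, eval, Pi.one_apply] using this
  | succ n ih =>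
    intro V _ _ G t ht hG
    by_cases hs : ∀ v, t v = single
    · refine ih V G t ?_ hG
      simp [hs, size]
    push Not at hs
    obtain ⟨u, hu⟩ := hs
    cases hc : t u with
    | single => exact absurd hc hu
    | graft a b =>
    let t' : Option V → BranchingTree := fun w => w.elim b (Function.update t u a)
    have heval : ∀ {R : Type} [Fintype R] (ν : R → ℝ) (L : Sym2 R → ℝ),
        weightedSum ν L (addLeaf G u) (fun w => (t' w).eval ν L) =
          weightedSum ν L G (fun w => (t w).eval ν L) := by
      intro R _ ν L
      rw [weightedSum_addLeaf]
      congr 1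
      funext w
      by_cases hw : w = u
      · subst hw
        simp [t', hc, eval]
      · simp [t', hw]
    rw [← heval, ← heval]
    refine ih _ _ t' ?_ (isTree_addLeaf hG u)
    have h1 : ∀ s : V → BranchingTree, ∑ v, (s v).size =
        (s u).size + ∑ v ∈ Finset.univ.erase u, (s v).size := fun s =>
      (Finset.add_sum_erase _ _ (Finset.mem_univ u)).symm
    have h2 : ∑ v ∈ Finset.univ.erase u, (Function.update t u a v).size =
        ∑ v ∈ Finset.univ.erase u, (t v).size :=
      Finset.sum_congr rfl fun v hv => by rw [Function.update_of_ne (Finset.ne_of_mem_erase hv)]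
    rw [h1, hc, size] at ht
    rw [Fintype.sum_option]
    simp only [t', Option.elim]
    rw [h1, h2, Function.update_self]
    omega

theorem sum_eval_eq
    (h : ∀ (k : ℕ) (T : SimpleGraph (Fin k)), T.IsTree →
      weightedSum μ K T 1 = weightedSum μ' K' T 1) (t : BranchingTree) :
    ∑ x, t.eval μ K x * μ x = ∑ x, t.eval μ' K' x * μ' x := by
  have := weightedSum_eval_eq h _ Unit ⊥ (fun _ => t) le_rfl .of_subsingleton
  rwa [weightedSum_of_subsingleton _ _ _ _ (), weightedSum_of_subsingleton _ _ _ _ ()] at this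

/-- The indicator of a set of points that a subalgebra does not separate from `x` lies in the
subalgebra. -/
theorem indicator_mem_subalgebra {Ω : Type} [Finite Ω] (A : Subalgebra ℝ (Ω → ℝ)) (x : Ω) :
    (fun y => if ∀ f ∈ A, f y = f x then (1 : ℝ) else 0) ∈ A := by
  have := Fintype.ofFinite Ω
  have hsep : ∀ y, ∃ g ∈ A, (∀ w, (∀ f ∈ A, f w = f x) → g w = 1) ∧
      ((¬ ∀ f ∈ A, f y = f x) → g y = 0) := by
    intro y
    by_cases hy : ∀ f ∈ A, f y = f x
    · exact ⟨1, one_mem A, fun _ _ => rfl, fun h => absurd hy h⟩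
    · push Not at hy
      obtain ⟨f, hf, hne⟩ := hy
      refine ⟨(f x - f y)⁻¹ • (f - algebraMap ℝ (Ω → ℝ) (f y)),
        A.smul_mem (A.sub_mem hf (A.algebraMap_mem _)) _, fun w hw => ?_, fun _ => ?_⟩
      · simp [hw f hf, inv_mul_cancel₀ (sub_ne_zero.2 hne.symm)]
      · simp
  choose g hg h1 h0 using hsep
  convert A.prod_mem fun y (_ : y ∈ (Finset.univ : Finset Ω)) => hg y using 1
  funext w
  rw [Finset.prod_apply]
  split_ifs with hw
  · exact (Finset.prod_eq_one fun y _ => h1 y w hw).symm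
  · exact (Finset.prod_eq_zero (f := fun y => g y w) (Finset.mem_univ w) (h0 w hw)).symm

variable (μ K μ' K') in
/-- The homomorphism density of a rooted tree on the disjoint union of two kernels. -/
def evalSum (t : BranchingTree) : S ⊕ S' → ℝ :=
  Sum.elim (t.eval μ K) (t.eval μ' K')

variable (μ K μ' K') in
/-- The algebra spanned by the rooted tree densities on the disjoint union of two kernels. -/
def treeAlgebra : Subalgebra ℝ (S ⊕ S' → ℝ) :=
  Algebra.adjoin ℝ (Set.range (evalSum μ K μ' K'))

theorem evalSum_mem (t : BranchingTree) : evalSum μ K μ' K' t ∈ treeAlgebra μ K μ' K' :=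
  Algebra.subset_adjoin ⟨t, rfl⟩

theorem toSubmodule_treeAlgebra :
    Subalgebra.toSubmodule (treeAlgebra μ K μ' K') =
      Submodule.span ℝ (Set.range (evalSum μ K μ' K')) := by
  refine Algebra.adjoin_eq_span_of_subset ℝ fun f hf => Submodule.subset_span ?_
  induction hf using Submonoid.closure_induction with
  | mem f hf => exact hf
  | one => exact ⟨single, by funext x; cases x <;> rfl⟩
  | mul f g _ _ hf hg =>
    obtain ⟨a, rfl⟩ := hf
    obtain ⟨b, rfl⟩ := hg
    exact ⟨a.mul b, by funext x; cases x <;> simp [evalSum, eval_mul]⟩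

theorem treeAlgebra_induction {p : (S ⊕ S' → ℝ) → Prop}
    (heval : ∀ t, p (evalSum μ K μ' K' t)) (hadd : ∀ f g, p f → p g → p (f + g))
    (hsmul : ∀ (c : ℝ) f, p f → p (c • f)) {f : S ⊕ S' → ℝ}
    (hf : f ∈ treeAlgebra μ K μ' K') : p f := by
  rw [← Subalgebra.mem_toSubmodule, toSubmodule_treeAlgebra] at hf
  induction hf using Submodule.span_induction with
  | mem f hf =>
    obtain ⟨t, rfl⟩ := hf
    exact heval t
  | zero => simpa using hsmul 0 _ (heval single)
  | add f g _ _ hf hg => exact hadd f g hf hg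
  | smul c f _ hf => exact hsmul c f hf

theorem sum_eq_of_mem_treeAlgebra
    (h : ∀ (k : ℕ) (T : SimpleGraph (Fin k)), T.IsTree →
      weightedSum μ K T 1 = weightedSum μ' K' T 1) {f : S ⊕ S' → ℝ}
    (hf : f ∈ treeAlgebra μ K μ' K') :
    ∑ x, f (.inl x) * μ x = ∑ x, f (.inr x) * μ' x := by
  refine treeAlgebra_induction (p := fun f => ∑ x, f (.inl x) * μ x = ∑ x, f (.inr x) * μ' x)
    (sum_eval_eq h) (fun f g hf hg => ?_) (fun c f hf => ?_) hf
  · simp only [Pi.add_apply, add_mul, Finset.sum_add_distrib, hf, hg]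
  · simp only [Pi.smul_apply, smul_eq_mul, mul_assoc, ← Finset.mul_sum, hf]

theorem kernelOp_add (f g : S → ℝ) :
    kernelOp μ K (f + g) = kernelOp μ K f + kernelOp μ K g := by
  funext x
  simp [kernelOp, add_mul, mul_add, Finset.sum_add_distrib]

theorem kernelOp_smul (c : ℝ) (f : S → ℝ) : kernelOp μ K (c • f) = c • kernelOp μ K f := by
  funext x
  simp [kernelOp, Finset.mul_sum, mul_assoc, mul_left_comm]

theorem kernelOp_mem_treeAlgebra {f : S ⊕ S' → ℝ} (hf : f ∈ treeAlgebra μ K μ' K') :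
    Sum.elim (kernelOp μ K (f ∘ .inl)) (kernelOp μ' K' (f ∘ .inr)) ∈ treeAlgebra μ K μ' K' := by
  refine treeAlgebra_induction (p := fun f => Sum.elim (kernelOp μ K (f ∘ .inl))
    (kernelOp μ' K' (f ∘ .inr)) ∈ treeAlgebra μ K μ' K') (fun t => ?_) (fun f g hf hg => ?_)
    (fun c f hf => ?_) hf
  · convert evalSum_mem (single.graft t) using 1
    funext x
    cases x <;> simp [evalSum, eval]
  · convert add_mem hf hg using 1
    funext x
    cases x <;> simp [Pi.add_comp, kernelOp_add]
  · convert Subalgebra.smul_mem _ hf c using 1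
    funext x
    cases x <;> simp [Pi.smul_comp, kernelOp_smul]

/-- The type classes of two kernels with equal tree densities: the quotient identifying types
which have the same rooted tree densities. -/
theorem exists_class_map
    (h : ∀ (k : ℕ) (T : SimpleGraph (Fin k)), T.IsTree →
      weightedSum μ K T 1 = weightedSum μ' K' T 1) :
    ∃ (n : ℕ) (c : S → Fin n) (c' : S' → Fin n) (D : Fin n → Fin n → ℝ),
      (∀ z, ∑ x with c x = z, μ x = ∑ x with c' x = z, μ' x) ∧
      (∀ x z, ∑ y with c y = z, K s(x, y) * μ y = D (c x) z) ∧
      (∀ x z, ∑ y with c' y = z, K' s(x, y) * μ' y = D (c' x) z) := by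
  let A := treeAlgebra μ K μ' K'
  let r : Setoid (S ⊕ S') :=
    ⟨fun x y => ∀ f ∈ A, f x = f y, fun _ _ _ => rfl, fun h f hf => (h f hf).symm,
      fun h h' f hf => (h f hf).trans (h' f hf)⟩
  let e := Fintype.equivFin (Quotient r)
  let c : S ⊕ S' → Fin (Fintype.card (Quotient r)) := fun x => e ⟦x⟧
  have hc : ∀ x y, c x = c y ↔ ∀ f ∈ A, f x = f y := fun x y =>
    e.injective.eq_iff.trans Quotient.eq
  have hsurj : Function.Surjective c := e.surjective.comp Quotient.mk_surjective
  choose rep hrep using hsurj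
  have hind : ∀ z, (fun y => if c y = z then (1 : ℝ) else 0) ∈ A := fun z => by
    have := indicator_mem_subalgebra A (rep z)
    simp_rw [← hc, hrep] at this
    exact this
  let D z := Sum.elim (kernelOp μ K ((fun y => if c y = z then (1 : ℝ) else 0) ∘ .inl))
    (kernelOp μ' K' ((fun y => if c y = z then (1 : ℝ) else 0) ∘ .inr))
  have hD : ∀ x z, D z x = D z (rep (c x)) := fun x z =>
    (hc _ _).1 (hrep (c x)).symm _ (kernelOp_mem_treeAlgebra (hind z))
  refine ⟨_, c ∘ .inl, c ∘ .inr, fun w z => D z (rep w), fun z => ?_, fun x z => ?_,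
    fun x z => ?_⟩
  · simpa [Finset.sum_filter] using sum_eq_of_mem_treeAlgebra h (hind z)
  · refine Eq.trans ?_ (hD (.inl x) z)
    simp [D, kernelOp, Finset.sum_filter]
  · refine Eq.trans ?_ (hD (.inr x) z)
    simp [D, kernelOp, Finset.sum_filter]

end Separation

/-- Let `κ₁` and `κ₂` be finite-type kernels.  Then `s(T,κ₁) = s(T,κ₂)`
for every finite tree `T` (a finite connected acyclic graph) if and only if there is a
finite-type kernel `κ_c` with `κ₁ ≺ κ_c` and `κ₂ ≺ κ_c`. -/
theorem tree_counts_eq_iff_common_coarsening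
    {m₁ m₂ : ℕ} (μ₁ : Fin m₁ → ℝ) (κ₁ : Fin m₁ → Fin m₁ → ℝ)
    (μ₂ : Fin m₂ → ℝ) (κ₂ : Fin m₂ → Fin m₂ → ℝ)
    (h₁ : IsFinKernel μ₁ κ₁) (h₂ : IsFinKernel μ₂ κ₂) :
    (∀ (k : ℕ) (T : SimpleGraph (Fin k)), T.Connected → T.IsAcyclic →
        sFin T μ₁ κ₁ = sFin T μ₂ κ₂) ↔
      (∃ (mc : ℕ) (μc : Fin mc → ℝ) (κc : Fin mc → Fin mc → ℝ),
        IsFinKernel μc κc ∧ Refines μ₁ κ₁ μc κc ∧ Refines μ₂ κ₂ μc κc) := by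
  obtain ⟨hμ₁, hsum₁, hκ₁, hpos₁⟩ := h₁
  obtain ⟨hμ₂, hsum₂, hκ₂, hpos₂⟩ := h₂
  simp_rw [sFin_eq_weightedSum _ _ _ hκ₁, sFin_eq_weightedSum _ _ _ hκ₂]
  constructor
  · intro h
    obtain ⟨n, c₁, c₂, D, hμ, hD₁, hD₂⟩ := exists_class_map fun k T hT => h k T hT.1 hT.2
    simp only [Sym2.lift_mk] at hD₁ hD₂
    let μc : Fin n → ℝ := fun z => ∑ x with c₁ x = z, μ₁ x
    have hsymm : ∀ w z, μc w * D w z = μc z * D z w := by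
      have : ∀ w z, μc w * D w z =
          ∑ x with c₁ x = w, ∑ y with c₁ y = z, κ₁ x y * (μ₁ x * μ₁ y) := by
        intro w z
        rw [Finset.sum_mul]
        refine Finset.sum_congr rfl fun x hx => ?_
        rw [← (Finset.mem_filter.1 hx).2, ← hD₁, Finset.mul_sum]
        exact Finset.sum_congr rfl fun y _ => by ring
      intro w z
      rw [this, this, Finset.sum_comm]
      refine Finset.sum_congr rfl fun x _ => Finset.sum_congr rfl fun y _ => ?_
      rw [hκ₁ y x, mul_comm (μ₁ y)]
    have hμc : ∀ z, 0 ≤ μc z := fun z => Finset.sum_nonneg fun x _ => hμ₁ x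
    have hDpos : ∀ w z, 0 ≤ μc w * D w z := by
      intro w z
      rw [Finset.sum_mul]
      refine Finset.sum_nonneg fun x hx => mul_nonneg (hμ₁ x) ?_
      rw [← (Finset.mem_filter.1 hx).2, ← hD₁]
      exact Finset.sum_nonneg fun y _ => mul_nonneg (hpos₁ x y) (hμ₁ y)
    have hpos : ∀ {m : ℕ} {μ : Fin m → ℝ} {c : Fin m → Fin n}, (∀ x, 0 ≤ μ x) →
        (∀ z, μc z = ∑ x with c x = z, μ x) → ∀ x, 0 < μ x → μc (c x) ≠ 0 := by
      intro m μ c hμ hc x hx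
      rw [hc]
      exact (hx.trans_le (Finset.single_le_sum (fun y _ => hμ y) (by simp))).ne.symm
    -- `κc w z = D w z / μc z`, written so that symmetry is visible
    let κc : Fin n → Fin n → ℝ := fun w z => μc w * D w z / (μc w * μc z)
    have href : ∀ {m : ℕ} {μ : Fin m → ℝ} {κ : Fin m → Fin m → ℝ} {c : Fin m → Fin n},
        (∀ x, 0 ≤ μ x) → (∀ z, μc z = ∑ x with c x = z, μ x) →
        (∀ x z, ∑ y with c y = z, κ x y * μ y = D (c x) z) → Refines μ κ μc κc := by
      intro m μ κ c hμ hc hD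
      refine ⟨c, hc, fun x hx z => ?_⟩
      have hx' := hpos hμ hc x hx
      by_cases hz : μc z = 0
      · rw [hz, mul_zero]
        rw [hc, Finset.sum_eq_zero_iff_of_nonneg fun y _ => hμ y] at hz
        exact Finset.sum_eq_zero fun y hy => by rw [hz y hy, mul_zero]
      · rw [hD]
        simp only [κc]
        field_simp
    refine ⟨n, μc, κc, ⟨hμc, ?_, fun w z => ?_, fun w z => ?_⟩,
      href hμ₁ (fun _ => rfl) hD₁, href hμ₂ hμ hD₂⟩
    · rw [← hsum₁]
      exact Finset.sum_fiberwise Finset.univ c₁ μ₁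
    · simp only [κc]
      rw [hsymm, mul_comm (μc w)]
    · exact div_nonneg (hDpos w z) (mul_nonneg (hμc w) (hμc z))
  · rintro ⟨mc, μc, κc, ⟨-, -, hκc, -⟩, ⟨τ₁, hτ₁, hK₁⟩, ⟨τ₂, hτ₂, hK₂⟩⟩ k T hT hT'
    rw [weightedSum_eq_of_coarsening (K' := Sym2.lift ⟨κc, hκc⟩) (τ := τ₁) hμ₁ hτ₁ hK₁ _ _ T
        rfl ⟨hT, hT'⟩ 1 1 fun _ _ _ => rfl,
      weightedSum_eq_of_coarsening (K' := Sym2.lift ⟨κc, hκc⟩) (τ := τ₂) hμ₂ hτ₂ hK₂ _ _ T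
        rfl ⟨hT, hT'⟩ 1 1 fun _ _ _ => rfl]
end
end
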